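/- arXiv:2007.14623 — 6 statements merged into one kernel-verified Lean document; each statement's English description precedes it below -/
import Mathlib

section
/- Let G be a K_4-free graph on n vertices with exactly cn² edges. Suppose there is a partition A ∪ B = V(G) such that e(A,B) > (9/4)c²n². Then G contains a vertex set of size ⌊n/2⌋ that spans strictly fewer than n²/18 edges. -/
open Finset

/-- Number of edges of `G` with both endpoints in `S`. -/
def edgesIn {V : Type*} [Fintype V] [DecidableEq V] (G : SimpleGraph V) [DecidableRel G.Adj]
    (S : Finset V) : ℕ :=
  (G.edgeFinset.filter fun e => ∀ v ∈ e, v ∈ S).card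

/-- Number of edges of `G` with one endpoint in `A` and the other in `B`. -/
def edgesBetween {V : Type*} [Fintype V] [DecidableEq V] (G : SimpleGraph V) [DecidableRel G.Adj]
    (A B : Finset V) : ℕ :=
  (G.edgeFinset.filter fun e => ∃ a ∈ A, ∃ b ∈ B, e = s(a, b)).card

/-- Deleting a suitable vertex from `S` does not increase a rescaled linear plus quadratic weight
beyond its average. -/
theorem exists_erase_weight_le {V : Type*} [DecidableEq V] (f : V → ℝ) (w : V → V → ℝ)
    (hdiag : ∀ v, w v v = 0) (p q : ℝ) {S : Finset V} (hS : S.Nonempty) :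
    ∃ v ∈ S, (S.card : ℝ) * (p * ∑ u ∈ S.erase v, f u
        + q * ∑ u ∈ S.erase v, ∑ x ∈ S.erase v, w u x)
      ≤ p * ((S.card - 1) * ∑ u ∈ S, f u) + q * ((S.card - 2) * ∑ u ∈ S, ∑ x ∈ S, w u x) := by
  have hf : ∀ v ∈ S, ∑ u ∈ S.erase v, f u = (∑ u ∈ S, f u) - f v := fun v hv => by
    rw [← Finset.add_sum_erase S f hv]; ring
  have hw : ∀ v ∈ S, ∑ u ∈ S.erase v, ∑ x ∈ S.erase v, w u x
      = (∑ u ∈ S, ∑ x ∈ S, w u x) - (∑ x ∈ S, w v x) - ∑ u ∈ S, w u v := fun v hv => by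
    have h1 : ∀ u, ∑ x ∈ S.erase v, w u x = (∑ x ∈ S, w u x) - w u v := fun u => by
      rw [← Finset.add_sum_erase S (w u) hv]; ring
    simp only [h1]
    have h2 := Finset.add_sum_erase S (fun u => (∑ x ∈ S, w u x) - w u v) hv
    simp only [hdiag, Finset.sum_sub_distrib] at h2 ⊢
    linarith
  have key : ∑ v ∈ S, (S.card : ℝ) * (p * ∑ u ∈ S.erase v, f u
        + q * ∑ u ∈ S.erase v, ∑ x ∈ S.erase v, w u x)
      ≤ ∑ _v ∈ S, (p * ((S.card - 1) * ∑ u ∈ S, f u)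
        + q * ((S.card - 2) * ∑ u ∈ S, ∑ x ∈ S, w u x)) := by
    rw [Finset.sum_congr rfl fun v hv => by rw [hf v hv, hw v hv]]
    rw [← Finset.mul_sum, Finset.sum_add_distrib, ← Finset.mul_sum, ← Finset.mul_sum]
    simp only [Finset.sum_sub_distrib, Finset.sum_const, nsmul_eq_mul]
    rw [Finset.sum_comm (f := fun v u => w u v)]
    apply le_of_eq
    ring
  exact Finset.exists_le_of_sum_le hS key

/-- Some `k`-subset of `A` has at most the expected linear plus quadratic weight of a random
`k`-subset. -/
theorem exists_subset_card_eq_weight_le {V : Type*} [DecidableEq V] (f : V → ℝ)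
    (w : V → V → ℝ) (hdiag : ∀ v, w v v = 0) (hw : ∀ u v, 0 ≤ w u v) {A : Finset V} {k : ℕ}
    (hk : k ≤ A.card) :
    ∃ S ⊆ A, S.card = k ∧ (∑ u ∈ S, f u) + ∑ u ∈ S, ∑ v ∈ S, w u v
      ≤ (k / A.card : ℝ) * ∑ u ∈ A, f u
        + (k / A.card : ℝ) ^ 2 * ∑ u ∈ A, ∑ v ∈ A, w u v := by
  rcases Nat.eq_zero_or_pos k with rfl | hk0
  · exact ⟨∅, by simp, by simp, by simp⟩
  obtain ⟨d, hd⟩ := Nat.exists_eq_add_of_le hk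
  induction d generalizing A with
  | zero =>
    have hc : A.card = k := by omega
    refine ⟨A, subset_rfl, hc, ?_⟩
    have : (k : ℝ) ≠ 0 := by positivity
    rw [hc, div_self this]
    simp
  | succ d ih =>
    have hA : A.Nonempty := Finset.card_pos.mp (by omega)
    set s : ℝ := (A.card : ℝ) with hs
    have hs2 : 2 ≤ s := by rw [hs]; exact_mod_cast (by omega : 2 ≤ A.card)
    obtain ⟨v, hv, hle⟩ := exists_erase_weight_le f w hdiag (k / (s - 1)) ((k / (s - 1)) ^ 2) hA
    have hcard := Finset.card_erase_of_mem hv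
    obtain ⟨S, hSA, hSk, hS⟩ := ih (A := A.erase v) (by omega) (by omega)
    refine ⟨S, hSA.trans (Finset.erase_subset _ _), hSk, hS.trans ?_⟩
    have hc : ((A.erase v).card : ℝ) = s - 1 := by
      rw [hcard, Nat.cast_sub (by omega), Nat.cast_one]
    rw [hc]
    rw [← hs] at hle
    have hW : 0 ≤ ∑ u ∈ A, ∑ x ∈ A, w u x :=
      Finset.sum_nonneg fun u _ => Finset.sum_nonneg fun x _ => hw u x
    generalize (∑ u ∈ A, ∑ x ∈ A, w u x) = W at *
    generalize (∑ u ∈ A, f u) = F at *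
    have hs1 : 0 < s - 1 := by linarith
    have hs0 : 0 < s := by linarith
    refine le_of_mul_le_mul_left (hle.trans ?_) hs0
    have e1 : (k : ℝ) / (s - 1) * ((s - 1) * F) = s * (k / s * F) := by field_simp
    have e2 : ((k : ℝ) / (s - 1)) ^ 2 * ((s - 2) * W) ≤ s * ((k / s) ^ 2 * W) := by
      have : s * ((k / s) ^ 2 * W) - ((k : ℝ) / (s - 1)) ^ 2 * ((s - 2) * W)
          = k ^ 2 * W / (s * (s - 1) ^ 2) := by
        field_simp
        ring
      have h0 : 0 ≤ k ^ 2 * W / (s * (s - 1) ^ 2) := by positivity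
      linarith
    linarith

theorem two_mul_edgesIn {V : Type*} [Fintype V] [DecidableEq V] (G : SimpleGraph V)
    [DecidableRel G.Adj] (S : Finset V) :
    2 * (edgesIn G S : ℝ) = ∑ u ∈ S, ∑ v ∈ S, if G.Adj u v then (1 : ℝ) else 0 := by
  classical
  let H : SimpleGraph V :=
    { Adj := fun u v => G.Adj u v ∧ u ∈ S ∧ v ∈ S
      symm := ⟨fun u v h => ⟨h.1.symm, h.2.2, h.2.1⟩⟩
      loopless := ⟨fun u h => G.loopless.irrefl u h.1⟩ }
  have hH : (G.edgeFinset.filter fun e => ∀ v ∈ e, v ∈ S) = H.edgeFinset := by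
    ext e
    induction e using Sym2.ind with
    | _ u v => simp [H]
  have hsum := H.sum_degrees_eq_twice_card_edges
  rw [edgesIn, hH]
  have hdeg : ∀ v, (H.degree v : ℝ) =
      if v ∈ S then ∑ u ∈ S, (if G.Adj v u then (1 : ℝ) else 0) else 0 := fun v => by
    rw [← H.card_neighborFinset_eq_degree, H.neighborFinset_eq_filter]
    split_ifs with hv
    · rw [Finset.sum_boole]
      congr 2
      ext u
      simp [H, hv, and_comm]
    · simp [H, hv]
  have hcast : (∑ v, (H.degree v : ℝ)) = 2 * (H.edgeFinset.card : ℝ) := by exact_mod_cast hsum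
  rw [← hcast]
  simp only [hdeg, Finset.sum_ite_mem, Finset.univ_inter]

theorem edgesBetween_eq_sum {V : Type*} [Fintype V] [DecidableEq V] (G : SimpleGraph V)
    [DecidableRel G.Adj] {A B : Finset V} (hdisj : Disjoint A B) :
    (edgesBetween G A B : ℝ) = ∑ u ∈ A, ∑ v ∈ B, if G.Adj u v then (1 : ℝ) else 0 := by
  rw [← Finset.sum_product', Finset.sum_boole, edgesBetween]
  congr 1
  symm
  refine Finset.card_bij (fun x _ => s(x.1, x.2)) ?_ ?_ ?_
  · rintro ⟨a, b⟩ h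
    simp only [Finset.mem_filter, Finset.mem_product] at h
    simp only [Finset.mem_filter, SimpleGraph.mem_edgeFinset, SimpleGraph.mem_edgeSet]
    exact ⟨h.2, a, h.1.1, b, h.1.2, rfl⟩
  · rintro ⟨a, b⟩ h ⟨a', b'⟩ h' heq
    simp only [Finset.mem_filter, Finset.mem_product] at h h'
    rcases Sym2.eq_iff.mp heq with ⟨rfl, rfl⟩ | ⟨h1, _⟩
    · rfl
    · have h1 : a = b' := h1
      exact absurd (h1 ▸ h'.1.2) (Finset.disjoint_left.mp hdisj h.1.1)
  · intro e h
    simp only [Finset.mem_filter, SimpleGraph.mem_edgeFinset] at h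
    obtain ⟨he, a, ha, b, hb, rfl⟩ := h
    exact ⟨(a, b), by simpa [ha, hb] using he, rfl⟩

theorem edgesBetween_comm {V : Type*} [Fintype V] [DecidableEq V] (G : SimpleGraph V)
    [DecidableRel G.Adj] (A B : Finset V) : edgesBetween G A B = edgesBetween G B A := by
  unfold edgesBetween
  congr 1
  ext e
  simp only [Finset.mem_filter, and_congr_right_iff]
  intro _
  constructor <;> rintro ⟨a, ha, b, hb, rfl⟩ <;> exact ⟨b, hb, a, ha, Sym2.eq_swap⟩

theorem edgesIn_union {V : Type*} [Fintype V] [DecidableEq V] (G : SimpleGraph V)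
    [DecidableRel G.Adj] {A B : Finset V} (hdisj : Disjoint A B) :
    (edgesIn G (A ∪ B) : ℝ) = edgesIn G A + edgesIn G B + edgesBetween G A B := by
  have h := two_mul_edgesIn G (A ∪ B)
  have hBA := edgesBetween_eq_sum G hdisj.symm
  rw [edgesBetween_comm] at hBA
  simp only [Finset.sum_union hdisj, Finset.sum_add_distrib] at h
  rw [← two_mul_edgesIn, ← two_mul_edgesIn, ← edgesBetween_eq_sum G hdisj, ← hBA] at h
  linarith

/-- If neither a random half of the larger side `A`, nor the smaller side `B` completed by random
vertices of `A`, is sparse, then the cut has few edges compared to the whole graph. Here `a` is the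
size of `A`, `t = n / (2a)`, and `x`, `y`, `g` count the edges in `A`, in `B`, and across. -/
theorem cut_le_of_random_halves_dense {a t x y g : ℝ} (ha : 0 < a) (ht : 0 < t) (ht1 : t ≤ 1)
    (hg : 0 ≤ g) (hx : 2 * a ^ 2 / 9 ≤ x)
    (h : (2 * a * t) ^ 2 / 18 ≤ y + (1 - t) * g + (1 - t) ^ 2 * x) :
    g * (2 * a * t) ^ 2 ≤ 9 / 4 * (x + y + g) ^ 2 := by
  have h1 : t * (2 - t) * (2 * a ^ 2 / 9) ≤ t * (2 - t) * x :=
    mul_le_mul_of_nonneg_left hx (mul_nonneg ht.le (by linarith))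
  have h2 : t * (g + 4 * a ^ 2 / 9) ≤ x + y + g := by nlinarith
  have h3 : (t * (g + 4 * a ^ 2 / 9)) ^ 2 ≤ (x + y + g) ^ 2 :=
    pow_le_pow_left₀ (by positivity) h2 2
  nlinarith [mul_nonneg (sq_nonneg t) (sq_nonneg (g - 4 * a ^ 2 / 9))]

theorem exists_sparse_half_of_card_le {V : Type*} [Fintype V] [DecidableEq V]
    (G : SimpleGraph V) [DecidableRel G.Adj] {A B : Finset V} (hdisj : Disjoint A B)
    (hunion : A ∪ B = Finset.univ) (hBA : B.card ≤ A.card)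
    (hcut : 9 / 4 * (G.edgeFinset.card : ℝ) ^ 2
      < (edgesBetween G A B : ℝ) * (Fintype.card V : ℝ) ^ 2) :
    ∃ S : Finset V, S.card = Fintype.card V / 2 ∧
      (edgesIn G S : ℝ) < (Fintype.card V : ℝ) ^ 2 / 18 := by
  by_contra! hdense
  have hn : A.card + B.card = Fintype.card V := by
    rw [← Finset.card_union_of_disjoint hdisj, hunion, Finset.card_univ]
  set n := Fintype.card V
  have hn0 : n ≠ 0 := by
    intro h0
    rw [h0] at hcut
    have : 0 ≤ 9 / 4 * (G.edgeFinset.card : ℝ) ^ 2 := by positivity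
    norm_num at hcut
    linarith
  have hA0 : 0 < A.card := by omega
  have hdiag : ∀ v, (if G.Adj v v then (1 / 2 : ℝ) else 0) = 0 := by simp
  have hnonneg : ∀ u v, (0 : ℝ) ≤ if G.Adj u v then 1 / 2 else 0 := fun u v => by
    split_ifs <;> norm_num
  have hedges : ∀ S : Finset V, ∑ u ∈ S, ∑ v ∈ S, (if G.Adj u v then (1 / 2 : ℝ) else 0)
      = edgesIn G S := fun S => by
    have h := two_mul_edgesIn G S
    have h' : ∀ u v, (if G.Adj u v then (1 / 2 : ℝ) else 0)
        = 1 / 2 * if G.Adj u v then (1 : ℝ) else 0 := fun u v => by split_ifs <;> norm_num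
    simp only [h', ← Finset.mul_sum]
    linarith
  have htotal : (G.edgeFinset.card : ℝ) = edgesIn G A + edgesIn G B + edgesBetween G A B := by
    rw [← edgesIn_union G hdisj, hunion]
    simp [edgesIn]
  have ha : (0 : ℝ) < A.card := by exact_mod_cast hA0
  have hnR : (A.card : ℝ) + B.card = n := by exact_mod_cast hn
  have hBAR : (B.card : ℝ) ≤ A.card := by exact_mod_cast hBA
  have hnpos : (0 : ℝ) < n := by positivity
  have hhalf : ((n / 2 : ℕ) : ℝ) ≤ n / 2 := Nat.cast_div_le
  set t : ℝ := n / (2 * A.card) with ht_def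
  have hat : 2 * A.card * t = n := by rw [ht_def]; field_simp
  have ht : 0 < t := by positivity
  have ht1 : t ≤ 1 := by rw [ht_def, div_le_one (by positivity)]; linarith
  have hxA : 2 * (A.card : ℝ) ^ 2 / 9 ≤ edgesIn G A := by
    obtain ⟨S, -, hSk, hS⟩ := exists_subset_card_eq_weight_le (fun _ => 0) _ hdiag hnonneg
      (A := A) (k := n / 2) (by omega)
    simp only [hedges, Finset.sum_const_zero, mul_zero, zero_add] at hS
    have hfrac : ((n / 2 : ℕ) : ℝ) / A.card ≤ t := by
      rw [div_le_iff₀ ha]; linarith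
    have h1 : (n : ℝ) ^ 2 / 18 ≤ t ^ 2 * edgesIn G A :=
      (hdense S hSk).trans (hS.trans (mul_le_mul_of_nonneg_right
        (pow_le_pow_left₀ (by positivity) hfrac 2) (by positivity)))
    rw [← hat] at h1
    refine le_of_mul_le_mul_left (a := t ^ 2) ?_ (by positivity)
    linarith
  have hyB : (n : ℝ) ^ 2 / 18
      ≤ edgesIn G B + (1 - t) * edgesBetween G A B + (1 - t) ^ 2 * edgesIn G A := by
    obtain ⟨S, hSA, hSk, hS⟩ := exists_subset_card_eq_weight_le
      (fun u => ∑ v ∈ B, if G.Adj u v then (1 : ℝ) else 0) _ hdiag hnonneg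
      (A := A) (k := n / 2 - B.card) (by omega)
    have hSB : Disjoint S B := Finset.disjoint_of_subset_left hSA hdisj
    rw [hedges, hedges, ← edgesBetween_eq_sum G hSB, ← edgesBetween_eq_sum G hdisj] at hS
    have hcard : (S ∪ B).card = n / 2 := by
      rw [Finset.card_union_of_disjoint hSB, hSk]; omega
    have hd := hdense _ hcard
    rw [edgesIn_union G hSB] at hd
    have hfrac : ((n / 2 - B.card : ℕ) : ℝ) / A.card ≤ 1 - t := by
      rw [div_le_iff₀ ha, Nat.cast_sub (by omega)]
      linarith
    have h1 := mul_le_mul_of_nonneg_right hfrac (Nat.cast_nonneg (α := ℝ) (edgesBetween G A B))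
    have h2 := mul_le_mul_of_nonneg_right (pow_le_pow_left₀ (by positivity) hfrac 2)
      (Nat.cast_nonneg (α := ℝ) (edgesIn G A))
    linarith
  rw [← hat] at hyB
  have := cut_le_of_random_halves_dense ha ht ht1 (Nat.cast_nonneg _) hxA hyB
  rw [hat, ← htotal] at this
  linarith

/-- If a `K₄`-free graph on `n` vertices with `cn²` edges has a partition
`A ∪ B = V(G)` with `e(A,B) > (9/4)c²n²`, then it contains a vertex set of size `⌊n/2⌋`
spanning strictly fewer than `n²/18` edges. -/
theorem big_cut_implies_sparse_half {n : ℕ} {c : ℝ} (G : SimpleGraph (Fin n))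
    [DecidableRel G.Adj] (hK4 : G.CliqueFree 4)
    (he : (G.edgeFinset.card : ℝ) = c * (n : ℝ) ^ 2)
    {A B : Finset (Fin n)} (hdisj : Disjoint A B) (hunion : A ∪ B = Finset.univ)
    (hcut : (9 / 4) * c ^ 2 * (n : ℝ) ^ 2 < (edgesBetween G A B : ℝ)) :
    ∃ S : Finset (Fin n), S.card = n / 2 ∧ (edgesIn G S : ℝ) < (n : ℝ) ^ 2 / 18 := by
  have hn : 0 < n := by
    rcases Nat.eq_zero_or_pos n with rfl | hn
    · simp [edgesBetween, Finset.eq_empty_of_isEmpty A] at hcut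
    · exact hn
  have hcut' : 9 / 4 * (G.edgeFinset.card : ℝ) ^ 2
      < (edgesBetween G A B : ℝ) * (Fintype.card (Fin n) : ℝ) ^ 2 := by
    rw [he, Fintype.card_fin]
    have := mul_lt_mul_of_pos_right hcut (by positivity : (0 : ℝ) < (n : ℝ) ^ 2)
    linarith
  rcases le_total B.card A.card with h | h
  · simpa using exists_sparse_half_of_card_le G hdisj hunion h hcut'
  · rw [edgesBetween_comm] at hcut'
    simpa using exists_sparse_half_of_card_le G hdisj.symm (by rwa [Finset.union_comm]) h hcut'
end

section
/- Suppose G is a K_4-free graph on n vertices with minimum degree δ(G) ≥ 0.59·n. Then G contains a vertex set of size ⌊n/2⌋ that spans at most n²/18 edges. Moreover, if every vertex set of size ⌊n/2⌋ in G spans at least n²/18 edges, then G is isomorphic to the Turán graph T_3(n). -/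
open Finset

section RelSum

variable {V : Type*} [Fintype V]

/-- The sum of `f` over `A`, divided by the total number of vertices. -/
noncomputable def relSum (A : Finset V) (f : V → ℝ) : ℝ := (∑ x ∈ A, f x) / Fintype.card V

/-- The size of `A` relative to the total number of vertices. -/
noncomputable def relVol (A : Finset V) : ℝ := relSum A fun _ => 1

theorem relSum_congr {A : Finset V} {f g : V → ℝ} (h : ∀ x ∈ A, f x = g x) :
    relSum A f = relSum A g := by
  simp only [relSum, sum_congr rfl h]

theorem relSum_add (A : Finset V) (f g : V → ℝ) :
    relSum A (fun x => f x + g x) = relSum A f + relSum A g := by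
  simp only [relSum, sum_add_distrib, add_div]

theorem relSum_sub (A : Finset V) (f g : V → ℝ) :
    relSum A (fun x => f x - g x) = relSum A f - relSum A g := by
  simp only [relSum, sum_sub_distrib, sub_div]

theorem relSum_mul_left (A : Finset V) (c : ℝ) (f : V → ℝ) :
    relSum A (fun x => c * f x) = c * relSum A f := by
  simp only [relSum, ← mul_sum, mul_div_assoc]

theorem relSum_mul_right (A : Finset V) (f : V → ℝ) (c : ℝ) :
    relSum A (fun x => f x * c) = relSum A f * c := by
  simp only [relSum, ← sum_mul, div_mul_eq_mul_div]

theorem relSum_const (A : Finset V) (c : ℝ) : relSum A (fun _ => c) = c * relVol A := by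
  rw [relVol, ← relSum_mul_left]; simp

theorem relSum_mono {A : Finset V} {f g : V → ℝ} (h : ∀ x ∈ A, f x ≤ g x) :
    relSum A f ≤ relSum A g :=
  div_le_div_of_nonneg_right (sum_le_sum h) (Nat.cast_nonneg _)

theorem relSum_nonneg {A : Finset V} {f : V → ℝ} (h : ∀ x ∈ A, 0 ≤ f x) : 0 ≤ relSum A f :=
  div_nonneg (sum_nonneg h) (Nat.cast_nonneg _)

theorem relSum_mono_set {A B : Finset V} {f : V → ℝ} (hAB : A ⊆ B) (h : ∀ x ∈ B, 0 ≤ f x) :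
    relSum A f ≤ relSum B f :=
  div_le_div_of_nonneg_right (sum_le_sum_of_subset_of_nonneg hAB fun x hx _ => h x hx)
    (Nat.cast_nonneg _)

theorem relSum_comm (A B : Finset V) (f : V → V → ℝ) :
    relSum A (fun x => relSum B fun y => f x y) = relSum B (fun y => relSum A fun x => f x y) := by
  simp only [relSum, ← sum_div]
  rw [sum_comm]

theorem relSum_sdiff [DecidableEq V] {A B : Finset V} (h : A ⊆ B) (f : V → ℝ) :
    relSum A f + relSum (B \ A) f = relSum B f := by
  rw [relSum, relSum, relSum, ← add_div, add_comm, sum_sdiff h]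

theorem relVol_eq (A : Finset V) : relVol A = #A / Fintype.card V := by
  simp [relVol, relSum]

theorem relVol_nonneg (A : Finset V) : 0 ≤ relVol A := relSum_nonneg fun _ _ => zero_le_one

theorem relVol_univ [Nonempty V] : relVol (univ : Finset V) = 1 := by
  rw [relVol_eq, card_univ, div_self]; exact_mod_cast Fintype.card_ne_zero

end RelSum

namespace SimpleGraph

section AdjInd

variable {V : Type*} (G : SimpleGraph V) [DecidableRel G.Adj]

/-- The adjacency indicator of `G`. -/
def adjInd (x y : V) : ℝ := if G.Adj x y then 1 else 0

theorem adjInd_nonneg (x y : V) : 0 ≤ G.adjInd x y := by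
  rw [adjInd]; split_ifs <;> norm_num

theorem adjInd_le_one (x y : V) : G.adjInd x y ≤ 1 := by
  rw [adjInd]; split_ifs <;> norm_num

theorem adjInd_symm (x y : V) : G.adjInd x y = G.adjInd y x := by
  simp only [adjInd, G.adj_comm]

end AdjInd

variable {V : Type*} [Fintype V] (G : SimpleGraph V) [DecidableRel G.Adj]

/-- The number of neighbours of `x` in `A`, relative to the number of vertices. -/
noncomputable def relDeg (x : V) (A : Finset V) : ℝ := relSum A fun y => G.adjInd x y

/-- The number of adjacent pairs in `A × B`, relative to the square of the number of vertices. -/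
noncomputable def relEdges (A B : Finset V) : ℝ := relSum A fun x => G.relDeg x B

theorem relDeg_nonneg (x : V) (A : Finset V) : 0 ≤ G.relDeg x A :=
  relSum_nonneg fun y _ => G.adjInd_nonneg x y

theorem relDeg_le (x : V) (A : Finset V) : G.relDeg x A ≤ relVol A :=
  relSum_mono fun y _ => G.adjInd_le_one x y

theorem relDeg_eq (x : V) (A : Finset V) : G.relDeg x A = relVol (A.filter (G.Adj x)) := by
  simp only [relDeg, relVol, relSum, adjInd, sum_filter]

theorem relDeg_mono (x : V) {A B : Finset V} (h : A ⊆ B) : G.relDeg x A ≤ G.relDeg x B :=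
  relSum_mono_set h fun y _ => G.adjInd_nonneg x y

theorem relEdges_nonneg (A B : Finset V) : 0 ≤ G.relEdges A B :=
  relSum_nonneg fun x _ => G.relDeg_nonneg x B

theorem relEdges_comm (A B : Finset V) : G.relEdges A B = G.relEdges B A := by
  simp only [relEdges, relDeg]
  rw [relSum_comm]
  simp only [G.adjInd_symm]

theorem relEdges_mono {A B : Finset V} {A' B' : Finset V} (h : A ⊆ A') (h' : B ⊆ B') :
    G.relEdges A B ≤ G.relEdges A' B' :=
  (relSum_mono fun x _ => G.relDeg_mono x h').trans
    (relSum_mono_set h fun x _ => G.relDeg_nonneg x B')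

theorem relEdges_le_mul {A B : Finset V} {c : ℝ} (h : ∀ x ∈ A, G.relDeg x B ≤ c) :
    G.relEdges A B ≤ c * relVol A := by
  rw [← relSum_const]; exact relSum_mono h

theorem relEdges_eq_zero {A B : Finset V} (h : ∀ x ∈ A, ∀ y ∈ B, ¬ G.Adj x y) :
    G.relEdges A B = 0 := by
  have : ∀ x ∈ A, G.relDeg x B = 0 := fun x hx => by
    rw [relDeg, relSum_congr (g := fun _ => 0), relSum_const, zero_mul]
    intro y hy; simp [adjInd, h x hx y hy]
  rw [relEdges, relSum_congr this, relSum_const, zero_mul]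

theorem relEdges_le (A B : Finset V) : G.relEdges A B ≤ relVol A * relVol B := by
  rw [mul_comm]; exact G.relEdges_le_mul fun x _ => G.relDeg_le x B

theorem relEdges_compl_graph (A B : Finset V) :
    relSum A (fun x => relSum B fun y => (1 - G.adjInd x y)) =
      relVol A * relVol B - G.relEdges A B := by
  simp only [relSum_sub, relEdges, relDeg, relSum_const, one_mul]
  ring

variable [DecidableEq V]

theorem relDeg_sdiff (x : V) {A B : Finset V} (h : A ⊆ B) :
    G.relDeg x A + G.relDeg x (B \ A) = G.relDeg x B := relSum_sdiff h _

theorem relEdges_sdiff_left {A B : Finset V} (h : A ⊆ B) (D : Finset V) :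
    G.relEdges A D + G.relEdges (B \ A) D = G.relEdges B D := relSum_sdiff h _

theorem relEdges_sdiff_right {A B : Finset V} (h : A ⊆ B) (D : Finset V) :
    G.relEdges D A + G.relEdges D (B \ A) = G.relEdges D B := by
  simp only [G.relEdges_comm D]; exact G.relEdges_sdiff_left h D

end SimpleGraph

section Rounding

open Matrix

variable {V : Type*} [Fintype V]

theorem exists_finset_sum_le_of_card_frac_le_one {M : Matrix V V ℝ} (h0 : ∀ x y, 0 ≤ M x y) {n : ℕ}
    {w : V → ℝ} (hw0 : ∀ x, 0 ≤ w x) (hw1 : ∀ x, w x ≤ 1) (hw : ∑ x, w x = n / 2)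
    (hf : #{x | 0 < w x ∧ w x < 1} ≤ 1) :
    ∃ S : Finset V, #S = n / 2 ∧ ∑ x ∈ S, ∑ y ∈ S, M x y ≤ w ⬝ᵥ M *ᵥ w := by
  refine ⟨univ.filter fun x => w x = 1, ?_, ?_⟩
  · have h1 : ∑ x, w x = #{x | w x = 1} + ∑ x with 0 < w x ∧ w x < 1, w x := by
      rw [card_eq_sum_ones, Nat.cast_sum, sum_filter, sum_filter, ← sum_add_distrib]
      refine sum_congr rfl fun x _ => ?_
      rcases (hw0 x).eq_or_lt with h | h
      · simp [← h]
      · rcases (hw1 x).eq_or_lt with h' | h'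
        · simp [h']
        · simp [h, h', h'.ne]
    have h2 : 0 ≤ ∑ x with 0 < w x ∧ w x < 1, w x := sum_nonneg fun x _ => hw0 x
    have h3 : ∑ x with 0 < w x ∧ w x < 1, w x < 1 := by
      rcases Nat.le_one_iff_eq_zero_or_eq_one.1 hf with h | h
      · rw [card_eq_zero.1 h]; simp
      · obtain ⟨x, hx⟩ := card_eq_one.1 h
        have : x ∈ univ.filter fun x => 0 < w x ∧ w x < 1 := by rw [hx]; simp
        rw [hx, sum_singleton]
        exact (mem_filter.1 this).2.2
    rw [hw] at h1
    generalize #{x | w x = 1} = m at h1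
    have h4 : 2 * m ≤ n := by
      have : (2 * m : ℝ) ≤ n := by linarith
      exact_mod_cast this
    have h5 : n < 2 * m + 2 := by
      have : (n : ℝ) < 2 * m + 2 := by linarith
      exact_mod_cast this
    omega
  · have h1 : w ⬝ᵥ M *ᵥ w = ∑ x, ∑ y, w x * (M x y * w y) := by
      simp only [dotProduct, mulVec, mul_sum]
    rw [h1]
    have h2 : ∀ x y, 0 ≤ w x * (M x y * w y) := fun x y =>
      mul_nonneg (hw0 x) (mul_nonneg (h0 x y) (hw0 y))
    calc ∑ x with w x = 1, ∑ y with w y = 1, M x y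
        = ∑ x with w x = 1, ∑ y with w y = 1, w x * (M x y * w y) :=
          sum_congr rfl fun x hx => sum_congr rfl fun y hy => by
            rw [(mem_filter.1 hx).2, (mem_filter.1 hy).2, one_mul, mul_one]
      _ ≤ ∑ x with w x = 1, ∑ y, w x * (M x y * w y) :=
          sum_le_sum fun x _ => sum_le_univ_sum_of_nonneg fun y => h2 x y
      _ ≤ ∑ x, ∑ y, w x * (M x y * w y) :=
          sum_le_univ_sum_of_nonneg fun x => sum_nonneg fun y _ => h2 x y

variable [DecidableEq V]

theorem dotProduct_mulVec_shift {M : Matrix V V ℝ} (hs : M.IsSymm) (h0 : ∀ x y, 0 ≤ M x y)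
    (hd : ∀ x, M x x = 0) (w : V → ℝ) {u v : V} (huv : (M *ᵥ w) u ≤ (M *ᵥ w) v)
    {s : ℝ} (hs0 : 0 ≤ s) :
    (w + s • (Pi.single u 1 - Pi.single v 1)) ⬝ᵥ M *ᵥ (w + s • (Pi.single u 1 - Pi.single v 1)) ≤
      w ⬝ᵥ M *ᵥ w := by
  have h1 : ∀ z : V → ℝ, w ⬝ᵥ M *ᵥ z = (M *ᵥ w) ⬝ᵥ z := fun z => by
    rw [dotProduct_mulVec, ← mulVec_transpose, hs.eq]
  have hcol : ∀ x, w ⬝ᵥ M.col x = (M *ᵥ w) x := fun x => by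
    simp only [dotProduct, mulVec, col_apply, hs.apply, mul_comm]
  have h2 := h0 u v
  have h3 : M v u = M u v := hs.apply u v
  simp only [mulVec_add, mulVec_smul, mulVec_sub, add_dotProduct, dotProduct_add, smul_dotProduct,
    dotProduct_smul, h1, dotProduct_sub, sub_dotProduct, single_dotProduct,
    smul_eq_mul, mulVec_single, MulOpposite.op_one, one_smul, one_mul,
    col_apply, hcol, hd, h3]
  have h4 := mul_nonneg hs0 (sub_nonneg.2 huv)
  have h5 := mul_nonneg (mul_nonneg hs0 hs0) h2
  linarith

theorem exists_finset_sum_le {M : Matrix V V ℝ} (hs : M.IsSymm) (h0 : ∀ x y, 0 ≤ M x y)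
    (hd : ∀ x, M x x = 0) {n : ℕ} (w : V → ℝ) (hw0 : ∀ x, 0 ≤ w x) (hw1 : ∀ x, w x ≤ 1)
    (hw : ∑ x, w x = n / 2) :
    ∃ S : Finset V, #S = n / 2 ∧ ∑ x ∈ S, ∑ y ∈ S, M x y ≤ w ⬝ᵥ M *ᵥ w := by
  induction hm : #{x | 0 < w x ∧ w x < 1} using Nat.strong_induction_on generalizing w with
  | _ m ih =>
    rcases le_or_gt m 1 with h1 | h1
    · exact exists_finset_sum_le_of_card_frac_le_one h0 hw0 hw1 hw (hm.trans_le h1)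
    obtain ⟨u, hu, v, hv, hne, huv⟩ : ∃ u, (0 < w u ∧ w u < 1) ∧ ∃ v, (0 < w v ∧ w v < 1) ∧ u ≠ v ∧
        (M *ᵥ w) u ≤ (M *ᵥ w) v := by
      obtain ⟨u, hu, v, hv, hne⟩ := one_lt_card.1 (hm ▸ h1)
      rw [mem_filter] at hu hv
      rcases le_total ((M *ᵥ w) u) ((M *ᵥ w) v) with h | h
      · exact ⟨u, hu.2, v, hv.2, hne, h⟩
      · exact ⟨v, hv.2, u, hu.2, hne.symm, h⟩
    obtain ⟨s, hsd⟩ : ∃ s, s = min (1 - w u) (w v) := ⟨_, rfl⟩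
    have hs0 : 0 < s := hsd ▸ lt_min (by linarith) hv.1
    have hsu : s ≤ 1 - w u := hsd ▸ min_le_left _ _
    have hsv : s ≤ w v := hsd ▸ min_le_right _ _
    have hshift := dotProduct_mulVec_shift hs h0 hd w huv hs0.le
    obtain ⟨w', hw'⟩ : ∃ w' : V → ℝ, w' = w + s • (Pi.single u 1 - Pi.single v 1) := ⟨_, rfl⟩
    rw [← hw'] at hshift
    have hwu : w' u = w u + s := by simp [hw', hne]
    have hwv : w' v = w v - s := by simp [hw', hne.symm, sub_eq_add_neg]
    have hwx : ∀ x, x ≠ u → x ≠ v → w' x = w x := fun x hxu hxv => by simp [hw', hxu, hxv]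
    have hw0' : ∀ x, 0 ≤ w' x := fun x => by
      by_cases hxu : x = u
      · subst hxu; linarith
      by_cases hxv : x = v
      · subst hxv; linarith
      rw [hwx x hxu hxv]; exact hw0 x
    have hw1' : ∀ x, w' x ≤ 1 := fun x => by
      by_cases hxu : x = u
      · subst hxu; linarith
      by_cases hxv : x = v
      · subst hxv; linarith
      rw [hwx x hxu hxv]; exact hw1 x
    have hsum : ∑ x, w' x = n / 2 := by
      rw [← hw, hw']
      simp [sum_add_distrib, ← mul_sum]
    have hlt : #{x | 0 < w' x ∧ w' x < 1} < m := by
      rw [← hm]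
      apply card_lt_card
      rw [ssubset_iff_of_subset]
      · rcases min_choice (1 - w u) (w v) with h | h
        · refine ⟨u, by simpa using hu, ?_⟩
          have : w' u = 1 := by rw [hwu, hsd, h]; ring
          simp [this]
        · refine ⟨v, by simpa using hv, ?_⟩
          have : w' v = 0 := by rw [hwv, hsd, h]; ring
          simp [this]
      · intro x hx
        rw [mem_filter] at hx ⊢
        refine ⟨hx.1, ?_⟩
        by_cases hxu : x = u
        · exact hxu ▸ hu
        by_cases hxv : x = v
        · exact hxv ▸ hv
        rw [← hwx x hxu hxv]; exact hx.2
    obtain ⟨S, hS, hle⟩ := ih _ hlt w' hw0' hw1' hsum rfl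
    exact ⟨S, hS, hle.trans hshift⟩

end Rounding

/-- The densities of a tripartite structure with large minimum cost are those of `T₃(n)`. -/
theorem scalar_equality {d h p f q : ℝ} (hd : 2 / 3 ≤ d) (hh1 : h ≤ 1 / 2)
    (hq0 : 0 ≤ q) (hq1 : q ≤ 1) (hq : q * (d - h) = 1 / 2 - h) (hf : 0 ≤ f)
    (hpf : p + f ≤ h * (d - h)) (hp : p ≤ h * h) (hcost : 1 / 9 ≤ 2 * q * p + q ^ 2 * f) :
    d = 2 / 3 ∧ h = 1 / 3 ∧ 1 / 9 ≤ p ∧ f ≤ 0 := by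
  have h1 : q * (q * (d - h)) = q * (1 / 2 - h) := by rw [hq]
  have h2 := mul_le_mul_of_nonneg_left hpf hq0
  have h3 := mul_le_mul_of_nonneg_left h2 hq0
  have h4 : h * (q * (d - h)) = h * (1 / 2 - h) := by rw [hq]
  have h4' : h * (q * (q * (d - h))) = h * (q * (1 / 2 - h)) := by rw [h1]
  have h5 : 0 ≤ q * f * (2 - q) := mul_nonneg (mul_nonneg hq0 hf) (by linarith)
  have h6 : (h - 1 / 6) * (h - 1 / 3) ≤ 0 := by linarith
  have hh2 : 1 / 6 ≤ h := by nlinarith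
  have hh3 : h ≤ 1 / 3 := by nlinarith
  -- bound the cost in terms of `q` and `h` only
  have h7 : 0 ≤ q * (2 - q) := mul_nonneg hq0 (by linarith)
  have h8 := mul_le_mul_of_nonneg_left hp h7
  have h9 : 1 / 9 ≤ q * (2 - q) * (h * h) + q * h * (1 / 2 - h) := by linarith
  obtain ⟨s, rfl⟩ : ∃ s, h = (1 - s) / 3 := ⟨1 - 3 * h, by ring⟩
  have hs0 : 0 ≤ s := by linarith
  have hs1 : s ≤ 1 / 2 := by linarith
  obtain ⟨g, hg⟩ : ∃ g, g * (2 * (1 + s)) = 1 + 2 * s :=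
    ⟨(1 + 2 * s) / (2 * (1 + s)), div_mul_cancel₀ _ (by linarith)⟩
  have hqg : q ≤ g := by
    have : 0 ≤ q * (d - 2 / 3) := mul_nonneg hq0 (by linarith)
    refine le_of_mul_le_mul_right (?_ : q * (2 * (1 + s)) ≤ g * (2 * (1 + s))) (by linarith)
    linarith
  have hg1 : g ≤ 1 := le_of_mul_le_mul_right (by linarith : g * (2 * (1 + s)) ≤ _) (by linarith)
  have h10 : 1 / 9 ≤ g * (2 - g) * ((1 - s) / 3 * ((1 - s) / 3)) +
      g * ((1 - s) / 3) * (1 / 2 - (1 - s) / 3) := by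
    have : 0 ≤ (g - q) * ((2 - g - q) * ((1 - s) / 3 * ((1 - s) / 3)) +
        ((1 - s) / 3) * (1 / 2 - (1 - s) / 3)) := by
      apply mul_nonneg (by linarith)
      apply add_nonneg
      · exact mul_nonneg (by linarith) (mul_self_nonneg _)
      · exact mul_nonneg (by linarith) (by linarith)
    linarith
  have h11 := mul_le_mul_of_nonneg_right h10 (sq_nonneg (2 * (1 + s)))
  have h12 : (g * (2 - g) * ((1 - s) / 3 * ((1 - s) / 3)) +
      g * ((1 - s) / 3) * (1 / 2 - (1 - s) / 3)) * (2 * (1 + s)) ^ 2 =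
      (1 + 2 * s) * (2 * (2 * (1 + s)) - (1 + 2 * s)) * ((1 - s) / 3 * ((1 - s) / 3)) +
      (1 + 2 * s) * (2 * (1 + s)) * ((1 - s) / 3) * (1 / 2 - (1 - s) / 3) := by
    rw [← hg]; ring
  rw [h12] at h11
  have hs : s = 0 := by
    have : s * (1 + 5 * s + 2 * s ^ 2) ≤ 0 := by linarith
    have : 0 ≤ s * s := mul_self_nonneg s
    have : 0 ≤ s * s * s := mul_nonneg this hs0
    linarith
  subst hs
  have hq2 : 1 / 2 ≤ q := by
    have : (q - 1 / 2) * (q - 2) ≤ 0 := by linarith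
    nlinarith
  have hd' : d ≤ 2 / 3 := by
    have := mul_nonneg (sub_nonneg.2 hq2) (show 0 ≤ d - (1 - 0) / 3 by linarith)
    linarith
  have hd3 : d = 2 / 3 := le_antisymm hd' hd
  subst hd3
  have hq3 : q = 1 / 2 := by linarith
  subst hq3
  refine ⟨rfl, by norm_num, by linarith, by linarith⟩

/-- The density constraints on a bipartition of a neighbourhood of density `d < 2 / 3` are
inconsistent when both parts are independent. -/
theorem scalar_contra_of_no_inner_edges {d E gP gQ : ℝ} (hd1 : 0.59 ≤ d) (hd2 : d < 2 / 3)
    (h1 : E ≤ d ^ 2 / 4) (h2 : d / 18 ≤ E * (1 - d)) (hg : gP + gQ = 1)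
    (h3 : 1 / 9 ≤ gP * gQ * (d - 2 * E)) : False := by
  obtain rfl : gQ = 1 - gP := by linarith
  have h4 : 0 ≤ d - 2 * E := by nlinarith
  have h5 : E ≤ d / 2 - 2 / 9 := by linarith [mul_nonneg (sq_nonneg (gP - 1 / 2)) h4]
  have h6 := mul_le_mul_of_nonneg_right h5 (show (0 : ℝ) ≤ 1 - d by linarith)
  nlinarith

/-- The constraints of `scalar_contra` are inconsistent once reduced to the excess `e = 2 / 3 - d`,
the inner density `i` and its factors `s` and `μ`. -/
theorem scalar_contra_of_product {e R i s μ : ℝ} (he0 : 0 < e) (he1 : e ≤ 0.0767)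
    (hR : R = e * (2/3 - e) * (1 - 3 * e) / 12) (hi0 : 0 ≤ i) (hiR : i * (1/6 + 2 * e) ≤ R)
    (hi2 : 0.53 * e^2 ≤ i) (hs0 : 0 ≤ s) (hμ : 0 ≤ μ) (hsi : s * μ = i)
    (h7 : (1/3 + e) * (0.09 * μ + ((2/3 - e)/2 - 0.13) * s) ≤ R + i/2) : False := by
  obtain ⟨C, hC⟩ : ∃ C, C = (2/3 - e)/2 - 0.13 := ⟨_, rfl⟩
  rw [← hC] at h7
  have hC0 : 0 ≤ C := by linarith
  have h8 : 0.36 * (1/3 + e)^2 * C * i ≤ (R + i/2)^2 := by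
    have h9 : ((1/3 + e) * (0.09 * μ + C * s))^2 ≤ (R + i/2)^2 :=
      pow_le_pow_left₀ (by positivity) h7 2
    rw [← hsi] at h9 ⊢
    linarith [mul_nonneg (sq_nonneg (1/3 + e)) (sq_nonneg (0.09 * μ - C * s))]
  obtain ⟨r, hr⟩ : ∃ r, r = (2/3 - e) * (1 - 3 * e) / 12 := ⟨_, rfl⟩
  have hRe : R = e * r := by rw [hR, hr]; ring
  have h10 := mul_le_mul_of_nonneg_right hiR hi0
  obtain ⟨X, hX⟩ : ∃ X, X = 0.36 * (1/3 + e)^2 * C * (1 + 12 * e) - R * (2.5 + 12 * e) := ⟨_, rfl⟩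
  have h11 : i * X ≤ R^2 * (1 + 12 * e) := by
    rw [hX]
    linarith [mul_le_mul_of_nonneg_right h8 (show (0:ℝ) ≤ 1 + 12 * e by linarith)]
  have he2 : 0 ≤ e * (0.0767 - e) := mul_nonneg he0.le (by linarith)
  have he3 : 0 ≤ e^2 * (0.0767 - e) := mul_nonneg (sq_nonneg e) (by linarith)
  have hrU : r^2 * (1 + 12 * e) ≤ 0.0037 := by
    have hr0 : 0 ≤ r := by rw [hr]; exact div_nonneg (mul_nonneg (by linarith) (by linarith)) (by norm_num)
    have : r ≤ (1 - 3 * e)/18 := by rw [hr]; nlinarith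
    have h2 : r^2 ≤ ((1 - 3 * e)/18)^2 := pow_le_pow_left₀ hr0 this 2
    have h3 := mul_le_mul_of_nonneg_right h2 (show (0:ℝ) ≤ 1 + 12 * e by linarith)
    nlinarith [sq_nonneg (e - 0.05)]
  have hKL : 0.02258 + 0.066 * e ≤ (1/3 + e)^2 * C := by
    rw [hC]; nlinarith [mul_nonneg he0.le he0.le, mul_nonneg he0.le he2]
  have hRU : R * (2.5 + 12 * e) ≤ 0.139 * e + 0.042 * e^2 := by
    rw [hR]
    nlinarith [mul_nonneg he0.le he3, pow_pos he0 3]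
  have hXL : 0.0037 < 0.53 * X := by
    have := mul_le_mul_of_nonneg_right hKL (show (0:ℝ) ≤ 1 + 12 * e by linarith)
    rw [hX]
    nlinarith [sq_nonneg (e - 0.035)]
  have h13 : R^2 = e^2 * r^2 := by rw [hRe]; ring
  have h14 : 0 ≤ (i - 0.53 * e^2) * X := mul_nonneg (by linarith) (by linarith)
  have he4 : 0 < e^2 := by positivity
  have h15 := mul_le_mul_of_nonneg_left hrU he4.le
  have h16 := mul_lt_mul_of_pos_left hXL he4
  rw [h13] at h11
  linarith

set_option maxHeartbeats 2000000 in
/-- The density constraints on a maximum cut of a neighbourhood of density `d < 2 / 3` are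
inconsistent when some vertex has relative degree `μ > 0` inside its own part. -/
theorem scalar_contra {d a b E iP iQ gP gQ μ c sP sQ : ℝ}
    (hd1 : 0.59 ≤ d) (hd2 : d < 2/3) (hab : a + b = d)
    (hiP : 0 ≤ iP) (hiQ : 0 ≤ iQ)
    (h1 : E + 2 * (iP + iQ) ≤ d^2/4)
    (h2 : d/18 ≤ E * (1 - d) + (iP + iQ)/2)
    (hg : gP + gQ = 1)
    (h3 : 1/9 ≤ 2 * gQ * iP + 2 * gP * iQ + gP * gQ * (d - 2 * (E + (iP + iQ))))
    (hμ : 0 < μ) (hc : 0.09 ≤ c) (hcμ : μ ≤ c) (hP : sP * μ = iP) (hQ : sQ * μ = iQ)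
    (hsP : 2 * sP ≤ a) (hsQ : 2 * sQ ≤ b)
    (hM : b * sP + a * sQ - 2 * sP * sQ ≤ a * b - E)
    (hM' : b * sP + a * sQ - 2 * sP * sQ + (c * μ - c * sP - μ * sQ) ≤ a * b - E) : False := by
  have hsP0 : 0 ≤ sP := nonneg_of_mul_nonneg_left (hP ▸ hiP) hμ
  have hsQ0 : 0 ≤ sQ := nonneg_of_mul_nonneg_left (hQ ▸ hiQ) hμ
  obtain ⟨e, rfl⟩ : ∃ e, d = 2/3 - e := ⟨2/3 - d, by ring⟩
  have he0 : 0 < e := by linarith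
  have he1 : e ≤ 0.0767 := by linarith
  obtain ⟨i, hi⟩ : ∃ i, i = iP + iQ := ⟨_, rfl⟩
  obtain ⟨s, hs⟩ : ∃ s, s = sP + sQ := ⟨_, rfl⟩
  obtain ⟨T, hT⟩ : ∃ T, T = (2/3-e)^2/4 - E := ⟨_, rfl⟩
  obtain ⟨R, hR⟩ : ∃ R, R = e * (2/3 - e) * (1 - 3 * e) / 12 := ⟨_, rfl⟩
  have hi0 : 0 ≤ i := by linarith
  have hs0 : 0 ≤ s := by linarith
  have hsi : s * μ = i := by rw [hs, hi, ← hP, ← hQ]; ring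
  rw [← hi] at h1 h2 h3
  have hE : E = (2/3-e)^2/4 - T := by linarith
  have hiT : 2 * i ≤ T := by linarith
  have hTR : (1/3 + e) * T ≤ R + i/2 := by
    rw [hE] at h2; rw [hR]; linarith
  have hR1 : R ≤ 0.0185 * (1/12 + e) := by
    rw [hR]
    linarith [sq_nonneg (e - 0.0803), mul_nonneg (sq_nonneg e) (sub_nonneg.2 he1)]
  have hT1 : T ≤ 0.0185 := by
    have : T * (1/12 + e) ≤ 0.0185 * (1/12 + e) := by linarith
    exact le_of_mul_le_mul_right this (by linarith)
  have hiR : i * (1/6 + 2 * e) ≤ R := by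
    linarith [mul_le_mul_of_nonneg_left hiT (show (0:ℝ) ≤ 1/3 + e by linarith)]
  have hi1 : i ≤ 0.0093 := by linarith
  -- lower bound on `i`
  have hi2 : 0.53 * e^2 ≤ i := by
    obtain ⟨z, hz⟩ : ∃ z, gP = 1/2 - z := ⟨1/2 - gP, by ring⟩
    have hz' : gQ = 1/2 + z := by linarith
    subst hz; subst hz'
    have hD : (iP - iQ)^2 ≤ i^2 := by rw [hi]; linarith [mul_nonneg hiP hiQ]
    have hW : 0.4 ≤ 2/3 - e - 2 * (E + i) := by
      rw [hE]
      linarith [mul_nonneg he0.le (sub_nonneg.2 he1)]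
    have hE2 : E ≤ (2/3 - e)/2 - 2/9 + i + 5 * i^2 := by
      rw [hi] at hW hD h3 ⊢
      linarith [sq_nonneg (0.4 * z - (iP - iQ)), mul_nonneg (sq_nonneg z) (sub_nonneg.2 hW)]
    have h5 : e^2/2 ≤ i * (5/6 + e) + 5 * (1/3 + e) * i^2 := by
      linarith [mul_le_mul_of_nonneg_right hE2 (show (0:ℝ) ≤ 1/3 + e by linarith)]
    have h6 : i * (5/6 + e) + 5 * (1/3 + e) * i^2 ≤ i * 0.93 := by
      have : 5/6 + e + 5 * (1/3 + e) * i ≤ 0.93 := by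
        have := mul_le_mul (show 1/3 + e ≤ 0.42 by linarith) hi1 hi0 (by norm_num)
        linarith
      linarith [mul_le_mul_of_nonneg_left this hi0]
    linarith
  -- bounds on `T` from missing pairs
  have key : 0 ≤ ((a-b)/2)^2 + ((a-b)/2) * (sQ - sP) + (sP - sQ)^2/4 := by
    linarith [sq_nonneg ((a-b)/2 + (sQ - sP)/2)]
  have habE : a * b - E = T - ((a-b)/2)^2 := by rw [hT, ← hab]; ring
  have hlin : b * sP + a * sQ = (2/3 - e)/2 * s + ((a-b)/2) * (sQ - sP) := by
    rw [hs, ← hab]; ring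
  have hqq : 2 * sP * sQ + (sP - sQ)^2/4 ≤ s^2/2 := by
    rw [hs]; linarith [sq_nonneg (sP - sQ)]
  have hT2 : (2/3 - e)/2 * s - s^2/2 ≤ T := by linarith
  have hsp : 0 ≤ s * ((2/3 - e)/2 - s) := mul_nonneg hs0 (by linarith)
  have hsp' : 0 ≤ s * ((2/3 - e)/2 - 0.295) := mul_nonneg hs0 (by linarith)
  have hs2 : s ≤ 0.126 := by linarith
  have hs3 : s ≤ 0.08 := by linarith [mul_nonneg hs0 (sub_nonneg.2 hs2)]
  have hs4 : s^2 ≤ 0.08 * s := by linarith [mul_nonneg hs0 (sub_nonneg.2 hs3)]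
  have hcM : 0.09 * (μ - s) ≤ c * μ - c * sP - μ * sQ ∨ μ ≤ s := by
    refine (le_or_gt μ s).symm.imp_left fun h => ?_
    have h' := mul_nonneg hsQ0 (sub_nonneg.2 hcμ)
    have h'' := mul_nonneg (sub_nonneg.2 hc) (sub_nonneg.2 h.le)
    rw [hs] at h'' ⊢
    linarith
  have hT3 : 0.09 * μ + ((2/3 - e)/2 - 0.13) * s ≤ T := by
    rcases hcM with h | h <;> linarith
  have h7 : (1/3 + e) * (0.09 * μ + ((2/3 - e)/2 - 0.13) * s) ≤ R + i/2 :=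
    (mul_le_mul_of_nonneg_left hT3 (by linarith)).trans hTR
  exact scalar_contra_of_product he0 he1 hR hi0 hiR hi2 hs0 hμ.le hsi h7

namespace SimpleGraph

variable {V : Type*} [Fintype V] (G : SimpleGraph V) [DecidableRel G.Adj]

/-- Every fractional vertex set of relative size `1 / 2` has relative edge density at least
`1 / 9`. -/
def HalfDense : Prop :=
  ∀ w : V → ℝ, (∀ x, 0 ≤ w x) → (∀ x, w x ≤ 1) → relSum univ w = 1 / 2 →
    1 / 9 ≤ relSum univ fun x => relSum univ fun y => G.adjInd x y * (w x * w y)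

theorem relSum_relSum_of_const {A B : Finset V} {w : V → ℝ} {a b : ℝ} (ha : ∀ x ∈ A, w x = a)
    (hb : ∀ y ∈ B, w y = b) :
    relSum A (fun x => relSum B fun y => G.adjInd x y * (w x * w y)) =
      a * b * G.relEdges A B := by
  rw [relEdges, ← relSum_mul_left]
  refine relSum_congr fun x hx => ?_
  rw [relDeg, ← relSum_mul_left]
  refine relSum_congr fun y hy => ?_
  rw [ha x hx, hb y hy, mul_comm]

variable {G}

/-- A vertex set with no triangle inside it. -/
def TriFreeOn (G : SimpleGraph V) (H : Finset V) : Prop :=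
  ∀ x ∈ H, ∀ y ∈ H, ∀ z ∈ H, G.Adj x y → G.Adj x z → ¬ G.Adj y z

theorem TriFreeOn.relEdges_filter_self {H : Finset V} (hH : TriFreeOn G H) {v : V} (hv : v ∈ H) :
    G.relEdges (H.filter (G.Adj v)) (H.filter (G.Adj v)) = 0 :=
  G.relEdges_eq_zero fun x hx y hy =>
    hH v hv x (mem_filter.1 hx).1 y (mem_filter.1 hy).1 (mem_filter.1 hx).2 (mem_filter.1 hy).2

/-- The basic count of missing pairs at a vertex `q` outside `P`: each edge inside `P` has an end
not adjacent to `q`. -/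
theorem TriFreeOn.half_relEdges_le {H P : Finset V} (hH : TriFreeOn G H) (hP : P ⊆ H) {q : V}
    (hq : q ∈ H) :
    G.relEdges P P / 2 ≤ relSum P fun z => (1 - G.adjInd z q) * G.relDeg z P := by
  have h1 : relSum P (fun z => relSum P fun y => (1 - G.adjInd z q) * G.adjInd z y) =
      relSum P fun z => relSum P fun y => (1 - G.adjInd y q) * G.adjInd z y := by
    rw [relSum_comm]
    simp only [G.adjInd_symm]
  have h2 : G.relEdges P P ≤
      relSum P (fun z => relSum P fun y => (1 - G.adjInd z q) * G.adjInd z y) +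
      relSum P fun z => relSum P fun y => (1 - G.adjInd y q) * G.adjInd z y := by
    rw [← relSum_add]
    refine relSum_mono fun z hz => ?_
    rw [← relSum_add]
    refine relSum_mono fun y hy => ?_
    have := hH q hq z (hP hz) y (hP hy)
    simp only [adjInd, G.adj_comm z q, G.adj_comm y q]
    split_ifs <;> first | (exfalso; tauto) | norm_num
  rw [← h1] at h2
  simp only [relSum_mul_left] at h2
  simp only [relDeg]
  linarith

variable [DecidableEq V]

/-- The fractional vertex set with weights `p`, `q`, `r` on the parts `P`, `H \ P`, `Hᶜ`. -/
theorem exists_weight (G : SimpleGraph V) [DecidableRel G.Adj] {H P : Finset V} (hP : P ⊆ H)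
    {p q r : ℝ} (hp0 : 0 ≤ p) (hp1 : p ≤ 1) (hq0 : 0 ≤ q) (hq1 : q ≤ 1) (hr0 : 0 ≤ r)
    (hr1 : r ≤ 1) : ∃ w : V → ℝ, (∀ x, 0 ≤ w x) ∧ (∀ x, w x ≤ 1) ∧
      relSum univ w = p * relVol P + q * relVol (H \ P) + r * relVol (univ \ H) ∧
      (relSum univ fun x => relSum univ fun y => G.adjInd x y * (w x * w y)) =
        p ^ 2 * G.relEdges P P + q ^ 2 * G.relEdges (H \ P) (H \ P) +
        r ^ 2 * G.relEdges (univ \ H) (univ \ H) + 2 * p * q * G.relEdges P (H \ P) +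
        2 * p * r * G.relEdges P (univ \ H) + 2 * q * r * G.relEdges (H \ P) (univ \ H) := by
  obtain ⟨w, hwd⟩ : ∃ w : V → ℝ, w = fun x => if x ∈ P then p else if x ∈ H then q else r :=
    ⟨_, rfl⟩
  have h1 : ∀ x ∈ P, w x = p := fun x hx => by simp [hwd, hx]
  have h2 : ∀ x ∈ H \ P, w x = q := fun x hx => by
    rw [mem_sdiff] at hx; simp [hwd, hx.1, hx.2]
  have h3 : ∀ x ∈ univ \ H, w x = r := fun x hx => by
    have hx' : x ∉ H := (mem_sdiff.1 hx).2
    have hx'' : x ∉ P := fun h => hx' (hP h)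
    simp [hwd, hx', hx'']
  have hsplit : ∀ f : V → ℝ, relSum univ f = relSum P f + relSum (H \ P) f +
      relSum (univ \ H) f := fun f => by
    rw [relSum_sdiff hP, relSum_sdiff (subset_univ H)]
  refine ⟨w, fun x => ?_, fun x => ?_, ?_, ?_⟩
  · rw [hwd]; dsimp only; split_ifs <;> assumption
  · rw [hwd]; dsimp only; split_ifs <;> assumption
  · rw [hsplit, relSum_congr h1, relSum_congr h2, relSum_congr h3]
    simp only [relSum_const]
  · simp only [hsplit, relSum_add]
    rw [G.relSum_relSum_of_const h1 h1, G.relSum_relSum_of_const h1 h2,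
      G.relSum_relSum_of_const h1 h3, G.relSum_relSum_of_const h2 h1,
      G.relSum_relSum_of_const h2 h2, G.relSum_relSum_of_const h2 h3,
      G.relSum_relSum_of_const h3 h1, G.relSum_relSum_of_const h3 h2,
      G.relSum_relSum_of_const h3 h3, G.relEdges_comm (H \ P) P, G.relEdges_comm (univ \ H) P,
      G.relEdges_comm (univ \ H) (H \ P)]
    ring

theorem HalfDense.three_parts (hG : G.HalfDense) {H P : Finset V} (hP : P ⊆ H) {p q r : ℝ}
    (hp0 : 0 ≤ p) (hp1 : p ≤ 1) (hq0 : 0 ≤ q) (hq1 : q ≤ 1) (hr0 : 0 ≤ r) (hr1 : r ≤ 1)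
    (hw : p * relVol P + q * relVol (H \ P) + r * relVol (univ \ H) = 1 / 2) :
    1 / 9 ≤ p ^ 2 * G.relEdges P P + q ^ 2 * G.relEdges (H \ P) (H \ P) +
      r ^ 2 * G.relEdges (univ \ H) (univ \ H) + 2 * p * q * G.relEdges P (H \ P) +
      2 * p * r * G.relEdges P (univ \ H) + 2 * q * r * G.relEdges (H \ P) (univ \ H) := by
  obtain ⟨w, hw0, hw1, hsum, hquad⟩ := G.exists_weight hP hp0 hp1 hq0 hq1 hr0 hr1
  exact hquad ▸ hG w hw0 hw1 (hsum.trans hw)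

theorem CliqueFree.triFreeOn (hG : G.CliqueFree 4) (u : V) :
    TriFreeOn G (univ.filter (G.Adj u)) := by
  intro x hx y hy z hz hxy hxz hyz
  rw [mem_filter] at hx hy hz
  refine hG _ ((is3Clique_triple_iff.2 ⟨hxy, hxz, hyz⟩).insert (a := u) fun b hb => ?_)
  simp only [mem_insert, mem_singleton] at hb
  rcases hb with rfl | rfl | rfl
  exacts [hx.2, hy.2, hz.2]

theorem relSum_erase_add {A : Finset V} {z : V} (hz : z ∈ A) (f : V → ℝ) :
    relSum (A.erase z) f + f z / Fintype.card V = relSum A f := by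
  rw [relSum, relSum, ← add_div, sum_erase_add _ _ hz]

theorem relSum_insert_of_notMem {A : Finset V} {z : V} (hz : z ∉ A) (f : V → ℝ) :
    relSum (insert z A) f = relSum A f + f z / Fintype.card V := by
  rw [relSum, relSum, ← add_div, sum_insert hz, add_comm]

theorem relDeg_le_of_isMaxCut {H P : Finset V} (hP : P ⊆ H)
    (hmax : ∀ P' ⊆ H, G.relEdges P' (H \ P') ≤ G.relEdges P (H \ P)) {z : V} (hz : z ∈ P) :
    G.relDeg z P ≤ G.relDeg z (H \ P) := by
  have h1 := hmax (P.erase z) ((erase_subset _ _).trans hP)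
  have h2 : H \ P.erase z = insert z (H \ P) := by
    ext x
    by_cases hx : x = z
    · subst hx; simp [hP hz]
    · simp [hx]
  have hN : (0:ℝ) < Fintype.card V := by exact_mod_cast Fintype.card_pos_iff.2 ⟨z⟩
  have h3 : G.relEdges (P.erase z) (insert z (H \ P)) =
      G.relEdges P (H \ P) - G.relDeg z (H \ P) / Fintype.card V +
        G.relDeg z P / Fintype.card V := by
    have h4 : G.relEdges (P.erase z) (insert z (H \ P)) =
        G.relEdges (P.erase z) (H \ P) + G.relDeg z (P.erase z) / Fintype.card V := by
      rw [relEdges_comm, relEdges, relSum_insert_of_notMem (by simp [hz]), ← relEdges, relEdges_comm]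
    have h5 := relSum_erase_add hz fun x => G.relDeg x (H \ P)
    have h6 := relSum_erase_add hz fun y => G.adjInd z y
    have h7 : G.adjInd z z = 0 := by simp [adjInd]
    rw [h7, zero_div, add_zero] at h6
    rw [h4, relEdges, relEdges, relDeg, h6, ← h5]
    rw [relDeg, relDeg]; ring
  rw [h2, h3] at h1
  have h8 : G.relDeg z P / Fintype.card V ≤ G.relDeg z (H \ P) / Fintype.card V := by linarith
  exact (div_le_div_iff_of_pos_right hN).1 h8

theorem TriFreeOn.relEdges_filter_le {H P : Finset V} (hH : TriFreeOn G H) (hP : P ⊆ H) {v : V}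
    (hv : v ∈ H) : G.relEdges (P.filter (G.Adj v)) P ≤ G.relEdges P P / 2 := by
  have hs : P.filter (G.Adj v) ⊆ P := filter_subset _ _
  have h0 : G.relEdges (P.filter (G.Adj v)) (P.filter (G.Adj v)) = 0 :=
    le_antisymm ((G.relEdges_mono (filter_subset_filter _ hP) (filter_subset_filter _ hP)).trans
      (hH.relEdges_filter_self hv).le) (G.relEdges_nonneg _ _)
  have h1 := G.relEdges_sdiff_right hs (P.filter (G.Adj v))
  have h2 := G.relEdges_sdiff_right hs (P \ P.filter (G.Adj v))
  have h3 := G.relEdges_sdiff_left hs P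
  have h4 := G.relEdges_comm (P.filter (G.Adj v)) (P \ P.filter (G.Adj v))
  have h5 := G.relEdges_nonneg (P \ P.filter (G.Adj v)) (P \ P.filter (G.Adj v))
  linarith

/-- Lower bounds for the density of missing pairs between `P` and `Q`, in terms of the edges inside
`P` and `Q`. -/
theorem TriFreeOn.missing_pairs {H P Q : Finset V} (hH : TriFreeOn G H) (hP : P ⊆ H) (hQ : Q ⊆ H)
    {μ sP sQ : ℝ} (hμ : 0 < μ) (hPμ : ∀ z ∈ P, G.relDeg z P ≤ μ)
    (hQμ : ∀ z ∈ Q, G.relDeg z Q ≤ μ) (hsP : sP * μ = G.relEdges P P / 2)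
    (hsQ : sQ * μ = G.relEdges Q Q / 2) {v : V} (hv : v ∈ P) (hvP : G.relDeg v P = μ) :
    relVol Q * sP + relVol P * sQ - 2 * sP * sQ ≤ relVol P * relVol Q - G.relEdges P Q ∧
    relVol Q * sP + relVol P * sQ - 2 * sP * sQ +
      (G.relDeg v Q * μ - G.relDeg v Q * sP - μ * sQ) ≤
        relVol P * relVol Q - G.relEdges P Q := by
  obtain ⟨α, hα⟩ : ∃ α : V → ℝ, α = fun z => G.relDeg z P * μ⁻¹ := ⟨_, rfl⟩
  obtain ⟨β, hβ⟩ : ∃ β : V → ℝ, β = fun z => G.relDeg z Q * μ⁻¹ := ⟨_, rfl⟩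
  have hμ' : 0 < μ⁻¹ := inv_pos.2 hμ
  have hα1 : ∀ z ∈ P, 0 ≤ 1 - α z := fun z hz => by
    rw [hα, sub_nonneg]
    exact (mul_le_mul_of_nonneg_right (hPμ z hz) hμ'.le).trans_eq (mul_inv_cancel₀ hμ.ne')
  have hβ1 : ∀ z ∈ Q, 0 ≤ 1 - β z := fun z hz => by
    rw [hβ, sub_nonneg]
    exact (mul_le_mul_of_nonneg_right (hQμ z hz) hμ'.le).trans_eq (mul_inv_cancel₀ hμ.ne')
  have hm : ∀ z q, 0 ≤ 1 - G.adjInd z q := fun z q => sub_nonneg.2 (G.adjInd_le_one z q)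
  have hsP' : sP = G.relEdges P P / 2 * μ⁻¹ := by rw [← hsP, mul_inv_cancel_right₀ hμ.ne']
  have hsQ' : sQ = G.relEdges Q Q / 2 * μ⁻¹ := by rw [← hsQ, mul_inv_cancel_right₀ hμ.ne']
  have hβsum : relSum Q β = 2 * sQ := by
    rw [hβ, relSum_mul_right, ← relEdges, hsQ']; ring
  have hαq : ∀ q ∈ Q, sP ≤ relSum P fun z => (1 - G.adjInd z q) * α z := fun q hq => by
    have := mul_le_mul_of_nonneg_right (hH.half_relEdges_le hP (hQ hq)) hμ'.le
    rw [hsP', hα]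
    simpa only [← relSum_mul_right, mul_assoc] using this
  have hβz : ∀ z ∈ P, sQ ≤ relSum Q fun q => (1 - G.adjInd z q) * β q := fun z hz => by
    have := mul_le_mul_of_nonneg_right (hH.half_relEdges_le hQ (hP hz)) hμ'.le
    rw [hsQ', hβ]
    simpa only [← relSum_mul_right, mul_assoc, G.adjInd_symm] using this
  have hdecomp : relVol P * relVol Q - G.relEdges P Q =
      relSum P (fun z => relSum Q fun q => (1 - β q) * ((1 - G.adjInd z q) * α z)) +
      relSum P (fun z => relSum Q fun q => (1 - G.adjInd z q) * β q) +
      relSum P (fun z => relSum Q fun q => (1 - G.adjInd z q) * ((1 - α z) * (1 - β q))) := by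
    rw [← relEdges_compl_graph]
    simp only [← relSum_add]
    refine relSum_congr fun z _ => relSum_congr fun q _ => by ring
  have h1 : sP * (relVol Q - 2 * sQ) ≤
      relSum P (fun z => relSum Q fun q => (1 - β q) * ((1 - G.adjInd z q) * α z)) := by
    rw [relSum_comm]
    simp only [relSum_mul_left (A := P)]
    calc sP * (relVol Q - 2 * sQ) = relSum Q fun q => (1 - β q) * sP := by
          rw [relSum_mul_right, relSum_sub, hβsum, relSum_const]; ring
      _ ≤ _ := relSum_mono fun q hq => mul_le_mul_of_nonneg_left (hαq q hq) (hβ1 q hq)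
  have h2 : sQ * relVol P ≤ relSum P (fun z => relSum Q fun q => (1 - G.adjInd z q) * β q) := by
    rw [← relSum_const]; exact relSum_mono hβz
  have hnn : ∀ z ∈ P, ∀ q ∈ Q, 0 ≤ (1 - G.adjInd z q) * ((1 - α z) * (1 - β q)) :=
    fun z hz q hq => mul_nonneg (hm z q) (mul_nonneg (hα1 z hz) (hβ1 q hq))
  have h3 : 0 ≤ relSum P (fun z => relSum Q fun q =>
      (1 - G.adjInd z q) * ((1 - α z) * (1 - β q))) :=
    relSum_nonneg fun z hz => relSum_nonneg fun q hq => hnn z hz q hq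
  have h4 : G.relDeg v Q * μ - G.relDeg v Q * sP - μ * sQ ≤ relSum P (fun z => relSum Q fun q =>
      (1 - G.adjInd z q) * ((1 - α z) * (1 - β q))) := by
    obtain ⟨P', hP'⟩ : ∃ P', P' = P.filter (G.Adj v) := ⟨_, rfl⟩
    obtain ⟨Q', hQ'⟩ : ∃ Q', Q' = Q.filter (G.Adj v) := ⟨_, rfl⟩
    have hPs : P' ⊆ P := hP' ▸ filter_subset _ _
    have hQs : Q' ⊆ Q := hQ' ▸ filter_subset _ _
    have hA : relSum P' α ≤ sP := by
      rw [hα, relSum_mul_right, ← relEdges, hsP', hP']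
      exact mul_le_mul_of_nonneg_right (hH.relEdges_filter_le hP (hP hv)) hμ'.le
    have hB : relSum Q' β ≤ sQ := by
      rw [hβ, relSum_mul_right, ← relEdges, hsQ', hQ']
      exact mul_le_mul_of_nonneg_right (hH.relEdges_filter_le hQ (hP hv)) hμ'.le
    have hA0 : 0 ≤ relSum P' α := relSum_nonneg fun z _ => by
      rw [hα]; exact mul_nonneg (G.relDeg_nonneg _ _) hμ'.le
    have hB0 : 0 ≤ relSum Q' β := relSum_nonneg fun z _ => by
      rw [hβ]; exact mul_nonneg (G.relDeg_nonneg _ _) hμ'.le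
    have hprod : relSum P' (fun z => relSum Q' fun q =>
        (1 - G.adjInd z q) * ((1 - α z) * (1 - β q))) =
        (μ - relSum P' α) * (G.relDeg v Q - relSum Q' β) := by
      rw [← hvP, G.relDeg_eq v P, G.relDeg_eq v Q, ← hP', ← hQ']
      have : ∀ z ∈ P', relSum Q' (fun q => (1 - G.adjInd z q) * ((1 - α z) * (1 - β q))) =
          (1 - α z) * (relVol Q' - relSum Q' β) := fun z hz => by
        rw [← one_mul (relVol Q'), ← relSum_const, ← relSum_sub, ← relSum_mul_left]
        refine relSum_congr fun q hq => ?_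
        rw [hP', mem_filter] at hz
        rw [hQ', mem_filter] at hq
        have : ¬ G.Adj z q := hH v (hP hv) z (hP hz.1) q (hQ hq.1) hz.2 hq.2
        simp [adjInd, this]
      rw [relSum_congr this, relSum_mul_right, relSum_sub, relSum_const, one_mul]
    have hle : (μ - relSum P' α) * (G.relDeg v Q - relSum Q' β) ≤ relSum P (fun z =>
        relSum Q fun q => (1 - G.adjInd z q) * ((1 - α z) * (1 - β q))) := by
      rw [← hprod]
      exact (relSum_mono fun z hz => relSum_mono_set hQs (hnn z (hPs hz))).trans
        (relSum_mono_set hPs fun z hz => relSum_nonneg (hnn z hz))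
    have h5 := mul_nonneg hA0 hB0
    have h6 := mul_le_mul_of_nonneg_left hA (G.relDeg_nonneg v Q)
    have h7 := mul_le_mul_of_nonneg_left hB hμ.le
    linarith
  rw [hdecomp]
  constructor <;> linarith

theorem relVol_sdiff {A B : Finset V} (h : A ⊆ B) : relVol (B \ A) = relVol B - relVol A :=
  eq_sub_of_add_eq' (relSum_sdiff h _)

theorem relEdges_self_eq {A B : Finset V} (h : A ⊆ B) : G.relEdges B B =
    G.relEdges A A + 2 * G.relEdges A (B \ A) + G.relEdges (B \ A) (B \ A) := by
  rw [← G.relEdges_sdiff_left h B, ← G.relEdges_sdiff_right h A, ← G.relEdges_sdiff_right h (B \ A),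
    G.relEdges_comm (B \ A) A]
  ring

/-- The neighbourhood of a vertex of maximum degree in a triangle-free set. -/
theorem TriFreeOn.exists_nbhd {H : Finset V} (hH : TriFreeOn G H) (hne : H.Nonempty) :
    ∃ I ⊆ H, G.relEdges I I = 0 ∧ G.relEdges I (H \ I) ≤ relVol I * relVol I ∧
      G.relEdges I (H \ I) + G.relEdges (H \ I) (H \ I) ≤ relVol I * (relVol H - relVol I) := by
  obtain ⟨v, hv, hmax⟩ := exists_max_image H (fun x => G.relDeg x H) hne
  have hs : H.filter (G.Adj v) ⊆ H := filter_subset _ _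
  have h0 := hH.relEdges_filter_self hv
  rw [G.relDeg_eq v] at hmax
  have h1 := G.relEdges_le_mul fun x hx => hmax x (hs hx)
  have h2 := G.relEdges_le_mul fun x (hx : x ∈ H \ H.filter (G.Adj v)) => hmax x (sdiff_subset hx)
  rw [← G.relEdges_sdiff_right hs] at h1 h2
  rw [relVol_sdiff hs, G.relEdges_comm _ (H.filter (G.Adj v))] at h2
  exact ⟨_, hs, h0, by linarith, h2⟩

theorem exists_isMaxCut (G : SimpleGraph V) [DecidableRel G.Adj] (H : Finset V) :
    ∃ P ⊆ H, ∀ P' ⊆ H, G.relEdges P' (H \ P') ≤ G.relEdges P (H \ P) := by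
  obtain ⟨P, hP, hmax⟩ := exists_max_image H.powerset (fun P => G.relEdges P (H \ P))
    (powerset_nonempty H)
  exact ⟨P, mem_powerset.1 hP, fun P' hP' => hmax P' (mem_powerset.2 hP')⟩

/-- The contribution of the complement of the neighbourhood of a vertex of maximum degree. -/
theorem relEdges_compl_le [Nonempty V] {H : Finset V} {d : ℝ} (hd : ∀ x, G.relDeg x univ ≤ d)
    (hH : relVol H = d) :
    2 * G.relEdges H (univ \ H) + G.relEdges (univ \ H) (univ \ H) ≤ d - G.relEdges H H := by
  have h1 := G.relEdges_le_mul (A := H) fun x _ => hd x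
  have h2 := G.relEdges_le_mul (A := univ \ H) fun x _ => hd x
  rw [← G.relEdges_sdiff_right (subset_univ H), hH] at h1
  rw [← G.relEdges_sdiff_right (subset_univ H), relVol_sdiff (subset_univ H), relVol_univ, hH,
    G.relEdges_comm _ H] at h2
  linarith

theorem HalfDense.cut_option (hG : G.HalfDense) {H P : Finset V} (hP : P ⊆ H)
    (hH : 1 / 2 ≤ relVol H) (hP1 : relVol P ≤ 1 / 2) {q : ℝ}
    (hq : q * (relVol H - relVol P) = 1 / 2 - relVol P) (hlt : relVol P < relVol H) :
    0 ≤ q ∧ q ≤ 1 ∧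
    1 / 9 ≤ G.relEdges P P + 2 * q * G.relEdges P (H \ P) +
      q ^ 2 * G.relEdges (H \ P) (H \ P) := by
  have hpos : 0 < relVol H - relVol P := by linarith
  have hq0 : 0 ≤ q := nonneg_of_mul_nonneg_left (by linarith) hpos
  have hq1 : q ≤ 1 := le_of_mul_le_mul_right (by linarith) hpos
  have := hG.three_parts hP zero_le_one le_rfl hq0 hq1 le_rfl zero_le_one
    (by rw [relVol_sdiff hP]; linarith)
  exact ⟨hq0, hq1, by linarith⟩

theorem HalfDense.compl_option (hG : G.HalfDense) [Nonempty V] {H P : Finset V} (hP : P ⊆ H)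
    {r : ℝ} (hr0 : 0 ≤ r) (hr1 : r ≤ 1) (hr : r * (1 - relVol H) = 1 / 2 - relVol P) :
    1 / 9 ≤ G.relEdges P P + 2 * r * G.relEdges P (univ \ H) +
      r ^ 2 * G.relEdges (univ \ H) (univ \ H) := by
  have := hG.three_parts hP zero_le_one le_rfl le_rfl zero_le_one hr0 hr1
    (by rw [relVol_sdiff (subset_univ H), relVol_univ]; linarith)
  linarith

theorem TriFreeOn.cut_contra {H P Q : Finset V} (hH : TriFreeOn G H) (hP : P ⊆ H) (hQ : Q ⊆ H)
    {d gP gQ : ℝ} (hd1 : 0.59 ≤ d) (hd2 : d < 2 / 3) (hab : relVol P + relVol Q = d)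
    (h1 : G.relEdges P Q + 2 * (G.relEdges P P / 2 + G.relEdges Q Q / 2) ≤ d ^ 2 / 4)
    (h2 : d / 18 ≤ G.relEdges P Q * (1 - d) + (G.relEdges P P / 2 + G.relEdges Q Q / 2) / 2)
    (hg : gP + gQ = 1)
    (h3 : 1 / 9 ≤ 2 * gQ * (G.relEdges P P / 2) + 2 * gP * (G.relEdges Q Q / 2) +
      gP * gQ * (d - 2 * (G.relEdges P Q + (G.relEdges P P / 2 + G.relEdges Q Q / 2))))
    {v : V} (hv : v ∈ P) (hvP : ∀ z ∈ P, G.relDeg z P ≤ G.relDeg v P)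
    (hvQ : ∀ z ∈ Q, G.relDeg z Q ≤ G.relDeg v P) (hvPQ : G.relDeg v P ≤ G.relDeg v Q)
    (hvH : 0.18 ≤ G.relDeg v P + G.relDeg v Q) : False := by
  have hPP := G.relEdges_nonneg P P
  have hQQ := G.relEdges_nonneg Q Q
  have hPP' := G.relEdges_le_mul hvP
  have hQQ' := G.relEdges_le_mul hvQ
  rcases (G.relDeg_nonneg v P).eq_or_lt with hμ | hμ
  · rw [← hμ, zero_mul] at hPP' hQQ'
    rw [le_antisymm hPP' hPP, le_antisymm hQQ' hQQ] at h1 h2 h3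
    exact scalar_contra_of_no_inner_edges (E := G.relEdges P Q) hd1 hd2 (by linarith) (by linarith) hg (by linarith)
  · have hsP : G.relEdges P P / 2 / G.relDeg v P * G.relDeg v P = G.relEdges P P / 2 :=
      div_mul_cancel₀ _ hμ.ne'
    have hsQ : G.relEdges Q Q / 2 / G.relDeg v P * G.relDeg v P = G.relEdges Q Q / 2 :=
      div_mul_cancel₀ _ hμ.ne'
    obtain ⟨hM, hM'⟩ := hH.missing_pairs hP hQ hμ hvP hvQ hsP hsQ hv rfl
    exact scalar_contra hd1 hd2 hab (by linarith) (by linarith) h1 h2 hg h3 hμ (by linarith) hvPQ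
      hsP hsQ (le_of_mul_le_mul_right (by linarith) hμ) (le_of_mul_le_mul_right (by linarith) hμ)
      hM hM'

theorem HalfDense.two_thirds_le [Nonempty V] (hG : G.HalfDense) (hK : G.CliqueFree 4)
    (hδ : ∀ x, 0.59 ≤ G.relDeg x univ) {u : V} (hu : ∀ x, G.relDeg x univ ≤ G.relDeg u univ) :
    2 / 3 ≤ G.relDeg u univ := by
  by_contra! hd2
  obtain ⟨H, hHd⟩ : ∃ H, H = univ.filter (G.Adj u) := ⟨_, rfl⟩
  have hH : TriFreeOn G H := hHd ▸ hK.triFreeOn u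
  obtain ⟨d, hd⟩ : ∃ d, d = G.relDeg u univ := ⟨_, rfl⟩
  have hvol : relVol H = d := by rw [hd, G.relDeg_eq, hHd]
  rw [← hd] at hu hd2
  have hd1 : 0.59 ≤ d := hd ▸ hδ u
  have hne : H.Nonempty := by
    rw [nonempty_iff_ne_empty]
    rintro rfl
    rw [relVol_eq] at hvol
    simp at hvol
    linarith
  obtain ⟨P, hP, hmax⟩ := G.exists_isMaxCut H
  obtain ⟨Q, hQd⟩ : ∃ Q, Q = H \ P := ⟨_, rfl⟩
  have hQ : Q ⊆ H := hQd ▸ sdiff_subset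
  have hPQ : H \ Q = P := by rw [hQd, Finset.sdiff_sdiff_eq_self hP]
  have hab : relVol P + relVol Q = d := by rw [hQd, relVol_sdiff hP, hvol]; ring
  have ht : G.relEdges H H = G.relEdges P P + 2 * G.relEdges P Q + G.relEdges Q Q := by
    rw [relEdges_self_eq hP, hQd]
  have hPP := G.relEdges_nonneg P P
  have hQQ := G.relEdges_nonneg Q Q
  have hE := G.relEdges_le P Q
  -- the sparse set around a vertex of maximum degree in `H`
  have hA : G.relEdges P Q + (G.relEdges P P + G.relEdges Q Q) ≤ d ^ 2 / 4 := by
    obtain ⟨I, hI, hI0, -, hI2⟩ := hH.exists_nbhd hne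
    have h1 := hmax I hI
    rw [relEdges_self_eq hI, hI0] at ht
    rw [← hQd] at h1
    rw [hvol] at hI2
    linarith [sq_nonneg (d / 2 - relVol I)]
  have hU : 4 * d ^ 2 / 9 ≤ G.relEdges H H := by
    have h1 : 1 / (2 * d) ≤ 1 := by rw [div_le_one (by linarith)]; linarith
    have h2 : 0 ≤ 1 / (2 * d) := by apply div_nonneg <;> linarith
    have h3 := hG.three_parts (H := H) (subset_refl H) h2 h1 le_rfl zero_le_one le_rfl zero_le_one
      (by rw [hvol]; field_simp; ring)
    have hd0 : 0 < d := by linarith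
    have h4 : (1 / (2 * d)) ^ 2 * G.relEdges H H = G.relEdges H H / (4 * d ^ 2) := by
      field_simp; ring
    rw [h4] at h3
    have h5 : 1 / 9 ≤ G.relEdges H H / (4 * d ^ 2) := by linarith
    rw [le_div_iff₀ (by positivity)] at h5
    linarith
  obtain ⟨a, ha⟩ : ∃ a, a = relVol P := ⟨_, rfl⟩
  obtain ⟨b, hb⟩ : ∃ b, b = relVol Q := ⟨_, rfl⟩
  have ha0 : 0 ≤ a := ha ▸ relVol_nonneg P
  have hb0 : 0 ≤ b := hb ▸ relVol_nonneg Q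
  have hE7 : 7 * d ^ 2 / 36 ≤ a * b := by rw [ha, hb]; linarith
  rw [← ha, ← hb] at hab
  have ha1 : a ≤ 1 / 2 := by
    obtain rfl : b = d - a := by linarith
    nlinarith
  have hb1 : b ≤ 1 / 2 := by
    obtain rfl : a = d - b := by linarith
    nlinarith
  have hapos : 0 < a := by linarith
  have hbpos : 0 < b := by linarith
  -- moving a half-sized set within `H`
  have hB : d / 18 ≤ G.relEdges P Q * (1 - d) + (G.relEdges P P / 2 + G.relEdges Q Q / 2) / 2 := by
    have hq : (1 / 2 - a) / b * b = 1 / 2 - a := div_mul_cancel₀ _ hbpos.ne'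
    have hr : (1 / 2 - b) / a * a = 1 / 2 - b := div_mul_cancel₀ _ hapos.ne'
    obtain ⟨q, hqd⟩ : ∃ q, q = (1 / 2 - a) / b := ⟨_, rfl⟩
    obtain ⟨r, hrd⟩ : ∃ r, r = (1 / 2 - b) / a := ⟨_, rfl⟩
    rw [← hqd] at hq
    rw [← hrd] at hr
    obtain ⟨hq0, hq1, h1⟩ := hG.cut_option hP (by linarith) (by linarith)
      (q := q) (by rw [hvol, ← ha, ← hab]; linarith) (by linarith)
    obtain ⟨hr0, hr1, h2⟩ := hG.cut_option hQ (by linarith) (by linarith)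
      (q := r) (by rw [hvol, ← hb, ← hab]; linarith) (by linarith)
    rw [← hQd] at h1
    rw [hPQ, G.relEdges_comm Q P] at h2
    have h3 := mul_le_mul_of_nonneg_right h1 hb0
    have h4 := mul_le_mul_of_nonneg_right h2 ha0
    have h5 : q ^ 2 * b ≤ 1 / 2 - a := by rw [sq, mul_assoc, hq]; nlinarith
    have h6 : r ^ 2 * a ≤ 1 / 2 - b := by rw [sq, mul_assoc, hr]; nlinarith
    have h7 := mul_le_mul_of_nonneg_right h5 hQQ
    have h8 := mul_le_mul_of_nonneg_right h6 hPP
    have h9 : q * b * G.relEdges P Q = (1 / 2 - a) * G.relEdges P Q := by rw [hq]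
    have h10 : r * a * G.relEdges P Q = (1 / 2 - b) * G.relEdges P Q := by rw [hr]
    obtain rfl : d = a + b := hab.symm
    linarith
  -- moving a half-sized set outside `H`
  have hk : 0 < 1 - d := by linarith
  have hgP : (1 / 2 - a) / (1 - d) * (1 - d) = 1 / 2 - a := div_mul_cancel₀ _ hk.ne'
  have hgQ : (1 / 2 - b) / (1 - d) * (1 - d) = 1 / 2 - b := div_mul_cancel₀ _ hk.ne'
  obtain ⟨gP, hgPd⟩ : ∃ g, g = (1 / 2 - a) / (1 - d) := ⟨_, rfl⟩
  obtain ⟨gQ, hgQd⟩ : ∃ g, g = (1 / 2 - b) / (1 - d) := ⟨_, rfl⟩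
  have hgP0 : 0 ≤ gP := hgPd ▸ div_nonneg (by linarith) hk.le
  have hgQ0 : 0 ≤ gQ := hgQd ▸ div_nonneg (by linarith) hk.le
  rw [← hgPd] at hgP
  rw [← hgQd] at hgQ
  have hg : gP + gQ = 1 := mul_right_cancel₀ hk.ne' (by linarith)
  have hC : 1 / 9 ≤ 2 * gQ * (G.relEdges P P / 2) + 2 * gP * (G.relEdges Q Q / 2) +
      gP * gQ * (d - 2 * (G.relEdges P Q + (G.relEdges P P / 2 + G.relEdges Q Q / 2))) := by
    have h1 := hG.compl_option hP hgP0 (by linarith) (by rw [hvol, ← ha]; exact hgP)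
    have h2 := hG.compl_option hQ hgQ0 (by linarith) (by rw [hvol, ← hb]; exact hgQ)
    have h3 := relEdges_compl_le hu hvol
    rw [ht, ← G.relEdges_sdiff_left hP, ← hQd] at h3
    have h4 := mul_le_mul_of_nonneg_right h1 hgQ0
    have h5 := mul_le_mul_of_nonneg_right h2 hgP0
    have h6 := mul_le_mul_of_nonneg_left h3 (mul_nonneg hgP0 hgQ0)
    have h7 : gP * gQ * G.relEdges (univ \ H) (univ \ H) * (gP + gQ) =
      gP * gQ * G.relEdges (univ \ H) (univ \ H) := by rw [hg, mul_one]
    have h8 : 1 / 9 * gP + 1 / 9 * gQ = 1 / 9 := by rw [← mul_add, hg, mul_one]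
    linarith
  -- the vertex with the most neighbours on its own side
  have hcP : ∀ z ∈ P, G.relDeg z P ≤ G.relDeg z Q := fun z hz =>
    hQd ▸ relDeg_le_of_isMaxCut hP hmax hz
  have hcQ : ∀ z ∈ Q, G.relDeg z Q ≤ G.relDeg z P := fun z hz => by
    have := relDeg_le_of_isMaxCut hQ (fun P' hP' => by
      rw [hPQ, G.relEdges_comm Q P, hQd]; exact hmax P' hP') hz
    rwa [hPQ] at this
  have hdegH : ∀ z, 0.18 ≤ G.relDeg z P + G.relDeg z Q := fun z => by
    have h1 := hδ z
    rw [← G.relDeg_sdiff z (subset_univ H), ← G.relDeg_sdiff z hP, ← hQd] at h1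
    have h2 := G.relDeg_le z (univ \ H)
    rw [relVol_sdiff (subset_univ H), relVol_univ, hvol] at h2
    linarith
  have hnonempty : ∀ {X : Finset V}, 0 < relVol X → X.Nonempty := fun {X} h => by
    rw [nonempty_iff_ne_empty]
    rintro rfl
    simp [relVol_eq] at h
  obtain ⟨v, hv, hvmax⟩ := exists_max_image P (fun z => G.relDeg z P) (hnonempty (ha ▸ hapos))
  obtain ⟨w, hw, hwmax⟩ := exists_max_image Q (fun z => G.relDeg z Q) (hnonempty (hb ▸ hbpos))
  rw [ha, hb] at hab
  rcases le_total (G.relDeg w Q) (G.relDeg v P) with h | h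
  · exact hH.cut_contra hP hQ hd1 hd2 hab (by linarith) hB hg hC hv hvmax
      (fun z hz => (hwmax z hz).trans h) (hcP v hv) (hdegH v)
  · rw [G.relEdges_comm P Q] at hA hB hC
    exact hH.cut_contra hQ hP hd1 hd2 (by linarith) (by linarith) (by linarith)
      (by linarith : gQ + gP = 1) (by linarith) hw hwmax
      (fun z hz => (hvmax z hz).trans h) (hcQ w hw) (by linarith [hdegH w])

theorem HalfDense.exists_tripartition [Nonempty V] (hG : G.HalfDense) (hK : G.CliqueFree 4)
    (hδ : ∀ x, 0.59 ≤ G.relDeg x univ) :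
    ∃ H I : Finset V, I ⊆ H ∧ relVol I = 1 / 3 ∧ relVol (H \ I) = 1 / 3 ∧
      relVol (univ \ H) = 1 / 3 ∧ G.relEdges I I = 0 ∧ G.relEdges (H \ I) (H \ I) = 0 ∧
      G.relEdges (univ \ H) (univ \ H) = 0 ∧ 1 / 9 ≤ G.relEdges I (H \ I) ∧
      1 / 9 ≤ G.relEdges I (univ \ H) ∧ 1 / 9 ≤ G.relEdges (H \ I) (univ \ H) := by
  obtain ⟨u, -, hu⟩ := exists_max_image univ (fun x => G.relDeg x univ) univ_nonempty
  replace hu : ∀ x, G.relDeg x univ ≤ G.relDeg u univ := fun x => hu x (mem_univ x)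
  have hd2 := hG.two_thirds_le hK hδ hu
  obtain ⟨H, hHd⟩ : ∃ H, H = univ.filter (G.Adj u) := ⟨_, rfl⟩
  have hH : TriFreeOn G H := hHd ▸ hK.triFreeOn u
  have hvol : relVol H = G.relDeg u univ := by rw [G.relDeg_eq, hHd]
  rw [← hvol] at hu hd2
  have hne : H.Nonempty := by
    rw [nonempty_iff_ne_empty]
    rintro rfl
    norm_num [relVol_eq] at hd2
  obtain ⟨I, hI, hI0, hI1, hI2⟩ := hH.exists_nbhd hne
  have hIhalf : relVol I ≤ 1 / 2 := by
    by_contra! h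
    have hp : 0 < relVol I := by linarith
    have h2 := hG.three_parts hI (p := 1 / (2 * relVol I)) (q := 0) (r := 0) (by positivity)
      (by rw [div_le_one (by linarith)]; linarith) le_rfl zero_le_one le_rfl zero_le_one
      (by field_simp; ring)
    rw [hI0] at h2
    norm_num at h2
  have hlt : relVol I < relVol H := by linarith
  have hq : (1 / 2 - relVol I) / (relVol H - relVol I) * (relVol H - relVol I) =
      1 / 2 - relVol I := div_mul_cancel₀ _ (by linarith)
  obtain ⟨hq0, hq1, hcost⟩ := hG.cut_option hI (by linarith) hIhalf hq hlt
  rw [hI0] at hcost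
  have hB0 := G.relEdges_nonneg (H \ I) (H \ I)
  obtain ⟨hd, hh, hp, hf⟩ := scalar_equality hd2 hIhalf hq0 hq1 hq hB0 hI2 hI1 (by linarith)
  have hB : G.relEdges (H \ I) (H \ I) = 0 := le_antisymm hf hB0
  have hBvol : relVol (H \ I) = 1 / 3 := by rw [relVol_sdiff hI, hd, hh]; norm_num
  have hCvol : relVol (univ \ H) = 1 / 3 := by
    rw [relVol_sdiff (subset_univ H), relVol_univ, hd]; norm_num
  have h1 := hG.compl_option hI (r := 1 / 2) (by norm_num) (by norm_num)
    (by rw [hd, hh]; norm_num)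
  have h2 := hG.compl_option (sdiff_subset : H \ I ⊆ H) (r := 1 / 2) (by norm_num) (by norm_num)
    (by rw [hd, hBvol]; norm_num)
  have h3 := G.relEdges_le_mul (A := univ \ H) fun x _ => hu x
  rw [← G.relEdges_sdiff_right (subset_univ H), hCvol, hd, G.relEdges_comm _ H,
    ← G.relEdges_sdiff_left hI] at h3
  have hC0 := G.relEdges_nonneg (univ \ H) (univ \ H)
  have hC : G.relEdges (univ \ H) (univ \ H) = 0 := by linarith
  exact ⟨H, I, hI, hh, hBvol, hCvol, hI0, hB, hC, hp, by linarith, by linarith⟩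

end SimpleGraph

namespace SimpleGraph

variable {V : Type*} [Fintype V] {G : SimpleGraph V} [DecidableRel G.Adj]

theorem natCast_degree_eq [Nonempty V] (x : V) :
    (G.degree x : ℝ) = Fintype.card V * G.relDeg x univ := by
  have hN : (Fintype.card V : ℝ) ≠ 0 := by exact_mod_cast Fintype.card_ne_zero
  rw [relDeg_eq, relVol_eq, ← card_neighborFinset_eq_degree, neighborFinset_eq_filter]
  field_simp

theorem two_mul_card_edgeFinset_eq_relEdges [Nonempty V] (G : SimpleGraph V) [DecidableRel G.Adj] :
    2 * (#G.edgeFinset : ℝ) = Fintype.card V ^ 2 * G.relEdges univ univ := by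
  have hN : (Fintype.card V : ℝ) ≠ 0 := by exact_mod_cast Fintype.card_ne_zero
  have h := G.sum_degrees_eq_twice_card_edges
  rw [← Nat.cast_ofNat, ← Nat.cast_mul, ← h, Nat.cast_sum]
  simp only [natCast_degree_eq, ← mul_sum]
  rw [relEdges, relSum]
  field_simp

theorem nonempty_iso_turanGraph_three [Nonempty V] (hK : G.CliqueFree 4)
    (h : 2 / 3 ≤ G.relEdges univ univ) :
    Nonempty (G ≃g turanGraph (Fintype.card V) 3) := by
  refine IsTuranMaximal.nonempty_iso_turanGraph ⟨hK, fun G' _ hK' => ?_⟩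
  have h1 := CliqueFree.card_edgeFinset_le (r := 3) hK'
  have h2 := mul_card_edgeFinset_turanGraph_le (n := Fintype.card V) (r := 3)
  rw [card_edgeFinset_turanGraph] at h2
  have h3 : 2 * 3 * #G'.edgeFinset ≤ (3 - 1) * Fintype.card V ^ 2 :=
    (Nat.mul_le_mul_left _ h1).trans h2
  have h4 : (2 * 3 * #G'.edgeFinset : ℝ) ≤ 2 * Fintype.card V ^ 2 := by exact_mod_cast h3
  have h5 := G.two_mul_card_edgeFinset_eq_relEdges
  have h6 := mul_le_mul_of_nonneg_left h (sq_nonneg (Fintype.card V : ℝ))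
  have h7 : (#G'.edgeFinset : ℝ) ≤ #G.edgeFinset := by linarith
  exact_mod_cast h7

variable [DecidableEq V]

theorem two_mul_edgesIn (G : SimpleGraph V) [DecidableRel G.Adj] (S : Finset V) :
    2 * (edgesIn G S : ℝ) = ∑ x ∈ S, ∑ y ∈ S, G.adjInd x y := by
  obtain ⟨G', hG'⟩ : ∃ G' : SimpleGraph V, ∀ x y, G'.Adj x y ↔ (G.Adj x y ∧ x ∈ S ∧ y ∈ S) :=
    ⟨⟨fun x y => G.Adj x y ∧ x ∈ S ∧ y ∈ S, ⟨fun _ _ h => ⟨h.1.symm, h.2.2, h.2.1⟩⟩,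
      ⟨fun x h => G.loopless.irrefl x h.1⟩⟩, fun _ _ => Iff.rfl⟩
  classical
  have h1 : edgesIn G S = #G'.edgeFinset := by
    rw [edgesIn]
    congr 1
    ext e
    induction e with
    | _ x y => simp [hG']
  have h2 := G'.sum_degrees_eq_twice_card_edges
  rw [h1, ← Nat.cast_ofNat, ← Nat.cast_mul, ← h2, Nat.cast_sum]
  have h3 : ∀ x, (G'.degree x : ℝ) = if x ∈ S then ∑ y ∈ S, G.adjInd x y else 0 := fun x => by
    rw [← card_neighborFinset_eq_degree, neighborFinset_eq_filter]
    simp only [adjInd, hG', card_filter, Nat.cast_sum]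
    split_ifs with h
    · rw [← sum_filter_add_sum_filter_not univ (· ∈ S)]
      simp +contextual [h]
    · simp [h]
  simp only [h3]
  simp

theorem exists_edgesIn_le [Nonempty V] (G : SimpleGraph V) [DecidableRel G.Adj] {w : V → ℝ}
    (hw0 : ∀ x, 0 ≤ w x) (hw1 : ∀ x, w x ≤ 1) (hw : relSum univ w = 1 / 2) :
    ∃ S : Finset V, #S = Fintype.card V / 2 ∧
      (2 * edgesIn G S : ℝ) / Fintype.card V ^ 2 ≤
        relSum univ fun x => relSum univ fun y => G.adjInd x y * (w x * w y) := by
  have hN : (Fintype.card V : ℝ) ≠ 0 := by exact_mod_cast Fintype.card_ne_zero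
  obtain ⟨S, hS, hle⟩ := exists_finset_sum_le (M := Matrix.of G.adjInd)
    (Matrix.IsSymm.ext fun x y => G.adjInd_symm y x) G.adjInd_nonneg
    (fun x => by simp [adjInd]) (n := Fintype.card V) w hw0 hw1 (by
      rw [relSum, div_eq_div_iff hN two_ne_zero] at hw
      linarith)
  refine ⟨S, hS, ?_⟩
  have h1 : (relSum univ fun x => relSum univ fun y => G.adjInd x y * (w x * w y)) =
      (w ⬝ᵥ (Matrix.of G.adjInd).mulVec w) / Fintype.card V ^ 2 := by
    simp only [relSum, dotProduct, Matrix.mulVec, mul_sum, ← sum_div, Matrix.of_apply]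
    rw [div_div, sq]
    congr 1
    exact sum_congr rfl fun x _ => sum_congr rfl fun y _ => by ring
  rw [h1, two_mul_edgesIn]
  exact div_le_div_of_nonneg_right hle (sq_nonneg _)

theorem halfDense_of_edgesIn [Nonempty V]
    (h : ∀ S : Finset V, #S = Fintype.card V / 2 →
      (Fintype.card V : ℝ) ^ 2 / 18 ≤ edgesIn G S) : G.HalfDense := by
  intro w hw0 hw1 hw
  have hN : (0 : ℝ) < Fintype.card V := by exact_mod_cast Fintype.card_pos
  obtain ⟨S, hS, hle⟩ := G.exists_edgesIn_le hw0 hw1 hw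
  refine le_trans ?_ hle
  rw [le_div_iff₀ (by positivity)]
  linarith [h S hS]

end SimpleGraph

/-- A `K₄`-free graph on `n` vertices with minimum degree at least `0.59·n`
contains a vertex set of size `⌊n/2⌋` spanning at most `n²/18` edges; moreover if every such
set spans at least `n²/18` edges, the graph is isomorphic to `T₃(n)`. -/
theorem dense_range_sparse_half {n : ℕ} (G : SimpleGraph (Fin n)) [DecidableRel G.Adj]
    (hK4 : G.CliqueFree 4) (hδ : ∀ v, (0.59 : ℝ) * (n : ℝ) ≤ (G.degree v : ℝ)) :
    (∃ S : Finset (Fin n), S.card = n / 2 ∧ (edgesIn G S : ℝ) ≤ (n : ℝ) ^ 2 / 18) ∧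
    ((∀ S : Finset (Fin n), S.card = n / 2 → (n : ℝ) ^ 2 / 18 ≤ (edgesIn G S : ℝ)) →
      Nonempty (G ≃g SimpleGraph.turanGraph n 3)) := by
  rcases Nat.eq_zero_or_pos n with rfl | hn
  · have : G = ⊥ := by ext x; exact x.elim0
    subst this
    refine ⟨⟨∅, by simp, by simp [edgesIn]⟩, fun _ => ⟨⟨Equiv.refl _, fun {a} => a.elim0⟩⟩⟩
  have : Nonempty (Fin n) := ⟨⟨0, hn⟩⟩
  have hn0 : (0 : ℝ) < n := by exact_mod_cast hn
  have hδ' : ∀ x, 0.59 ≤ G.relDeg x univ := fun x => by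
    have h := hδ x
    rw [SimpleGraph.natCast_degree_eq, Fintype.card_fin, mul_comm] at h
    exact le_of_mul_le_mul_left h hn0
  constructor
  · by_contra! hS
    have hG : G.HalfDense := SimpleGraph.halfDense_of_edgesIn fun S h => by
      rw [Fintype.card_fin] at h ⊢
      exact (hS S h).le
    obtain ⟨H, I, hI, hIv, hBv, -, hI0, hB0, -, -, -, -⟩ := hG.exists_tripartition hK4 hδ'
    obtain ⟨w, hw0, hw1, hw, hq⟩ := G.exists_weight hI zero_le_one le_rfl
      (by norm_num : (0 : ℝ) ≤ 1 / 2) (by norm_num) le_rfl zero_le_one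
    obtain ⟨S, hS', hle⟩ := G.exists_edgesIn_le hw0 hw1 (by rw [hw, hIv, hBv]; norm_num)
    rw [Fintype.card_fin] at hS' hle
    have h1 := G.relEdges_le I (H \ I)
    rw [hIv, hBv] at h1
    rw [hq, hI0, hB0, div_le_iff₀ (by positivity)] at hle
    have h2 := mul_le_mul_of_nonneg_right h1 (sq_nonneg (n : ℝ))
    linarith [hS S hS']
  · intro hS
    have hG : G.HalfDense := SimpleGraph.halfDense_of_edgesIn (by rwa [Fintype.card_fin])
    obtain ⟨H, I, hI, -, -, -, hI0, hB0, hC0, hIB, hIC, hBC⟩ := hG.exists_tripartition hK4 hδ'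
    have h := SimpleGraph.nonempty_iso_turanGraph_three hK4 (by
      rw [SimpleGraph.relEdges_self_eq (subset_univ H), SimpleGraph.relEdges_self_eq hI,
        ← G.relEdges_sdiff_left hI (univ \ H)]
      linarith)
    rwa [Fintype.card_fin] at h
end

section
/- Let G be a K_4-free graph on n vertices (with n even) that contains an induced triangle-free subgraph on at least 2n/3 vertices. Then G contains a vertex set of size n/2 that spans at most n²/18 edges. Moreover, if the induced triangle-free subgraph has strictly more than 2n/3 vertices, then G contains a vertex set of size n/2 that spans strictly fewer than n²/18 edges. -/
open Finset

section SparseHalf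

variable {V : Type*} (G : SimpleGraph V) [DecidableRel G.Adj]

/-- Number of neighbours of `v` inside `T`. -/
def degreeIn (T : Finset V) (v : V) : ℕ := (T.filter (G.Adj v)).card

/-- Sum over `T` of the degrees inside `T`, i.e. twice the number of edges spanned by `T`. -/
def degreeSum (T : Finset V) : ℕ := ∑ v ∈ T, degreeIn G T v

theorem degreeSum_eq_two_mul_edgesIn [Fintype V] [DecidableEq V] (S : Finset V) :
    degreeSum G S = 2 * edgesIn G S := by
  classical
  let H : SimpleGraph V :=
    { Adj := fun u v => G.Adj u v ∧ u ∈ S ∧ v ∈ S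
      symm := ⟨fun u v h => ⟨h.1.symm, h.2.2, h.2.1⟩⟩
      loopless := ⟨fun u h => G.loopless.irrefl u h.1⟩ }
  have hE : H.edgeFinset = G.edgeFinset.filter fun e => ∀ v ∈ e, v ∈ S := by
    ext e
    induction e with
    | h u v => simp [H]
  have hdeg : ∀ u, H.degree u = if u ∈ S then degreeIn G S u else 0 := by
    intro u
    rw [← SimpleGraph.card_neighborFinset_eq_degree]
    split_ifs with hu
    · unfold degreeIn
      congr 1
      ext v
      simp [H, hu, and_comm]
    · rw [card_eq_zero]
      ext v
      simp [H, hu]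
  have h := H.sum_degrees_eq_twice_card_edges
  rw [hE] at h
  simp only [hdeg] at h
  rw [edgesIn, ← h, degreeSum]
  simp

theorem degreeIn_erase [DecidableEq V] (T : Finset V) (u v : V) (hv : v ∈ T) :
    degreeIn G (T.erase v) u + (if G.Adj u v then 1 else 0) = degreeIn G T u := by
  unfold degreeIn
  rw [filter_erase]
  split_ifs with h
  · exact card_erase_add_one (by simp [hv, h])
  · rw [erase_eq_of_notMem (by simp [h])]; rfl

theorem degreeSum_erase [DecidableEq V] (T : Finset V) {v : V} (hv : v ∈ T) :
    degreeSum G (T.erase v) + 2 * degreeIn G T v = degreeSum G T := by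
  have h1 : degreeSum G T = degreeIn G T v + ∑ u ∈ T.erase v, degreeIn G T u :=
    (add_sum_erase T _ hv).symm
  have h2 : ∑ u ∈ T.erase v, degreeIn G T u
      = degreeSum G (T.erase v) + degreeIn G (T.erase v) v := by
    rw [degreeSum, degreeIn, card_filter, ← sum_add_distrib]
    refine sum_congr rfl fun u _ => ?_
    rw [← degreeIn_erase G T u v hv]
    simp [G.adj_comm]
  have h3 := degreeIn_erase G T v v hv
  simp at h3
  omega

theorem sum_sum_degreeIn (T : Finset V) :
    ∑ v ∈ T, ∑ u ∈ T.filter (G.Adj v), degreeIn G T u = ∑ u ∈ T, degreeIn G T u ^ 2 := by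
  simp_rw [sum_filter]
  rw [sum_comm]
  refine sum_congr rfl fun u _ => ?_
  rw [← sum_filter, sum_const, smul_eq_mul, sq]
  simp [degreeIn, G.adj_comm]

theorem degreeSum_sq_le (T : Finset V) :
    degreeSum G T ^ 2 ≤ T.card * ∑ u ∈ T, degreeIn G T u ^ 2 :=
  sq_sum_le_card_mul_sum_sq

theorem degreeIn_add_le [DecidableEq V] {T : Finset V}
    (hT : ∀ x ∈ T, ∀ y ∈ T, ∀ z ∈ T, G.Adj x y → G.Adj x z → ¬ G.Adj y z)
    {u v : V} (hu : u ∈ T) (hv : v ∈ T) (huv : G.Adj u v) :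
    degreeIn G T u + degreeIn G T v ≤ T.card := by
  unfold degreeIn
  rw [← card_union_of_disjoint]
  · exact card_le_card (union_subset (filter_subset _ _) (filter_subset _ _))
  · rw [disjoint_filter]
    exact fun x hx h1 h2 => hT u hu v hv x hx huv h1 h2

theorem two_mul_degreeSum_le [DecidableEq V] {T : Finset V}
    (hT : ∀ x ∈ T, ∀ y ∈ T, ∀ z ∈ T, G.Adj x y → G.Adj x z → ¬ G.Adj y z) :
    2 * degreeSum G T ≤ T.card ^ 2 := by
  have h1 : ∑ v ∈ T, ∑ u ∈ T.filter (G.Adj v), (degreeIn G T v + degreeIn G T u)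
      ≤ ∑ v ∈ T, ∑ u ∈ T.filter (G.Adj v), T.card := by
    refine sum_le_sum fun v hv => sum_le_sum fun u hu => ?_
    rw [mem_filter] at hu
    exact degreeIn_add_le G hT hv hu.1 hu.2
  simp_rw [sum_add_distrib, sum_sum_degreeIn, sum_const, smul_eq_mul, ← sum_mul] at h1
  have h2 : ∑ v ∈ T, (T.filter (G.Adj v)).card * degreeIn G T v = ∑ u ∈ T, degreeIn G T u ^ 2 :=
    sum_congr rfl fun u _ => by rw [sq]; rfl
  have h3 : ∑ v ∈ T, (T.filter (G.Adj v)).card = degreeSum G T := rfl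
  rw [h2, h3] at h1
  have h4 := degreeSum_sq_le G T
  rcases Nat.eq_zero_or_pos (degreeSum G T) with h | h
  · simp [h]
  · refine Nat.le_of_mul_le_mul_right ?_ h
    nlinarith

/-- Some vertex has neighbours whose average degree is at least the average degree. -/
theorem exists_le_sum_degreeIn {T : Finset V} (hT : T.Nonempty) :
    ∃ v ∈ T, degreeSum G T * degreeIn G T v
      ≤ T.card * ∑ u ∈ T.filter (G.Adj v), degreeIn G T u := by
  refine exists_le_of_sum_le hT ?_
  rw [← mul_sum, ← mul_sum, sum_sum_degreeIn]
  calc _ = degreeSum G T ^ 2 := by rw [sq]; rfl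
    _ ≤ _ := degreeSum_sq_le G T

/-- The bilinear form of the adjacency matrix. -/
def adjForm [Fintype V] (x y : V → ℝ) : ℝ := ∑ u, ∑ v, if G.Adj u v then x u * y v else 0

theorem adjForm_comm [Fintype V] (x y : V → ℝ) : adjForm G x y = adjForm G y x := by
  unfold adjForm
  rw [sum_comm]
  simp_rw [G.adj_comm, mul_comm]

theorem adjForm_add_smul_left [Fintype V] (x z y : V → ℝ) (t : ℝ) :
    adjForm G (x + t • z) y = adjForm G x y + t * adjForm G z y := by
  unfold adjForm
  simp_rw [mul_sum, ← sum_add_distrib]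
  refine sum_congr rfl fun u _ => sum_congr rfl fun v _ => ?_
  split_ifs <;> simp
  ring

theorem adjForm_smul_smul [Fintype V] (x : V → ℝ) (t : ℝ) :
    adjForm G (t • x) (t • x) = t ^ 2 * adjForm G x x := by
  unfold adjForm
  simp_rw [mul_sum]
  refine sum_congr rfl fun u _ => sum_congr rfl fun v _ => ?_
  split_ifs <;> simp
  ring

theorem adjForm_add_smul [Fintype V] (x z : V → ℝ) (t : ℝ) :
    adjForm G (x + t • z) (x + t • z)
      = adjForm G x x + 2 * t * adjForm G z x + t ^ 2 * adjForm G z z := by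
  rw [adjForm_add_smul_left, adjForm_comm G x, adjForm_comm G z, adjForm_add_smul_left,
    adjForm_add_smul_left, adjForm_comm G x z]
  ring

/-- The real indicator function of a finite set. -/
def indic [DecidableEq V] (S : Finset V) : V → ℝ := fun v => if v ∈ S then 1 else 0

theorem sum_indic [Fintype V] [DecidableEq V] (S : Finset V) : ∑ v, indic S v = S.card := by
  simp [indic]

theorem adjForm_indic [Fintype V] [DecidableEq V] (S T : Finset V) :
    adjForm G (indic S) (indic T) = ∑ u ∈ S, (degreeIn G T u : ℝ) := by
  have h : ∀ u, (∑ v, if G.Adj u v then indic S u * indic T v else 0)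
      = if u ∈ S then (degreeIn G T u : ℝ) else 0 := by
    intro u
    by_cases hu : u ∈ S
    · simp only [indic, hu, if_true, one_mul, degreeIn, card_filter]
      push_cast
      rw [← sum_filter, ← sum_filter, ← sum_filter, filter_filter]
      refine sum_congr ?_ fun _ _ => rfl
      ext
      simp [and_comm]
    · simp [indic, hu]
  unfold adjForm
  simp_rw [h]
  simp

theorem adjForm_swap [Fintype V] [DecidableEq V] (u v : V) :
    adjForm G (Pi.single u 1 - Pi.single v 1) (Pi.single u 1 - Pi.single v 1)
      = if G.Adj u v then -2 else 0 := by
  have hs : ∀ w : V, (Pi.single w 1 : V → ℝ) = indic {w} := by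
    intro w; ext x; simp [indic, Pi.single_apply]
  have := adjForm_add_smul G (indic {u}) (indic {v}) (-1)
  rw [hs, hs, sub_eq_add_neg, ← neg_one_smul ℝ (indic {v}), this]
  simp only [adjForm_indic, degreeIn, sum_singleton, filter_singleton]
  simp [G.adj_comm v u]
  split_ifs <;> simp

/-- Moving weight between two fractional coordinates, in one of the two directions, makes one of
them integral without increasing the form. -/
theorem exists_adjForm_swap [Fintype V] [DecidableEq V] {w : V → ℝ}
    (h0 : ∀ x, 0 ≤ w x) (h1 : ∀ x, w x ≤ 1) {u v : V}
    (huv : u ≠ v) (hu : 0 < w u ∧ w u < 1) (hv : 0 < w v ∧ w v < 1) :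
    ∃ w' : V → ℝ, (∀ x, 0 ≤ w' x) ∧ (∀ x, w' x ≤ 1) ∧ ∑ x, w' x = ∑ x, w x ∧
      adjForm G w' w' ≤ adjForm G w w ∧ (G.Adj u v → adjForm G w' w' < adjForm G w w) ∧
      (univ.filter fun x => 0 < w' x ∧ w' x < 1).card
        < (univ.filter fun x => 0 < w x ∧ w x < 1).card := by
  wlog hL : adjForm G (Pi.single u 1 - Pi.single v 1) w ≤ 0 generalizing u v
  · have hneg : adjForm G (Pi.single v 1 - Pi.single u 1) w
        = - adjForm G (Pi.single u 1 - Pi.single v 1) w := by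
      have h := adjForm_add_smul_left G 0 (Pi.single u 1 - Pi.single v 1) w (-1)
      have h' : adjForm G 0 w = 0 := by simp [adjForm]
      simp only [h', zero_add, neg_one_smul, neg_sub] at h
      linarith
    have := this huv.symm hv hu (by linarith)
    rwa [G.adj_comm] at this
  set t := min (1 - w u) (w v) with ht
  have ht0 : 0 < t := lt_min (by linarith) hv.1
  have htu : t ≤ 1 - w u := min_le_left _ _
  have htv : t ≤ w v := min_le_right _ _
  set w' := w + t • (Pi.single u 1 - Pi.single v 1 : V → ℝ) with hw'
  have hwu : w' u = w u + t := by simp [hw', huv]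
  have hwv : w' v = w v - t := by simp [hw', huv.symm, sub_eq_add_neg]
  have hwx : ∀ x, x ≠ u → x ≠ v → w' x = w x := by
    intro x hxu hxv; simp [hw', hxu, hxv]
  have hform := adjForm_add_smul G w (Pi.single u 1 - Pi.single v 1) t
  rw [adjForm_swap G, ← hw'] at hform
  have htL : t * adjForm G (Pi.single u 1 - Pi.single v 1) w ≤ 0 :=
    mul_nonpos_of_nonneg_of_nonpos ht0.le hL
  have ht2 : 0 < t ^ 2 := by positivity
  refine ⟨w', ?_, ?_, ?_, ?_, ?_, ?_⟩
  · intro x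
    by_cases hxu : x = u
    · subst hxu; linarith
    by_cases hxv : x = v
    · subst hxv; linarith
    rw [hwx x hxu hxv]; exact h0 x
  · intro x
    by_cases hxu : x = u
    · subst hxu; linarith
    by_cases hxv : x = v
    · subst hxv; linarith
    rw [hwx x hxu hxv]; exact h1 x
  · simp [hw', sum_add_distrib, ← mul_sum]
  · split_ifs at hform <;> nlinarith
  · intro h; rw [if_pos h] at hform; nlinarith
  · refine card_lt_card ((ssubset_iff_of_subset ?_).2 ?_)
    · intro x hx
      simp only [mem_filter, mem_univ, true_and] at hx ⊢
      by_cases hxu : x = u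
      · subst hxu; exact hu
      by_cases hxv : x = v
      · subst hxv; exact hv
      rwa [hwx x hxu hxv] at hx
    · rcases min_choice (1 - w u) (w v) with h | h
      · refine ⟨u, by simpa using hu, ?_⟩
        rw [← ht] at h
        have : w' u = 1 := by linarith
        simp [this]
      · refine ⟨v, by simpa using hv, ?_⟩
        rw [← ht] at h
        have : w' v = 0 := by linarith
        simp [this]

/-- A fractional vertex set of integral total weight can be rounded. -/
theorem exists_rounding [Fintype V] [DecidableEq V] (k : ℕ) (w : V → ℝ)
    (h0 : ∀ x, 0 ≤ w x) (h1 : ∀ x, w x ≤ 1)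
    (hk : ∑ x, w x = k) :
    ∃ S : Finset V, S.card = k ∧ (degreeSum G S : ℝ) ≤ adjForm G w w := by
  induction hN : (univ.filter fun x => 0 < w x ∧ w x < 1).card using Nat.strong_induction_on
    generalizing w with
  | _ N ih =>
    by_cases hex : ∃ u v, u ≠ v ∧ (0 < w u ∧ w u < 1) ∧ (0 < w v ∧ w v < 1)
    · obtain ⟨u, v, huv, hu, hv⟩ := hex
      obtain ⟨w', h0', h1', hs, hle, -, hcard⟩ := exists_adjForm_swap G h0 h1 huv hu hv
      obtain ⟨S, hS, hS'⟩ := ih _ (hN ▸ hcard) w' h0' h1' (hs.trans hk) rfl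
      exact ⟨S, hS, hS'.trans hle⟩
    · have hw01 : ∀ x, w x = 0 ∨ w x = 1 := by
        by_contra! hne
        obtain ⟨u, hu0, hu1⟩ := hne
        have hu : 0 < w u ∧ w u < 1 := ⟨(h0 u).lt_of_ne' hu0, (h1 u).lt_of_ne hu1⟩
        have hrest : ∀ x ∈ univ.erase u, w x = if w x = 1 then 1 else 0 := by
          intro x hx
          have hxu := ne_of_mem_erase hx
          split_ifs with h
          · exact h
          · by_contra hx0
            exact hex ⟨x, u, hxu, ⟨(h0 x).lt_of_ne' hx0, (h1 x).lt_of_ne h⟩, hu⟩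
        rw [← add_sum_erase _ _ (mem_univ u), sum_congr rfl hrest, sum_boole] at hk
        set c := ((univ.erase u).filter fun x => w x = 1).card
        have a1 : (c : ℝ) < k := by linarith
        have a2 : (k : ℝ) < c + 1 := by linarith
        norm_cast at a1 a2
        omega
      have hw : w = indic (univ.filter fun x => w x = 1) := by
        ext x
        rcases hw01 x with h | h <;> simp [indic, h]
      set S := univ.filter fun x => w x = 1
      refine ⟨S, ?_, ?_⟩
      · rw [hw, sum_indic] at hk
        exact_mod_cast hk
      · rw [hw, adjForm_indic, degreeSum]
        push_cast
        exact le_rfl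

theorem exists_rounding_lt [Fintype V] [DecidableEq V] (k : ℕ) (w : V → ℝ)
    (h0 : ∀ x, 0 ≤ w x) (h1 : ∀ x, w x < 1)
    (hk : ∑ x, w x = k) (hpos : 0 < adjForm G w w) :
    ∃ S : Finset V, S.card = k ∧ (degreeSum G S : ℝ) < adjForm G w w := by
  obtain ⟨u, v, huv, hu, hv⟩ : ∃ u v, G.Adj u v ∧ 0 < w u ∧ 0 < w v := by
    by_contra! hne
    refine hpos.not_ge (sum_nonpos fun u _ => sum_nonpos fun v _ => ?_)
    split_ifs with h
    · rcases (h0 u).eq_or_lt with hu | hu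
      · simp [← hu]
      · exact mul_nonpos_of_nonneg_of_nonpos (h0 u) (hne u v h hu)
    · exact le_rfl
  obtain ⟨w', h0', h1', hs, -, hlt, -⟩ :=
    exists_adjForm_swap G h0 (fun x => (h1 x).le) huv.ne ⟨hu, h1 u⟩ ⟨hv, h1 v⟩
  obtain ⟨S, hS, hS'⟩ := exists_rounding G k w' h0' h1' (hs.trans hk)
  exact ⟨S, hS, hS'.trans_lt (hlt huv)⟩

/-- If `A` is triangle-free and spans more than `2|A|²/9` edges, then some independent set of at
least `|A|/4` vertices of `A` has large average degree in `A`. -/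
theorem exists_independent_large_degree [DecidableEq V] {A : Finset V}
    (hA : ∀ x ∈ A, ∀ y ∈ A, ∀ z ∈ A, G.Adj x y → G.Adj x z → ¬ G.Adj y z)
    (hd : 4 * A.card ^ 2 < 9 * degreeSum G A) :
    ∃ I ⊆ A, A.card ≤ 4 * I.card ∧ 0 < I.card ∧ (∀ x ∈ I, ∀ y ∈ I, ¬ G.Adj x y) ∧
      (2 * (degreeSum G A : ℝ) - A.card ^ 2 / 2) * I.card
        ≤ A.card * ∑ u ∈ I, (degreeIn G A u : ℝ) := by
  set m := A.card with hm
  obtain ⟨T, hTA, hmax⟩ := exists_max_image A.powerset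
    (fun T => 4 * (degreeSum G T : ℤ) - 2 * (T.card : ℤ) ^ 2 + m * T.card) ⟨A, by simp⟩
  rw [mem_powerset] at hTA
  have hT : ∀ x ∈ T, ∀ y ∈ T, ∀ z ∈ T, G.Adj x y → G.Adj x z → ¬ G.Adj y z :=
    fun x hx y hy z hz => hA x (hTA hx) y (hTA hy) z (hTA hz)
  have hmantel : 2 * (degreeSum G T : ℤ) ≤ (T.card : ℤ) ^ 2 := by
    exact_mod_cast two_mul_degreeSum_le G hT
  have hmA := hmax A (by simp)
  simp only [← hm] at hmA
  set s := T.card with hs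
  have hd' : 4 * (m : ℤ) ^ 2 < 9 * degreeSum G A := by exact_mod_cast hd
  have hm0 : 0 < (m : ℤ) := by
    rcases Nat.eq_zero_or_pos m with h | h
    · have : A = ∅ := card_eq_zero.1 h
      subst this
      simp [degreeSum] at hd
    · exact_mod_cast h
  have hsm : 7 * (m : ℤ) < 9 * s := by
    refine lt_of_mul_lt_mul_left ?_ hm0.le
    nlinarith
  have hTne : T.Nonempty := card_pos.1 (by omega)
  have hdeg : ∀ v ∈ T, m ≤ 4 * degreeIn G T v := by
    intro v hv
    have h := hmax (T.erase v) (mem_powerset.2 ((erase_subset _ _).trans hTA))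
    have he := degreeSum_erase G T hv
    have hc := card_erase_add_one hv
    simp only [← hs] at h hc
    zify at he hc
    have e1 : ((T.erase v).card : ℤ) = s - 1 := by linarith
    have e2 : (degreeSum G (T.erase v) : ℤ) = degreeSum G T - 2 * degreeIn G T v := by linarith
    rw [e1, e2] at h
    have : 4 * (s : ℤ) - 2 - m ≤ 8 * degreeIn G T v := by nlinarith
    omega
  obtain ⟨v, hv, hav⟩ := exists_le_sum_degreeIn G hTne
  refine ⟨T.filter (G.Adj v), (filter_subset _ _).trans hTA, hdeg v hv, ?_, ?_, ?_⟩
  · have := hdeg v hv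
    change 0 < degreeIn G T v
    omega
  · intro x hx y hy
    rw [mem_filter] at hx hy
    exact hT v hv x hx.1 y hy.1 hx.2 hy.2
  · have hmono : ∑ u ∈ T.filter (G.Adj v), (degreeIn G T u : ℝ)
        ≤ ∑ u ∈ T.filter (G.Adj v), (degreeIn G A u : ℝ) :=
      sum_le_sum fun u _ => by
        exact_mod_cast card_le_card (filter_subset_filter _ hTA)
    have hav' : (degreeSum G T : ℝ) * (T.filter (G.Adj v)).card
        ≤ s * ∑ u ∈ T.filter (G.Adj v), (degreeIn G T u : ℝ) := by exact_mod_cast hav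
    set d : ℝ := ((T.filter (G.Adj v)).card : ℝ)
    set X := ∑ u ∈ T.filter (G.Adj v), (degreeIn G T u : ℝ)
    have hmA' : 4 * (degreeSum G A : ℝ) - 2 * (m : ℝ) ^ 2 + m * m
        ≤ 4 * (degreeSum G T : ℝ) - 2 * (s : ℝ) ^ 2 + m * s := by exact_mod_cast hmA
    have hmantel' : 2 * (degreeSum G T : ℝ) ≤ (s : ℝ) ^ 2 := by exact_mod_cast hmantel
    have hsA : (s : ℝ) ≤ m := by exact_mod_cast card_le_card hTA
    have hs0 : (0 : ℝ) < s := by exact_mod_cast card_pos.2 hTne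
    have hsm' : (m : ℝ) ≤ 2 * s := by
      have : (m : ℤ) ≤ 2 * s := by linarith
      exact_mod_cast this
    have hd0 : 0 ≤ d := Nat.cast_nonneg _
    have key : (2 * (degreeSum G A : ℝ) - m ^ 2 / 2) * s ≤ m * degreeSum G T := by
      have h1 : (2 * (degreeSum G A : ℝ) - m ^ 2 / 2)
          ≤ 2 * (degreeSum G T : ℝ) - (s : ℝ) ^ 2 + m * s / 2 := by linarith
      have h2 := mul_le_mul_of_nonneg_right h1 hs0.le
      nlinarith [mul_nonneg (sub_nonneg.2 hsm') (sub_nonneg.2 hmantel')]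
    have hX : (2 * (degreeSum G A : ℝ) - m ^ 2 / 2) * d ≤ m * X := by
      refine le_of_mul_le_mul_right ?_ hs0
      have h1 := mul_le_mul_of_nonneg_right key hd0
      have h2 := mul_le_mul_of_nonneg_left hav' (Nat.cast_nonneg (α := ℝ) m)
      nlinarith
    exact hX.trans (mul_le_mul_of_nonneg_left hmono (Nat.cast_nonneg _))

/-- A triangle-free vertex set contains a fractional subset of three quarters of its size spanning
at most the weight that a balanced complete bipartite graph allows. -/
theorem exists_fractional_sparse [Fintype V] [DecidableEq V] {A : Finset V}
    (hA : ∀ x ∈ A, ∀ y ∈ A, ∀ z ∈ A, G.Adj x y → G.Adj x z → ¬ G.Adj y z) :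
    ∃ w : V → ℝ, (∀ x, 0 ≤ w x) ∧ (∀ x, w x ≤ 1) ∧ ∑ x, w x = 3 / 4 * (A.card : ℝ) ∧
      adjForm G w w ≤ (A.card : ℝ) ^ 2 / 4 := by
  have hDA : adjForm G (indic A) (indic A) = degreeSum G A := by
    rw [adjForm_indic, degreeSum]; push_cast; rfl
  by_cases hd : 9 * degreeSum G A ≤ 4 * A.card ^ 2
  · refine ⟨(3 / 4 : ℝ) • indic A, ?_, ?_, ?_, ?_⟩
    · intro x; simp only [indic, Pi.smul_apply, smul_eq_mul]; split_ifs <;> norm_num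
    · intro x; simp only [indic, Pi.smul_apply, smul_eq_mul]; split_ifs <;> norm_num
    · simp only [Pi.smul_apply, smul_eq_mul, ← mul_sum, sum_indic]
    · rw [adjForm_smul_smul, hDA]
      have : 9 * (degreeSum G A : ℝ) ≤ 4 * (A.card : ℝ) ^ 2 := by exact_mod_cast hd
      linarith
  · obtain ⟨I, hIA, hI4, hI0, hind, hI⟩ :=
      exists_independent_large_degree G hA (not_le.1 hd)
    have hI0' : (0 : ℝ) < I.card := by exact_mod_cast hI0
    have hI4' : (A.card : ℝ) ≤ 4 * I.card := by exact_mod_cast hI4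
    set q : ℝ := A.card / (4 * I.card) with hq
    have hq0 : 0 ≤ q := by positivity
    have hq1 : q ≤ 1 := by rw [hq, div_le_one (by positivity)]; exact hI4'
    have hqI : q * I.card = A.card / 4 := by rw [hq]; field_simp
    have hII : adjForm G (indic I) (indic I) = 0 := by
      rw [adjForm_indic]
      refine sum_eq_zero fun u hu => ?_
      rw [Nat.cast_eq_zero, degreeIn, card_eq_zero, filter_eq_empty_iff]
      exact fun y hy => hind u hu y hy
    refine ⟨indic A + (-q) • indic I, ?_, ?_, ?_, ?_⟩
    · intro x
      simp only [indic, Pi.add_apply, Pi.smul_apply, smul_eq_mul]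
      by_cases hx : x ∈ I
      · simp [hx, hIA hx, hq1]
      · simp only [hx, if_false]; split_ifs <;> norm_num
    · intro x
      simp only [indic, Pi.add_apply, Pi.smul_apply, smul_eq_mul]
      by_cases hx : x ∈ I
      · simp [hx, hIA hx, hq0]
      · simp only [hx, if_false]; split_ifs <;> norm_num
    · simp only [Pi.add_apply, Pi.smul_apply, smul_eq_mul, sum_add_distrib, ← mul_sum, sum_indic]
      linarith
    · rw [adjForm_add_smul, hII, hDA, adjForm_indic]
      set X := ∑ u ∈ I, (degreeIn G A u : ℝ)
      have : (2 * (degreeSum G A : ℝ) - A.card ^ 2 / 2) ≤ 4 * (q * X) := by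
        have : 4 * (q * X) = A.card * X / I.card := by rw [hq]; field_simp
        rw [this, le_div_iff₀ hI0']
        exact hI
      linarith

end SparseHalf

/-- If a `K₄`-free graph on an even number `n` of vertices contains an induced
triangle-free subgraph on at least `2n/3` vertices, then it contains a vertex set of size `n/2`
spanning at most `n²/18` edges; and if the induced triangle-free subgraph has strictly more than
`2n/3` vertices, then there is such a set spanning strictly fewer than `n²/18` edges. -/
theorem induced_triangle_free_sparse_half {n : ℕ} (hn : Even n) (G : SimpleGraph (Fin n))
    [DecidableRel G.Adj] (hK4 : G.CliqueFree 4) {A : Finset (Fin n)}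
    (hA3 : (G.induce (A : Set (Fin n))).CliqueFree 3)
    (hAcard : 2 * (n : ℝ) / 3 ≤ (A.card : ℝ)) :
    (∃ S : Finset (Fin n), S.card = n / 2 ∧ (edgesIn G S : ℝ) ≤ (n : ℝ) ^ 2 / 18) ∧
    (2 * (n : ℝ) / 3 < (A.card : ℝ) →
      ∃ S : Finset (Fin n), S.card = n / 2 ∧ (edgesIn G S : ℝ) < (n : ℝ) ^ 2 / 18) := by
  have hA : ∀ x ∈ A, ∀ y ∈ A, ∀ z ∈ A, G.Adj x y → G.Adj x z → ¬ G.Adj y z := by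
    intro x hx y hy z hz hxy hxz hyz
    refine hA3 {⟨x, hx⟩, ⟨y, hy⟩, ⟨z, hz⟩} ?_
    rw [SimpleGraph.is3Clique_triple_iff]
    exact ⟨hxy, hxz, hyz⟩
  obtain ⟨k, rfl⟩ := hn
  have hk2 : (k + k) / 2 = k := by omega
  have hE : ∀ S, (degreeSum G S : ℝ) = 2 * edgesIn G S := fun S => by
    exact_mod_cast degreeSum_eq_two_mul_edgesIn G S
  rw [hk2]
  push_cast at hAcard ⊢
  rcases Nat.eq_zero_or_pos k with rfl | hk
  · have hA0 : A.card = 0 := by simpa using card_le_univ A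
    have h0 := hE ∅
    simp only [degreeSum, sum_empty, Nat.cast_zero] at h0
    refine ⟨⟨∅, by simp, by push_cast; linarith⟩, fun h => ?_⟩
    simp [hA0] at h
  have hk' : (0 : ℝ) < k := by exact_mod_cast hk
  obtain ⟨w, h0, h1, hsum, hw⟩ := exists_fractional_sparse G hA
  have hA0 : (0 : ℝ) < A.card := by linarith
  set c : ℝ := 2 * (k + k) / 3 / A.card with hc
  have hc0 : 0 < c := by positivity
  have hcA : c * A.card = 2 * (k + k) / 3 := by rw [hc]; field_simp
  have hc1 : c ≤ 1 := by rw [hc, div_le_one hA0]; exact hAcard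
  have hcsum : ∑ x, (c • w) x = k := by
    simp only [Pi.smul_apply, smul_eq_mul, ← mul_sum, hsum]
    linarith
  have hcw0 : ∀ x, 0 ≤ (c • w) x := fun x => mul_nonneg hc0.le (h0 x)
  have hcw : ∀ x, (c • w) x ≤ c := fun x => mul_le_of_le_one_right hc0.le (h1 x)
  have hform : adjForm G (c • w) (c • w) ≤ 2 * (((k : ℝ) + k) ^ 2 / 18) := by
    rw [adjForm_smul_smul]
    calc c ^ 2 * adjForm G w w ≤ c ^ 2 * ((A.card : ℝ) ^ 2 / 4) := by gcongr
      _ = (c * A.card) ^ 2 / 4 := by ring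
      _ = _ := by rw [hcA]; ring
  obtain ⟨S, hS, hS'⟩ := exists_rounding G k (c • w) hcw0 (fun x => (hcw x).trans hc1) hcsum
  rw [hE] at hS'
  refine ⟨⟨S, hS, by linarith⟩, fun hlt => ?_⟩
  have hc1' : c < 1 := by rw [hc, div_lt_one hA0]; exact hlt
  rcases le_or_gt (adjForm G (c • w) (c • w)) 0 with h | h
  · have : 0 < ((k : ℝ) + k) ^ 2 / 18 := by positivity
    exact ⟨S, hS, by linarith⟩
  · obtain ⟨S, hS, hS'⟩ := exists_rounding_lt G k (c • w) hcw0
      (fun x => (hcw x).trans_lt hc1') hcsum h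
    rw [hE] at hS'
    exact ⟨S, hS, by linarith⟩
end

section
/- Let 3/5 < α ≤ 1, n ∈ ℕ and αn ∈ ℕ. Let G be a triangle-free graph on n vertices. If every vertex set S ⊆ V(G) with |S| = αn spans at least ((2α − 1)/4)·n² edges, then G is isomorphic to the balanced complete bipartite Turán graph T_2(n). -/
open Finset

section EdgeCounting

variable {V : Type*} [Fintype V] [DecidableEq V] (G : SimpleGraph V) [DecidableRel G.Adj]

theorem edgesIn_insert {S : Finset V} {v : V} (hv : v ∉ S) :
    edgesIn G (insert v S) = edgesIn G S + #(G.neighborFinset v ∩ S) := by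
  have hcard : #((G.neighborFinset v ∩ S).image fun u => s(v, u)) = #(G.neighborFinset v ∩ S) :=
    card_image_of_injective _ fun a b h => Sym2.congr_right.1 h
  rw [edgesIn, edgesIn, ← hcard, ← card_union_of_disjoint]
  · congr 1
    ext e
    induction e with | _ a b
    simp only [mem_filter, mem_union, mem_image, mem_inter, SimpleGraph.mem_neighborFinset,
      SimpleGraph.mem_edgeFinset, SimpleGraph.mem_edgeSet, Sym2.mem_iff, forall_eq_or_imp,
      forall_eq, mem_insert]
    constructor
    · rintro ⟨hab, rfl | ha, rfl | hb⟩
      · exact absurd hab G.irrefl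
      · exact Or.inr ⟨b, ⟨hab, hb⟩, rfl⟩
      · exact Or.inr ⟨a, ⟨hab.symm, ha⟩, Sym2.eq_swap⟩
      · exact Or.inl ⟨hab, ha, hb⟩
    · rintro (⟨hab, ha, hb⟩ | ⟨u, ⟨hu, huS⟩, he⟩)
      · exact ⟨hab, Or.inr ha, Or.inr hb⟩
      · rcases Sym2.eq_iff.1 he with ⟨rfl, rfl⟩ | ⟨rfl, rfl⟩
        · exact ⟨hu, Or.inl rfl, Or.inr huS⟩
        · exact ⟨hu.symm, Or.inr huS, Or.inl rfl⟩
  · rw [disjoint_left]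
    intro e he he'
    obtain ⟨u, -, rfl⟩ := mem_image.1 he'
    exact hv ((mem_filter.1 he).2 v (Sym2.mem_mk_left v u))

theorem edgesIn_univ : edgesIn G univ = #G.edgeFinset := by
  simp [edgesIn]

theorem edgesIn_empty : edgesIn G ∅ = 0 := by
  rw [edgesIn, card_eq_zero, filter_eq_empty_iff]
  intro e _ h
  induction e with | _ a b
  exact absurd (h a (Sym2.mem_mk_left a b)) (notMem_empty a)

/-- The handshaking lemma for the subgraph induced on `S`. -/
theorem sum_card_neighborFinset_inter (S : Finset V) :
    ∑ v ∈ S, #(G.neighborFinset v ∩ S) = 2 * edgesIn G S := by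
  induction S using Finset.induction_on with
  | empty => simp [edgesIn_empty]
  | insert a S ha ih =>
    have h1 : ∀ v ∈ S, #(G.neighborFinset v ∩ insert a S) =
        #(G.neighborFinset v ∩ S) + if G.Adj a v then 1 else 0 := by
      intro v _
      split_ifs with h
      · rw [inter_insert_of_mem (by simpa using h.symm), card_insert_of_notMem (by simp [ha])]
      · rw [inter_insert_of_notMem (by simpa using fun h' => h h'.symm), add_zero]
    have h2 : ∑ v ∈ S, (if G.Adj a v then 1 else 0) = #(G.neighborFinset a ∩ S) := by
      rw [← card_filter]
      congr 1
      ext v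
      simp [and_comm]
    rw [edgesIn_insert G ha, sum_insert ha, inter_insert_of_notMem (by simp), sum_congr rfl h1,
      sum_add_distrib, ih, h2]
    ring

theorem edgesIn_compl_add_sum_degree {R : Finset V}
    (hR : ∀ u ∈ R, ∀ v ∈ R, ¬ G.Adj u v) :
    edgesIn G Rᶜ + ∑ v ∈ R, G.degree v = #G.edgeFinset := by
  induction R using Finset.induction_on with
  | empty => simp [edgesIn_univ]
  | insert a R ha ih =>
    have h1 : Rᶜ = insert a (insert a R)ᶜ := by
      ext v
      by_cases h : v = a <;> simp [h, ha]
    have h2 : G.neighborFinset a ∩ (insert a R)ᶜ = G.neighborFinset a := by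
      refine inter_eq_left.2 fun v hv => mem_compl.2 fun hv' => ?_
      exact hR a (mem_insert_self a R) v hv' ((G.mem_neighborFinset a v).1 hv)
    rw [← ih fun u hu v hv => hR u (mem_insert_of_mem hu) v (mem_insert_of_mem hv), h1,
      edgesIn_insert G (by simp), h2, sum_insert ha, SimpleGraph.card_neighborFinset_eq_degree]
    ring

/-- Some `k`-subset of `T` spans at most the fraction `(k / #T)²` of the edges spanned by `T`. -/
theorem exists_subset_edgesIn_le {k : ℕ} (hk : 0 < k) {T : Finset V} (hT : k ≤ #T) :
    ∃ S ⊆ T, #S = k ∧ edgesIn G S * #T ^ 2 ≤ k ^ 2 * edgesIn G T := by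
  obtain ⟨N, hN⟩ : ∃ N, #T = N := ⟨_, rfl⟩
  rw [hN] at hT ⊢
  induction N, hT using Nat.le_induction generalizing T with
  | base => exact ⟨T, subset_rfl, hN, (mul_comm _ _).le⟩
  | succ N hkN ih =>
    have hne : T.Nonempty := card_pos.1 (by omega)
    obtain ⟨v, hv, hdeg⟩ : ∃ v ∈ T, 2 * edgesIn G T ≤ #T * #(G.neighborFinset v ∩ T) := by
      by_contra! h
      have := sum_lt_sum_of_nonempty hne h
      rw [← mul_sum, sum_card_neighborFinset_inter, sum_const, smul_eq_mul] at this
      exact lt_irrefl _ this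
    obtain ⟨S, hST, hS, hle⟩ := ih (T := T.erase v) (by rw [card_erase_of_mem hv, hN]; rfl)
    refine ⟨S, hST.trans (erase_subset v T), hS, ?_⟩
    have hins := edgesIn_insert G (notMem_erase v T)
    have hnbr : G.neighborFinset v ∩ T.erase v = G.neighborFinset v ∩ T := by
      ext u
      simp only [mem_inter, mem_erase, SimpleGraph.mem_neighborFinset]
      exact ⟨fun h => ⟨h.1, h.2.2⟩, fun h => ⟨h.1, h.1.ne', h.2⟩⟩
    rw [insert_erase hv, hnbr] at hins
    rw [hN] at hdeg
    have hstep : (N + 1) ^ 2 * edgesIn G (T.erase v) ≤ N ^ 2 * edgesIn G T := by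
      nlinarith
    have hpos : 0 < N ^ 2 := pow_pos (hk.trans_le hkN) 2
    refine Nat.le_of_mul_le_mul_right ?_ hpos
    calc edgesIn G S * (N + 1) ^ 2 * N ^ 2
        = (edgesIn G S * N ^ 2) * (N + 1) ^ 2 := by ring
      _ ≤ (k ^ 2 * edgesIn G (T.erase v)) * (N + 1) ^ 2 := Nat.mul_le_mul_right _ hle
      _ = k ^ 2 * ((N + 1) ^ 2 * edgesIn G (T.erase v)) := by ring
      _ ≤ k ^ 2 * (N ^ 2 * edgesIn G T) := Nat.mul_le_mul_left _ hstep
      _ = k ^ 2 * edgesIn G T * N ^ 2 := by ring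

end EdgeCounting

theorem sum_sum_degree_neighborFinset {V : Type*} [Fintype V] (G : SimpleGraph V)
    [DecidableRel G.Adj] :
    ∑ w, ∑ u ∈ G.neighborFinset w, G.degree u = ∑ w, G.degree w ^ 2 := by
  rw [sum_comm' (t' := univ) (s' := fun u => G.neighborFinset u)
    (by simp [SimpleGraph.adj_comm])]
  simp [sq]

/-- Some `m`-subset of `A` has at least the average of `f` over `A`. -/
theorem exists_subset_card_mul_sum_le {ι : Type*} [DecidableEq ι] (f : ι → ℕ) {m : ℕ}
    {A : Finset ι} (hA : m ≤ #A) :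
    ∃ R ⊆ A, #R = m ∧ m * ∑ i ∈ A, f i ≤ #A * ∑ i ∈ R, f i := by
  rcases Nat.eq_zero_or_pos m with rfl | hm
  · exact ⟨∅, by simp⟩
  obtain ⟨N, hN⟩ : ∃ N, #A = N := ⟨_, rfl⟩
  rw [hN] at hA ⊢
  induction N, hA using Nat.le_induction generalizing A with
  | base => exact ⟨A, subset_rfl, hN, le_rfl⟩
  | succ N hmN ih =>
    have hne : A.Nonempty := card_pos.1 (by omega)
    obtain ⟨a, ha, hmin⟩ := exists_min_image A f hne
    obtain ⟨R, hRA, hR, hle⟩ := ih (A := A.erase a) (by rw [card_erase_of_mem ha, hN]; rfl)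
    refine ⟨R, hRA.trans (erase_subset a A), hR, ?_⟩
    have hsum := add_sum_erase A f ha
    have hlow : N * f a ≤ ∑ i ∈ A.erase a, f i := by
      have := card_nsmul_le_sum (A.erase a) f (f a) fun i hi => hmin i (mem_of_mem_erase hi)
      rwa [card_erase_of_mem ha, hN, smul_eq_mul] at this
    rw [← hsum]
    refine Nat.le_of_mul_le_mul_right ?_ (show 0 < N by omega)
    calc m * (f a + ∑ i ∈ A.erase a, f i) * N
        = m * (N * f a) + m * (∑ i ∈ A.erase a, f i) * N := by ring
      _ ≤ m * (∑ i ∈ A.erase a, f i) + m * (∑ i ∈ A.erase a, f i) * N := by gcongr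
      _ = (N + 1) * (m * ∑ i ∈ A.erase a, f i) := by ring
      _ ≤ (N + 1) * (N * ∑ i ∈ R, f i) := Nat.mul_le_mul_left _ hle
      _ = (N + 1) * (∑ i ∈ R, f i) * N := by ring

theorem SimpleGraph.CliqueFree.not_adj_of_mem_neighborFinset {V : Type*} [Fintype V]
    [DecidableEq V] {G : SimpleGraph V} [DecidableRel G.Adj] (h3 : G.CliqueFree 3) {w u v : V}
    (hu : u ∈ G.neighborFinset w) (hv : v ∈ G.neighborFinset w) : ¬ G.Adj u v := fun huv =>
  h3 {w, u, v} (SimpleGraph.is3Clique_triple_iff.2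
    ⟨(G.mem_neighborFinset w u).1 hu, (G.mem_neighborFinset w v).1 hv, huv⟩)

/-- A triangle-free graph with at least `n² / 4` edges is a balanced complete bipartite graph. -/
theorem SimpleGraph.CliqueFree.nonempty_iso_turanGraph_two {n : ℕ} {G : SimpleGraph (Fin n)}
    [DecidableRel G.Adj] (h3 : G.CliqueFree 3) (hE : n ^ 2 ≤ 4 * #G.edgeFinset) :
    Nonempty (G ≃g SimpleGraph.turanGraph n 2) := by
  have hmax : G.IsTuranMaximal 2 := by
    refine ⟨h3, fun H _ hH => ?_⟩
    have hle := hH.card_edgeFinset_le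
    simp only [Fintype.card_fin, Nat.choose_eq_zero_of_lt (Nat.mod_lt n two_pos)] at hle
    omega
  have hiso := hmax.nonempty_iso_turanGraph
  rwa [Fintype.card_fin] at hiso

section LocalDensity

variable {V : Type*} [Fintype V] [DecidableEq V] {G : SimpleGraph V} [DecidableRel G.Adj]

/-- Deleting `m` vertices of a neighbourhood of size at least `m`. -/
theorem sum_degree_neighborFinset_lt_of_le_degree (h3 : G.CliqueFree 3) {k m : ℕ} {n γ : ℝ}
    (hV : Fintype.card V = k + m) (hn : (k : ℝ) + m = n) (hm : 0 < m) (hmn : 2 * (m : ℝ) < n)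
    (hγ : γ = (2 * k - n) * n / 4)
    (hmin : ∀ S : Finset V, #S = k → γ ≤ edgesIn G S)
    (hE : (#G.edgeFinset : ℝ) < n ^ 2 / 4) {w : V} (hw : m ≤ G.degree w) :
    ((∑ u ∈ G.neighborFinset w, G.degree u : ℕ) : ℝ) <
      (G.degree w : ℝ) ^ 2 - G.degree w * n / 2 + #G.edgeFinset := by
  obtain ⟨R, hRN, hR, hle⟩ := exists_subset_card_mul_sum_le (fun u => G.degree u)
    (A := G.neighborFinset w) (m := m) (by simpa using hw)
  have hcompl := edgesIn_compl_add_sum_degree G (R := R) fun u hu v hv =>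
    h3.not_adj_of_mem_neighborFinset (hRN hu) (hRN hv)
  have hS := hmin Rᶜ (by rw [card_compl, hR, hV]; omega)
  rw [SimpleGraph.card_neighborFinset_eq_degree] at hle
  generalize ∑ u ∈ G.neighborFinset w, G.degree u = s at *
  generalize ∑ u ∈ R, G.degree u = r at *
  generalize G.degree w = d at *
  generalize #G.edgeFinset = E at *
  have hle' : (m : ℝ) * s ≤ d * r := by exact_mod_cast hle
  have hcompl' : (edgesIn G Rᶜ : ℝ) + r = E := by exact_mod_cast hcompl
  have hw' : (m : ℝ) ≤ d := by exact_mod_cast hw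
  have hm' : (0 : ℝ) < m := by exact_mod_cast hm
  have hk : (k : ℝ) = n - m := by linarith
  rw [hγ, hk] at hS
  have h1 : (m : ℝ) * s ≤ d * (E - (2 * (n - m) - n) * n / 4) :=
    hle'.trans (mul_le_mul_of_nonneg_left (by linarith) (by linarith))
  have h2 : 0 < m * ((d : ℝ) - n / 2) ^ 2 + (n ^ 2 / 4 - E) * (d - m) := by
    rcases hw'.eq_or_lt with h | h
    · have : (d : ℝ) - n / 2 ≠ 0 := by linarith
      rw [← h] at this ⊢
      simp only [sub_self, mul_zero, add_zero]
      positivity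
    · have := mul_pos (sub_pos.2 hE) (sub_pos.2 h)
      positivity
  refine lt_of_mul_lt_mul_left ?_ hm'.le
  nlinarith

/-- Choosing `k` vertices outside a neighbourhood of size less than `m`. -/
theorem sum_degree_neighborFinset_lt_of_degree_lt (h3 : G.CliqueFree 3) {k m : ℕ} {n γ : ℝ}
    (hV : Fintype.card V = k + m) (hn : (k : ℝ) + m = n) (hk : 3 / 5 * n < k)
    (hγ : γ = (2 * k - n) * n / 4)
    (hmin : ∀ S : Finset V, #S = k → γ ≤ edgesIn G S)
    {w : V} (hw : G.degree w < m) :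
    ((∑ u ∈ G.neighborFinset w, G.degree u : ℕ) : ℝ) <
      (G.degree w : ℝ) ^ 2 - G.degree w * n / 2 + #G.edgeFinset := by
  have hcompl := edgesIn_compl_add_sum_degree G (R := G.neighborFinset w) fun u hu v hv =>
    h3.not_adj_of_mem_neighborFinset hu hv
  have hm0 : (0 : ℝ) < m := by exact_mod_cast Nat.zero_lt_of_lt hw
  have hk0 : (0 : ℝ) < k := by
    have : (0 : ℝ) ≤ k := k.cast_nonneg
    linarith
  have hT : #(G.neighborFinset w)ᶜ = k + m - G.degree w := by
    rw [card_compl, hV, SimpleGraph.card_neighborFinset_eq_degree]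
  obtain ⟨S, -, hS, hle⟩ := exists_subset_edgesIn_le G (k := k) (by exact_mod_cast hk0)
    (T := (G.neighborFinset w)ᶜ) (by omega)
  have hSγ := hmin S hS
  have hT' : (#(G.neighborFinset w)ᶜ : ℝ) = n - G.degree w := by
    rw [hT, Nat.cast_sub (by omega), ← hn]
    push_cast
    ring
  have hle' : (edgesIn G S : ℝ) * (n - G.degree w) ^ 2 ≤
      k ^ 2 * edgesIn G (G.neighborFinset w)ᶜ := by
    rw [← hT']
    exact_mod_cast hle
  have hcompl' : (edgesIn G (G.neighborFinset w)ᶜ : ℝ) +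
      ((∑ u ∈ G.neighborFinset w, G.degree u : ℕ) : ℝ) = #G.edgeFinset := by
    exact_mod_cast hcompl
  generalize ∑ u ∈ G.neighborFinset w, G.degree u = s at *
  generalize G.degree w = d at *
  generalize #G.edgeFinset = E at *
  have h1 : γ * (n - d) ^ 2 ≤ k ^ 2 * (E - s) := by
    have := mul_le_mul_of_nonneg_right hSγ (sq_nonneg (n - (d : ℝ)))
    rw [← hcompl']
    linarith
  have h2 : 0 < γ * (n - d) ^ 2 + k ^ 2 * ((d : ℝ) ^ 2 - d * n / 2) := by
    have hkn : (k : ℝ) < n := by linarith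
    have hγ0 : 0 < γ := by
      rw [hγ]
      have : 0 < (2 * (k : ℝ) - n) * n := mul_pos (by linarith) (by linarith)
      linarith
    have hdisc : 0 < γ / 2 - (k : ℝ) ^ 2 / 16 := by
      rw [hγ]
      nlinarith [mul_pos (sub_pos.2 hk) (sub_pos.2 hkn), mul_pos (sub_pos.2 hk) (hk0.trans hkn),
        mul_pos (hk0.trans hkn) (hk0.trans hkn)]
    have hpos : 0 < (k : ℝ) ^ 2 + γ := by positivity
    have hn0 : 0 < n := hk0.trans hkn
    refine pos_of_mul_pos_right ?_ hpos.le
    calc (0 : ℝ) < (((k : ℝ) ^ 2 + γ) * d - (k ^ 2 * n / 4 + γ * n)) ^ 2 +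
          n ^ 2 * k ^ 2 * (γ / 2 - (k : ℝ) ^ 2 / 16) := by positivity
      _ = (k ^ 2 + γ) * (γ * (n - d) ^ 2 + k ^ 2 * ((d : ℝ) ^ 2 - d * n / 2)) := by ring
  refine lt_of_mul_lt_mul_left (a := (k : ℝ) ^ 2) ?_ (by positivity)
  linarith

end LocalDensity

/-- For `3/5 < α ≤ 1` with `αn ∈ ℕ`, a triangle-free graph on `n` vertices in
which every vertex set of size `αn` spans at least `((2α−1)/4)n²` edges is isomorphic to
`T₂(n)`. -/
theorem krivelevich_extremal {α : ℝ} (hα1 : 3 / 5 < α) (hα2 : α ≤ 1) {n k : ℕ}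
    (hk : (k : ℝ) = α * (n : ℝ)) (G : SimpleGraph (Fin n)) [DecidableRel G.Adj]
    (h3 : G.CliqueFree 3)
    (hmin : ∀ S : Finset (Fin n), S.card = k →
      (2 * α - 1) / 4 * (n : ℝ) ^ 2 ≤ (edgesIn G S : ℝ)) :
    Nonempty (G ≃g SimpleGraph.turanGraph n 2) := by
  refine h3.nonempty_iso_turanGraph_two ?_
  by_contra! hlt
  have hE : (#G.edgeFinset : ℝ) < (n : ℝ) ^ 2 / 4 := by
    have : (4 : ℝ) * #G.edgeFinset < (n : ℝ) ^ 2 := by exact_mod_cast hlt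
    linarith
  have hn : 0 < n := by
    rcases Nat.eq_zero_or_pos n with rfl | h
    · simp at hlt
    · exact h
  have hn' : (0 : ℝ) < n := by exact_mod_cast hn
  have hkn : k ≤ n := by
    have : (k : ℝ) ≤ n := by rw [hk]; nlinarith
    exact_mod_cast this
  have hk' : 3 / 5 * (n : ℝ) < k := by rw [hk]; gcongr
  obtain ⟨m, rfl⟩ := Nat.exists_eq_add_of_le hkn
  have hcast : (k : ℝ) + m = ((k + m : ℕ) : ℝ) := by push_cast; rfl
  have hγ : (2 * α - 1) / 4 * ((k + m : ℕ) : ℝ) ^ 2 =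
      (2 * k - ((k + m : ℕ) : ℝ)) * ((k + m : ℕ) : ℝ) / 4 := by rw [hk]; ring
  rcases Nat.eq_zero_or_pos m with rfl | hm
  · have h := hmin univ (by simp)
    rw [edgesIn_univ, hγ, ← hcast] at h
    rw [← hcast] at hE
    push_cast at h hE
    nlinarith
  have hvertex : ∀ w ∈ (univ : Finset (Fin (k + m))),
      ((∑ u ∈ G.neighborFinset w, G.degree u : ℕ) : ℝ) <
        (G.degree w : ℝ) ^ 2 - G.degree w * ((k + m : ℕ) : ℝ) / 2 + #G.edgeFinset := by
    intro w _
    rcases le_or_gt m (G.degree w) with hw | hw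
    · exact sum_degree_neighborFinset_lt_of_le_degree h3 (Fintype.card_fin _) hcast hm
        (by linarith) hγ hmin hE hw
    · exact sum_degree_neighborFinset_lt_of_degree_lt h3 (Fintype.card_fin _) hcast hk' hγ hmin hw
  have hsum := sum_lt_sum_of_nonempty ⟨⟨0, hn⟩, mem_univ _⟩ hvertex
  have hdeg : ∑ w, (G.degree w : ℝ) = 2 * #G.edgeFinset := by
    exact_mod_cast G.sum_degrees_eq_twice_card_edges
  have hsq : ∑ w, ((∑ u ∈ G.neighborFinset w, G.degree u : ℕ) : ℝ) =
      ∑ w, (G.degree w : ℝ) ^ 2 := by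
    exact_mod_cast sum_sum_degree_neighborFinset G
  rw [hsq, sum_add_distrib, sum_sub_distrib, ← sum_div, ← sum_mul, hdeg, sum_const, card_univ,
    Fintype.card_fin, nsmul_eq_mul] at hsum
  linarith
end

section
/- Let G be a K_4-free graph on n vertices with exactly cn² edges and with n/2 ≤ δ(G) ≤ Δ(G) ≤ 9n/14. Suppose every vertex set of size ⌊n/2⌋ in G spans at least n²/18 edges. Then the number of triangles in G satisfies t(G) ≥ c·n³/(27(1 − 2c)). -/
open Finset

/-- Some `j`-element subset of `I` has average weight at most that of `I`. -/
lemma exists_subset_card_eq_mul_sum_le {V : Type*} [DecidableEq V] (f : V → ℝ) (I : Finset V)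
    (j : ℕ) (hj : j ≤ I.card) :
    ∃ J ⊆ I, J.card = j ∧ (I.card : ℝ) * ∑ x ∈ J, f x ≤ (j : ℝ) * ∑ x ∈ I, f x := by
  induction I using Finset.strongInduction with
  | H I ih =>
    rcases hj.eq_or_lt with h | h
    · exact ⟨I, Subset.rfl, h.symm, by rw [h]⟩
    · have hne : I.Nonempty := card_pos.mp (by omega)
      obtain ⟨m, hm, hmax⟩ := I.exists_max_image f hne
      have hc := card_erase_of_mem hm
      obtain ⟨J, hJ, hJc, hle⟩ := ih (I.erase m) (erase_ssubset hm) (by omega)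
      refine ⟨J, hJ.trans (erase_subset _ _), hJc, ?_⟩
      have hJm : ∑ x ∈ J, f x ≤ j * f m := by
        rw [← hJc, ← nsmul_eq_mul]
        exact sum_le_card_nsmul _ _ _ fun x hx => hmax x (erase_subset _ _ (hJ hx))
      have hsum := add_sum_erase I f hm
      have hc' : ((I.erase m).card : ℝ) + 1 = I.card := by
        rw [hc]; exact_mod_cast Nat.succ_pred_eq_of_pos (card_pos.mpr hne)
      rw [← hsum, ← hc']
      linarith

/-- The polynomial inequality behind the global averaging step. -/
lemma coefficient_bound {r g : ℝ} (hr2 : 2 ≤ r) (hg2 : 2 ≤ g) (hg3 : g ≤ 14 / 5) :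
    81 / 10 * (r / 2 - 1) ≤ r ^ 3 * g / 9 + 3 / 8 * r ^ 2 - 1 / 10 * r ^ 2 * g ^ 2 := by
  have hg4 : g ^ 2 ≤ 24 / 5 * g - 28 / 5 := by nlinarith
  have p1 : 0 ≤ r ^ 3 * (14 / 5) / 9 + 3 / 8 * r ^ 2 - 1 / 10 * r ^ 2 * (196 / 25)
      - 81 / 10 * (r / 2 - 1) := by
    linarith [mul_nonneg (by linarith : (0 : ℝ) ≤ r) (sq_nonneg (r - 257 / 100)),
      sq_nonneg (r - 257 / 100)]
  have p2 : 0 ≤ r ^ 3 * 2 / 9 + 3 / 8 * r ^ 2 - 1 / 10 * r ^ 2 * 4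
      - 81 / 10 * (r / 2 - 1) := by
    linarith [mul_nonneg (by linarith : (0 : ℝ) ≤ r) (sq_nonneg (r - 5 / 2)),
      sq_nonneg (r - 5 / 2)]
  linarith [mul_nonneg (sub_nonneg.mpr hg2) p1, mul_nonneg (sub_nonneg.mpr hg3) p2,
    mul_le_mul_of_nonneg_left hg4 (sq_nonneg r)]

section Weighted

variable {V : Type*} [Fintype V]

/-- Global averaging: the local lower bounds for `S v` add up to a bound depending only on the
average `k` of `d`. -/
lemma average_lower_bound (A : V → V → ℝ) (hsymm : ∀ x y, A x y = A y x)
    (h01 : ∀ x y, A x y * A x y = A x y) (w k : ℝ) (hw : 0 < w)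
    (hcard : w * Fintype.card V = 1) (d S : V → ℝ) (hd : ∀ v, d v = w * ∑ x, A v x)
    (hk : k = w * ∑ v, d v) (hlo : ∀ v, 1 / 2 ≤ d v) (hhi : ∀ v, d v ≤ 9 / 14)
    (hS : ∀ v, (1 - d v)⁻¹ * (d v / 9 + w * ∑ x, A v x * (d x - k))
      - 81 / 10 * (d v - 1 / 2) * (w * ∑ x, A v x * (d x - k) ^ 2) ≤ S v) :
    k / (9 * (1 - k)) ≤ w * ∑ v, S v := by
  have hone : w * ∑ _v : V, (1 : ℝ) = 1 := by simpa using hcard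
  have hmean : ∀ b : ℝ, w * ∑ _v : V, b = b := fun b => by
    have : ∑ _v : V, b = b * ∑ _v : V, (1 : ℝ) := by rw [mul_sum]; simp
    rw [this]; linear_combination b * hone
  have hk1 : 1 / 2 ≤ k := by
    rw [hk, ← hmean (1 / 2)]; gcongr; exact hlo _
  have hk2 : k ≤ 9 / 14 := by
    rw [hk, ← hmean (9 / 14)]; gcongr; exact hhi _
  set q : V → ℝ := fun v => w * ∑ x, A v x * (d x - k) with hq
  set Q : V → ℝ := fun v => w * ∑ x, A v x * (d x - k) ^ 2 with hQ
  set W : ℝ := w * ∑ v, (d v - k) ^ 2 with hW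
  have heps : w * ∑ v, (d v - k) = 0 := by
    rw [sum_sub_distrib, mul_sub, hmean, ← hk, sub_self]
  have hA1 : ∀ x y, A x y ≤ 1 := fun x y => by nlinarith [h01 x y, sq_nonneg (1 - A x y)]
  have hqsum : w * ∑ v, q v = W := by
    have h1 : ∑ v, q v = ∑ x, d x * (d x - k) := by
      simp only [hq, mul_sum]
      rw [sum_comm]
      refine sum_congr rfl fun x _ => ?_
      rw [hd x, mul_sum, sum_mul]
      exact sum_congr rfl fun v _ => by rw [hsymm v x]; ring
    have h2 : ∑ x, d x * (d x - k) = ∑ x, (d x - k) ^ 2 + k * ∑ x, (d x - k) := by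
      rw [mul_sum, ← sum_add_distrib]; exact sum_congr rfl fun x _ => by ring
    rw [h1, h2, hW]; linear_combination k * heps
  have hqsq : ∀ v, q v ^ 2 ≤ W / 4 := fun v => by
    have h1 : q v = w * ∑ x, (A v x - 1 / 2) * (d x - k) := by
      have : ∑ x, (A v x - 1 / 2) * (d x - k)
          = ∑ x, A v x * (d x - k) - 1 / 2 * ∑ x, (d x - k) := by
        rw [mul_sum, ← sum_sub_distrib]; exact sum_congr rfl fun x _ => by ring
      rw [this]; simp only [hq]; linear_combination 1 / 2 * heps
    have h2 := sum_mul_sq_le_sq_mul_sq univ (fun x => A v x - 1 / 2) (fun x => d x - k)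
    have h3 : w * ∑ x, (A v x - 1 / 2) ^ 2 = 1 / 4 := by
      rw [← hmean (1 / 4)]
      congr 1
      exact sum_congr rfl fun x _ => by linear_combination h01 v x
    calc q v ^ 2 = w ^ 2 * (∑ x, (A v x - 1 / 2) * (d x - k)) ^ 2 := by rw [h1]; ring
      _ ≤ w ^ 2 * ((∑ x, (A v x - 1 / 2) ^ 2) * ∑ x, (d x - k) ^ 2) := by gcongr
      _ = (w * ∑ x, (A v x - 1 / 2) ^ 2) * W := by rw [hW]; ring
      _ = W / 4 := by rw [h3]; ring
  have hQsum : w * ∑ v, (d v - 1 / 2) * Q v ≤ (k - 1 / 2) * W := by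
    have h1 : ∑ v, (d v - 1 / 2) * Q v
        ≤ ∑ v, (d v - 1 / 2) * W := by
      gcongr with v
      · linarith [hlo v]
      · simp only [hQ, hW]
        gcongr with x
        exact mul_le_of_le_one_left (sq_nonneg _) (hA1 v x)
    have h2 : w * ∑ v, (d v - 1 / 2) * W = (k - 1 / 2) * W := by
      rw [← sum_mul, sum_sub_distrib, ← mul_assoc, mul_sub, hmean, ← hk]
    rw [← h2]; gcongr
  obtain ⟨r, hr⟩ : ∃ r, r = (1 - k)⁻¹ := ⟨_, rfl⟩
  have hrk : r * (1 - k) = 1 := by rw [hr]; exact inv_mul_cancel₀ (by linarith)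
  have hr2 : 2 ≤ r := by nlinarith
  have hpoint : ∀ v, k * r / 9 + r ^ 2 / 9 * (d v - k) + r * q v
      - 5 / 2 * r * (W / 4) - 81 / 10 * ((d v - 1 / 2) * Q v)
      + (d v - k) ^ 2 * (81 / 10 * (k - 1 / 2) - 3 / 8 * r) ≤ S v := fun v => by
    refine le_trans ?_ (hS v)
    change _ ≤ (1 - d v)⁻¹ * (d v / 9 + q v) - 81 / 10 * (d v - 1 / 2) * Q v
    obtain ⟨g, hg⟩ : ∃ g, g = (1 - d v)⁻¹ := ⟨_, rfl⟩
    have hgd : g * (1 - d v) = 1 := by rw [hg]; exact inv_mul_cancel₀ (by linarith [hhi v])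
    have hg2 : 2 ≤ g := by nlinarith [hlo v, hhi v]
    have hg3 : g ≤ 14 / 5 := by nlinarith [hlo v, hhi v]
    rw [← hg]
    set e := d v - k with he
    have hgr : g = r + r * e * g := by
      rw [he]; linear_combination r * hgd - g * hrk
    have hgd' : g * d v = k * r + r ^ 2 * e + r ^ 2 * e ^ 2 * g := by
      have hr1 : k * r = r - 1 := by linarith
      have : g * d v = g - 1 := by linarith
      rw [this, hr1]
      linear_combination (1 + r * e) * hgr
    have hcross : -(1 / 10 * (e * g) ^ 2) - 5 / 2 * (W / 4) ≤ e * g * q v := by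
      nlinarith [sq_nonneg (e * g + 5 * q v), hqsq v]
    have hcoef : 81 / 10 * (k - 1 / 2) ≤ r ^ 2 * g / 9 + 3 / 8 * r - 1 / 10 * r * g ^ 2 := by
      have hkr : k - 1 / 2 = 1 / 2 - r⁻¹ := by
        rw [hr, inv_inv]; ring
      have hrpos : 0 < r := by linarith
      rw [hkr]
      refine le_of_mul_le_mul_left ?_ hrpos
      have : r * (81 / 10 * (1 / 2 - r⁻¹)) = 81 / 10 * (r / 2 - 1) := by field_simp
      rw [this]
      linarith [coefficient_bound hr2 hg2 hg3]
    have hgq : g * q v = r * q v + r * (e * g * q v) := by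
      linear_combination q v * hgr
    have hc1 := mul_le_mul_of_nonneg_left hcross (by linarith : 0 ≤ r)
    have hc2 := mul_le_mul_of_nonneg_left hcoef (sq_nonneg e)
    linarith
  have hlin : ∀ (e p h f : V → ℝ) (c₀ c₁ c₂ c₃ c₄ c₅ : ℝ),
      w * ∑ v, (c₀ + c₁ * e v + c₂ * p v - c₃ - c₄ * h v + f v * c₅)
        = c₀ + c₁ * (w * ∑ v, e v) + c₂ * (w * ∑ v, p v) - c₃ - c₄ * (w * ∑ v, h v)
          + (w * ∑ v, f v) * c₅ := fun e p h f c₀ c₁ c₂ c₃ c₄ c₅ => by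
    simp only [sum_add_distrib, sum_sub_distrib, ← mul_sum, ← sum_mul]
    linear_combination hmean c₀ - hmean c₃
  have htotal := mul_le_mul_of_nonneg_left (sum_le_sum fun v (_ : v ∈ univ) => hpoint v) hw.le
  rw [hlin (fun v => d v - k), heps, hqsum, ← hW] at htotal
  have e3 : k / (9 * (1 - k)) = k * r / 9 := by
    rw [hr]; field_simp
  rw [e3]
  linarith

/-- The local lower bound at a vertex with neighbourhood indicator `t`, where `α` are normalized
codegrees and `δ` normalized degrees. -/
lemma vertex_lower_bound (t α δ : V → ℝ) (w k d S : ℝ) (hw : 0 < w) (ht : ∀ x, 0 ≤ t x)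
    (hd : d = w * ∑ x, t x) (hS : S = w * ∑ x, t x * α x) (hS9 : 1 / 9 ≤ S) (hlo : 1 / 2 ≤ d)
    (hhi : d ≤ 9 / 14)
    (h : S / 18 ≤ S * (k / 2 - w * ∑ x, t x * δ x + S / 2)
      + (d - 1 / 2) * (w * ∑ x, t x * (α x * (δ x - α x)))) :
    (1 - d)⁻¹ * (d / 9 + w * ∑ x, t x * (δ x - k))
      - 81 / 10 * (d - 1 / 2) * (w * ∑ x, t x * (δ x - k) ^ 2) ≤ S := by
  obtain ⟨s, hs⟩ : ∃ s, s = S / d := ⟨_, rfl⟩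
  have hsd : s * d = S := by rw [hs]; field_simp
  have hs0 : 0 < s := by rw [hs]; apply div_pos <;> linarith
  obtain ⟨q, hq⟩ : ∃ q, q = w * ∑ x, t x * (δ x - k) := ⟨_, rfl⟩
  obtain ⟨Q, hQ⟩ : ∃ Q, Q = w * ∑ x, t x * (δ x - k) ^ 2 := ⟨_, rfl⟩
  have hQ0 : 0 ≤ Q := by
    rw [hQ]
    exact mul_nonneg hw.le (sum_nonneg fun x _ => mul_nonneg (ht x) (sq_nonneg _))
  have hp : w * ∑ x, t x * δ x = k * d + q := by
    have : ∑ x, t x * (δ x - k) = ∑ x, t x * δ x - k * ∑ x, t x := by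
      rw [mul_sum, ← sum_sub_distrib]; exact sum_congr rfl fun x _ => by ring
    rw [hq, hd, this]; ring
  have hM : w * ∑ x, t x * (α x * (δ x - α x)) ≤ k * S + s * q - s * S + Q / 4 := by
    have h1 : ∑ x, t x * (α x * (δ x - α x)) ≤
        ∑ x, (k * (t x * α x) + s * (t x * (δ x - k)) - 2 * s * (t x * α x) + s ^ 2 * t x
          + 1 / 4 * (t x * (δ x - k) ^ 2)) := by
      refine sum_le_sum fun x _ => ?_
      linarith [mul_nonneg (ht x) (sq_nonneg (α x - s - (δ x - k) / 2))]
    simp only [sum_add_distrib, sum_sub_distrib, ← mul_sum] at h1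
    have h2 := mul_le_mul_of_nonneg_left h1 hw.le
    have h3 : s ^ 2 * d = s * S := by rw [← hsd]; ring
    rw [hd] at h3
    rw [hQ, hq]
    have h4 : s * S = s * (w * ∑ x, t x * α x) := by rw [hS]
    have h5 : k * S = k * (w * ∑ x, t x * α x) := by rw [hS]
    linarith
  rw [hp] at h
  rw [← hq, ← hQ]
  have h1 := h.trans (add_le_add_right (mul_le_mul_of_nonneg_left hM (sub_nonneg.mpr hlo)) _)
  have h2 : s * (d / 9 + q) ≤ s * (S * (1 - d)) + (d - 1 / 2) * Q / 2 := by
    rw [← hsd] at h1 ⊢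
    linarith
  have h3 : (d - 1 / 2) * Q / 2 ≤ s * (9 / 2 * d * ((d - 1 / 2) * Q)) := by
    have : 0 ≤ (d - 1 / 2) * Q := mul_nonneg (sub_nonneg.mpr hlo) hQ0
    have h9 : 1 / 2 ≤ s * (9 / 2 * d) := by linarith
    nlinarith
  have h4 : d / 9 + q ≤ S * (1 - d) + 9 / 2 * d * ((d - 1 / 2) * Q) := by
    refine le_of_mul_le_mul_left ?_ hs0
    linarith
  have h5 : 9 / 2 * d ≤ (1 - d) * (81 / 10) := by linarith
  have h6 : (1 - d)⁻¹ * (d / 9 + q) ≤ S + 81 / 10 * (d - 1 / 2) * Q := by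
    rw [inv_mul_le_iff₀ (by linarith)]
    have : 0 ≤ (d - 1 / 2) * Q := mul_nonneg (sub_nonneg.mpr hlo) hQ0
    linarith [mul_le_mul_of_nonneg_right h5 this]
  linarith

end Weighted

section Indicator

variable {V : Type*} (G : SimpleGraph V) [DecidableRel G.Adj]

/-- The real-valued adjacency indicator. -/
def adjInd (x y : V) : ℝ := if G.Adj x y then 1 else 0

lemma adjInd_comm (x y : V) : adjInd G x y = adjInd G y x := by
  simp only [adjInd, G.adj_comm]

lemma adjInd_mul_self (x y : V) : adjInd G x y * adjInd G x y = adjInd G x y := by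
  simp [adjInd]

lemma adjInd_nonneg (x y : V) : 0 ≤ adjInd G x y := by
  unfold adjInd; split_ifs <;> norm_num

lemma sum_adjInd_mul [Fintype V] (x : V) (f : V → ℝ) :
    ∑ y, adjInd G x y * f y = ∑ y ∈ G.neighborFinset x, f y := by
  simp [adjInd, SimpleGraph.neighborFinset_eq_filter, sum_filter]

lemma sum_adjInd [Fintype V] (x : V) : ∑ y, adjInd G x y = G.degree x := by
  simpa using sum_adjInd_mul G x 1

/-- The number of common neighbours of `v` and `x`. -/
def codeg [Fintype V] (v x : V) : ℝ := ∑ y, adjInd G v y * adjInd G x y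

lemma sum_codeg [Fintype V] (v : V) : ∑ x, codeg G v x = ∑ x, adjInd G v x * G.degree x := by
  simp only [codeg]
  rw [sum_comm]
  refine sum_congr rfl fun y _ => ?_
  rw [← mul_sum, ← sum_adjInd]
  simp only [adjInd_comm G y]

end Indicator

section Graph

variable {V : Type*} [Fintype V] [DecidableEq V] (G : SimpleGraph V) [DecidableRel G.Adj]

lemma two_mul_edgesIn_le (S : Finset V) :
    2 * (edgesIn G S : ℝ) ≤ ∑ x ∈ S, ∑ y ∈ S, adjInd G x y := by
  have h1 : ∑ x ∈ S, ∑ y ∈ S, adjInd G x y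
      = (((S ×ˢ S).filter fun p => G.Adj p.1 p.2).card : ℝ) := by
    rw [card_filter, sum_product]; push_cast; rfl
  rw [h1]
  have h2 : edgesIn G S * 2 ≤ ((S ×ˢ S).filter fun p => G.Adj p.1 p.2).card := by
    unfold edgesIn
    set F := G.edgeFinset.filter fun e => ∀ v ∈ e, v ∈ S with hF
    rw [card_eq_sum_card_fiberwise (f := fun p : V × V => s(p.1, p.2)) (t := F)]
    · rw [← smul_eq_mul]
      refine card_nsmul_le_sum _ _ _ fun e => ?_
      induction e with | _ x y => ?_
      intro he
      simp only [hF, mem_filter, SimpleGraph.mem_edgeFinset, SimpleGraph.mem_edgeSet,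
        Sym2.mem_iff, forall_eq_or_imp, forall_eq] at he
      obtain ⟨hxy, hx, hy⟩ := he
      rw [← card_pair (a := (x, y)) (b := (y, x)) (by simp [hxy.ne])]
      refine card_le_card ?_
      intro p hp
      rw [mem_insert, mem_singleton] at hp
      rcases hp with rfl | rfl
      · simp [hx, hy, hxy]
      · simp [hx, hy, hxy.symm]
    · intro p hp
      simp only [coe_filter, mem_product, Set.mem_ofPred_eq] at hp
      simp [hF, hp.1.1, hp.1.2, hp.2]
  rw [mul_comm]
  exact_mod_cast h2

lemma sum_codegree_le_six_mul_triangles :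
    ∑ v, ∑ x, adjInd G v x * codeg G v x
      ≤ 6 * ((G.cliqueFinset 3).card : ℝ) := by
  set P := (univ : Finset (V × V × V)).filter
    fun p => G.Adj p.1 p.2.1 ∧ G.Adj p.1 p.2.2 ∧ G.Adj p.2.1 p.2.2 with hP
  have h1 : ∑ v, ∑ x, adjInd G v x * codeg G v x = (P.card : ℝ) := by
    rw [hP, card_filter]
    push_cast
    simp only [Fintype.sum_prod_type, codeg, mul_sum]
    refine sum_congr rfl fun v _ => sum_congr rfl fun x _ => sum_congr rfl fun y _ => ?_
    simp only [adjInd, ite_and]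
    split_ifs <;> norm_num
  rw [h1]
  have h2 : P.card ≤ 6 * (G.cliqueFinset 3).card := by
    refine card_le_mul_card_image_of_maps_to (f := fun p => {p.1, p.2.1, p.2.2}) ?_ 6 ?_
    · intro p hp
      simp only [hP, mem_filter] at hp
      rw [SimpleGraph.mem_cliqueFinset_iff]
      exact SimpleGraph.is3Clique_triple_iff.mpr hp.2
    · intro s hs
      rw [SimpleGraph.mem_cliqueFinset_iff, SimpleGraph.is3Clique_iff] at hs
      obtain ⟨a, b, c, hab, hac, hbc, rfl⟩ := hs
      refine le_trans (card_le_card (t := {(a, b, c), (a, c, b), (b, a, c), (b, c, a), (c, a, b),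
        (c, b, a)}) ?_) card_le_six
      rintro ⟨x, y, z⟩ hp
      simp only [hP, mem_filter, mem_univ, true_and] at hp
      obtain ⟨⟨hxy, hxz, hyz⟩, heq⟩ := hp
      have hx : x ∈ ({a, b, c} : Finset V) := by rw [← heq]; simp
      have hy : y ∈ ({a, b, c} : Finset V) := by rw [← heq]; simp
      have hz : z ∈ ({a, b, c} : Finset V) := by rw [← heq]; simp
      have := hxy.ne
      have := hxz.ne
      have := hyz.ne
      simp only [mem_insert, mem_singleton, Prod.mk.injEq] at hx hy hz ⊢
      rcases hx with rfl | rfl | rfl <;> rcases hy with rfl | rfl | rfl <;>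
        rcases hz with rfl | rfl | rfl <;> simp_all
  exact_mod_cast h2

lemma codeg_eq_card (v x : V) :
    codeg G v x = ((G.neighborFinset v ∩ G.neighborFinset x).card : ℝ) := by
  rw [codeg, sum_adjInd_mul]
  simp [adjInd, ← SimpleGraph.mem_neighborFinset]

lemma sum_compl_neighborFinset_adjInd (v x : V) :
    ∑ y ∈ (G.neighborFinset v)ᶜ, adjInd G x y = G.degree x - codeg G v x := by
  rw [codeg, sum_adjInd_mul, ← sum_adjInd, ← sum_add_sum_compl (G.neighborFinset v)]
  ring

lemma sum_compl_neighborFinset (v : V) :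
    ∑ x ∈ (G.neighborFinset v)ᶜ, (G.degree x - codeg G v x)
      = 2 * (G.edgeFinset.card : ℝ) - 2 * ∑ x, adjInd G v x * G.degree x
        + ∑ x, adjInd G v x * codeg G v x := by
  have h1 := sum_add_sum_compl (G.neighborFinset v) fun x => (G.degree x : ℝ) - codeg G v x
  have h2 : ∑ x, (G.degree x : ℝ) = 2 * G.edgeFinset.card := by
    exact_mod_cast G.sum_degrees_eq_twice_card_edges
  rw [← sum_adjInd_mul, sum_sub_distrib (s := univ), h2, sum_codeg] at h1
  simp only [mul_sub, sum_sub_distrib] at h1 ⊢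
  linarith

lemma adjInd_eq_zero_of_cliqueFree (hK4 : G.CliqueFree 4) {u v x y : V} (huv : G.Adj v u)
    (hx : x ∈ G.neighborFinset v ∩ G.neighborFinset u)
    (hy : y ∈ G.neighborFinset v ∩ G.neighborFinset u) : adjInd G x y = 0 := by
  simp only [mem_inter, SimpleGraph.mem_neighborFinset] at hx hy
  refine if_neg fun hxy => hK4 {v, u, x, y} ?_
  refine (SimpleGraph.is3Clique_triple_iff.mpr ⟨hx.2, hy.2, hxy⟩).insert ?_
  simp [huv, hx.1, hy.1]

/-- Apply the density hypothesis to the non-neighbours of `v` together with common neighbours of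
`u` and `v` sending few edges to them. -/
lemma codeg_mul_le (hK4 : G.CliqueFree 4) {β : ℝ}
    (hβ : ∀ S : Finset V, S.card = Fintype.card V / 2 → β ≤ edgesIn G S)
    (hdeg : ∀ v, Fintype.card V ≤ 2 * G.degree v) {u v : V} (huv : G.Adj v u) :
    codeg G v u * (2 * β) ≤
      codeg G v u * ∑ x ∈ (G.neighborFinset v)ᶜ, (G.degree x - codeg G v x)
      + (2 * G.degree v - Fintype.card V)
        * ∑ x, adjInd G v x * (adjInd G u x * (G.degree x - codeg G v x)) := by
  set N := G.neighborFinset v with hN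
  set I := N ∩ G.neighborFinset u with hI
  set f : V → ℝ := fun x => G.degree x - codeg G v x with hf
  have hf' : ∀ x, f x = ∑ y ∈ Nᶜ, adjInd G x y :=
    fun x => (sum_compl_neighborFinset_adjInd G v x).symm
  have hf0 : ∀ x, 0 ≤ f x := fun x => by
    rw [hf']; exact sum_nonneg fun y _ => adjInd_nonneg G x y
  have hNc : N.card = G.degree v := G.card_neighborFinset_eq_degree v
  have hCc : Nᶜ.card = Fintype.card V - G.degree v := by rw [card_compl, hNc]
  have hdv := hdeg v
  have hdu := hdeg u
  have hdn : G.degree v ≤ Fintype.card V := by rw [← hNc]; exact card_le_univ _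
  have hIc : G.degree v + G.degree u ≤ I.card + Fintype.card V := by
    have := card_union_add_card_inter N (G.neighborFinset u)
    rw [hNc, G.card_neighborFinset_eq_degree, ← hI] at this
    have := card_le_univ (N ∪ G.neighborFinset u)
    omega
  obtain ⟨j, hj⟩ : ∃ j, j = Fintype.card V / 2 - (Fintype.card V - G.degree v) := ⟨_, rfl⟩
  obtain ⟨J, hJI, hJc, hJ⟩ := exists_subset_card_eq_mul_sum_le f I j (by omega)
  have hdisj : Disjoint Nᶜ J :=
    disjoint_compl_left.mono_right (hJI.trans inter_subset_left)
  have hS := hβ (Nᶜ ∪ J) (by rw [card_union_of_disjoint hdisj, hCc, hJc]; omega)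
  have hS2 := two_mul_edgesIn_le G (Nᶜ ∪ J)
  have hJJ : ∑ x ∈ J, ∑ y ∈ J, adjInd G x y = 0 :=
    sum_eq_zero fun x hx => sum_eq_zero fun y hy =>
      adjInd_eq_zero_of_cliqueFree G hK4 huv (hJI hx) (hJI hy)
  have hCJ : ∑ x ∈ Nᶜ, ∑ y ∈ J, adjInd G x y = ∑ x ∈ J, f x := by
    rw [sum_comm]
    exact sum_congr rfl fun y _ => by rw [hf']; simp only [adjInd_comm G y]
  simp only [sum_union hdisj, sum_add_distrib, hJJ, hCJ, ← hf'] at hS2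
  have hIf : ∑ x, adjInd G v x * (adjInd G u x * f x) = ∑ x ∈ I, f x := by
    rw [sum_adjInd_mul, hI, ← filter_mem_eq_inter, sum_filter]
    simp [adjInd, hN]
  have hj2 : (2 * j : ℝ) ≤ 2 * G.degree v - Fintype.card V := by
    have : 2 * j + Fintype.card V ≤ 2 * G.degree v := by omega
    have : (2 * j + Fintype.card V : ℝ) ≤ 2 * G.degree v := by exact_mod_cast this
    linarith
  change _ ≤ codeg G v u * ∑ x ∈ Nᶜ, f x + _ * ∑ x, adjInd G v x * (adjInd G u x * f x)
  rw [hIf, codeg_eq_card]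
  have h1 := mul_le_mul_of_nonneg_right hj2 (sum_nonneg fun x (_ : x ∈ I) => hf0 x)
  have h2 : 2 * β ≤ ∑ x ∈ Nᶜ, f x + 2 * ∑ x ∈ J, f x := by linarith
  have h3 := mul_le_mul_of_nonneg_left h2 (Nat.cast_nonneg (α := ℝ) I.card)
  linarith

/-- The neighbourhood of any vertex contains a half of the vertex set. -/
lemma two_mul_le_sum_codeg {β : ℝ}
    (hβ : ∀ S : Finset V, S.card = Fintype.card V / 2 → β ≤ edgesIn G S)
    (hdeg : ∀ v, Fintype.card V ≤ 2 * G.degree v) (v : V) :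
    2 * β ≤ ∑ x, adjInd G v x * codeg G v x := by
  have hdv := hdeg v
  obtain ⟨T, hT, hTc⟩ := exists_subset_card_eq (s := G.neighborFinset v)
    (n := Fintype.card V / 2) (by rw [G.card_neighborFinset_eq_degree]; omega)
  have h1 := hβ T hTc
  have h2 := two_mul_edgesIn_le G T
  have h3 : ∑ x ∈ T, ∑ y ∈ T, adjInd G x y ≤ ∑ x, adjInd G v x * codeg G v x := by
    rw [sum_adjInd_mul]
    simp only [codeg, sum_adjInd_mul]
    refine (sum_le_sum fun x _ => ?_).trans (sum_le_sum_of_subset_of_nonneg hT fun x _ _ => ?_)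
    · exact sum_le_sum_of_subset_of_nonneg hT fun y _ _ => adjInd_nonneg G x y
    · exact sum_nonneg fun y _ => adjInd_nonneg G x y
  linarith

/-- The bounds of `codeg_mul_le`, summed over all neighbours `u` of `v`. -/
lemma sum_codeg_mul_le (hK4 : G.CliqueFree 4) {β : ℝ}
    (hβ : ∀ S : Finset V, S.card = Fintype.card V / 2 → β ≤ edgesIn G S)
    (hdeg : ∀ v, Fintype.card V ≤ 2 * G.degree v) (v : V) :
    (∑ x, adjInd G v x * codeg G v x) * (2 * β) ≤
      (∑ x, adjInd G v x * codeg G v x)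
        * (2 * (G.edgeFinset.card : ℝ) - 2 * ∑ x, adjInd G v x * G.degree x
          + ∑ x, adjInd G v x * codeg G v x)
      + (2 * G.degree v - Fintype.card V)
        * ∑ x, adjInd G v x * (codeg G v x * (G.degree x - codeg G v x)) := by
  have h1 : ∀ u, adjInd G v u * codeg G v u * (2 * β) ≤
      adjInd G v u * codeg G v u
        * ∑ x ∈ (G.neighborFinset v)ᶜ, (G.degree x - codeg G v x)
      + (2 * G.degree v - Fintype.card V) * (adjInd G v u
        * ∑ x, adjInd G v x * (adjInd G u x * (G.degree x - codeg G v x))) := fun u => by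
    by_cases huv : G.Adj v u
    · have : adjInd G v u = 1 := if_pos huv
      simpa only [this, one_mul] using codeg_mul_le G hK4 hβ hdeg huv
    · have : adjInd G v u = 0 := if_neg huv
      simp [this]
  have h2 := sum_le_sum fun u (_ : u ∈ univ) => h1 u
  simp only [sum_add_distrib, ← sum_mul, sum_compl_neighborFinset] at h2
  rw [← mul_sum] at h2
  have h3 : ∑ u, adjInd G v u
        * ∑ x, adjInd G v x * (adjInd G u x * (G.degree x - codeg G v x))
      = ∑ x, adjInd G v x * (codeg G v x * (G.degree x - codeg G v x)) := by
    simp only [mul_sum]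
    rw [sum_comm]
    refine sum_congr rfl fun x _ => ?_
    generalize hb : (G.degree x : ℝ) - codeg G v x = b
    rw [codeg, sum_mul, mul_sum]
    exact sum_congr rfl fun u _ => by rw [adjInd_comm G u x]; ring
  rwa [h3] at h2

end Graph

/-- A `K₄`-free graph on `n` vertices with `cn²` edges, all degrees between `n/2`
and `9n/14`, in which every vertex set of size `⌊n/2⌋` spans at least `n²/18` edges, has at
least `cn³/(27(1 − 2c))` triangles. -/
theorem many_triangles {n : ℕ} {c : ℝ} (G : SimpleGraph (Fin n)) [DecidableRel G.Adj]
    (hK4 : G.CliqueFree 4) (he : (G.edgeFinset.card : ℝ) = c * (n : ℝ) ^ 2)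
    (hdeg : ∀ v, (n : ℝ) / 2 ≤ (G.degree v : ℝ) ∧ (G.degree v : ℝ) ≤ 9 * (n : ℝ) / 14)
    (hsparse : ∀ S : Finset (Fin n), S.card = n / 2 →
      (n : ℝ) ^ 2 / 18 ≤ (edgesIn G S : ℝ)) :
    c * (n : ℝ) ^ 3 / (27 * (1 - 2 * c)) ≤ ((G.cliqueFinset 3).card : ℝ) := by
  rcases Nat.eq_zero_or_pos n with rfl | hn
  · simp
  have hn' : (0 : ℝ) < n := by exact_mod_cast hn
  have hdeg2 : ∀ v, Fintype.card (Fin n) ≤ 2 * G.degree v := fun v => by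
    have h : (n : ℝ) ≤ 2 * G.degree v := by linarith [(hdeg v).1]
    rw [Fintype.card_fin]; exact_mod_cast h
  have hβ : ∀ S : Finset (Fin n), S.card = Fintype.card (Fin n) / 2 →
      (n : ℝ) ^ 2 / 18 ≤ (edgesIn G S : ℝ) := by simpa using hsparse
  obtain ⟨w, hw⟩ : ∃ w : ℝ, w = (n : ℝ)⁻¹ := ⟨_, rfl⟩
  have hwn : w * n = 1 := by rw [hw]; exact inv_mul_cancel₀ hn'.ne'
  have hw0 : 0 < w := by rw [hw]; positivity
  have hwn2 : w ^ 2 * (n : ℝ) ^ 2 = 1 := by rw [← mul_pow, hwn, one_pow]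
  set S : Fin n → ℝ := fun v => w * ∑ x, adjInd G v x * (w * codeg G v x) with hS
  have hS' : ∀ v, S v = w ^ 2 * ∑ x, adjInd G v x * codeg G v x := fun v => by
    simp only [hS, mul_sum]; exact sum_congr rfl fun x _ => by ring
  have hlo : ∀ v, 1 / 2 ≤ w * (G.degree v : ℝ) := fun v => by
    have := mul_le_mul_of_nonneg_left (hdeg v).1 hw0.le
    linarith
  have hhi : ∀ v, w * (G.degree v : ℝ) ≤ 9 / 14 := fun v => by
    have := mul_le_mul_of_nonneg_left (hdeg v).2 hw0.le
    linarith
  have hsum : ∑ v, (G.degree v : ℝ) = 2 * (c * (n : ℝ) ^ 2) := by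
    rw [← he]; exact_mod_cast G.sum_degrees_eq_twice_card_edges
  have hmain := average_lower_bound (adjInd G) (adjInd_comm G) (adjInd_mul_self G) w (2 * c) hw0
    (by simpa using hwn) (fun v => w * G.degree v) S (fun v => by rw [sum_adjInd])
    (by rw [← mul_sum, hsum]; linear_combination -(2 * c) * hwn2) hlo hhi (fun v => by
      refine vertex_lower_bound (adjInd G v) (fun x => w * codeg G v x) (fun x => w * G.degree x)
        w (2 * c) (w * G.degree v) (S v) hw0 (adjInd_nonneg G v) (by rw [sum_adjInd]) rfl ?_
        (hlo v) (hhi v) ?_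
      · have := mul_le_mul_of_nonneg_left (two_mul_le_sum_codeg G hβ hdeg2 v) (sq_nonneg w)
        rw [hS']; linarith
      · have h1 := sum_codeg_mul_le G hK4 hβ hdeg2 v
        have h2 : w * ∑ x, adjInd G v x * (w * G.degree x)
            = w ^ 2 * ∑ x, adjInd G v x * G.degree x := by
          simp only [mul_sum]; exact sum_congr rfl fun x _ => by ring
        have h3 : w * ∑ x, adjInd G v x * (w * codeg G v x * (w * G.degree x - w * codeg G v x))
            = w ^ 3 * ∑ x, adjInd G v x * (codeg G v x * (G.degree x - codeg G v x)) := by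
          simp only [mul_sum]; exact sum_congr rfl fun x _ => by ring
        rw [h2, h3, hS']
        rw [he, Fintype.card_fin] at h1
        have h4 := mul_le_mul_of_nonneg_left h1 (pow_nonneg hw0.le 4)
        generalize ∑ x, adjInd G v x * codeg G v x = a at *
        generalize ∑ x, adjInd G v x * (G.degree x : ℝ) = b at *
        generalize ∑ x, adjInd G v x * (codeg G v x * (G.degree x - codeg G v x)) = m at *
        have e1 : w ^ 4 * (a * (2 * ((n : ℝ) ^ 2 / 18))) = w ^ 2 * a / 9 := by
          linear_combination w ^ 2 * a / 9 * hwn2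
        have e2 : w ^ 4 * (a * (2 * (c * (n : ℝ) ^ 2) - 2 * b + a)
            + (2 * G.degree v - n) * m) = w ^ 2 * a * (2 * c - 2 * (w ^ 2 * b) + w ^ 2 * a)
            + (2 * (w * G.degree v) - 1) * (w ^ 3 * m) := by
          linear_combination w ^ 2 * a * 2 * c * hwn2 - w ^ 3 * m * hwn
        rw [e1, e2] at h4
        linarith)
  have hT := sum_codegree_le_six_mul_triangles G
  have hT' : w * ∑ v, S v ≤ w ^ 3 * (6 * ((G.cliqueFinset 3).card : ℝ)) := by
    have : w * ∑ v, S v = w ^ 3 * ∑ v, ∑ x, adjInd G v x * codeg G v x := by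
      simp only [hS', ← mul_sum]; ring
    rw [this]; gcongr
  have hfin := mul_le_mul_of_nonneg_left (hmain.trans hT') (pow_nonneg hn'.le 3)
  have e1 : (n : ℝ) ^ 3 * (w ^ 3 * (6 * ((G.cliqueFinset 3).card : ℝ)))
      = 6 * ((G.cliqueFinset 3).card : ℝ) := by
    rw [← mul_assoc, ← mul_pow, mul_comm (n : ℝ), hwn]; ring
  have e2 : (n : ℝ) ^ 3 * (2 * c / (9 * (1 - 2 * c)))
      = 6 * (c * (n : ℝ) ^ 3 / (27 * (1 - 2 * c))) := by
    simp only [div_eq_mul_inv, mul_inv]; ring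
  rw [e1, e2] at hfin
  linarith
end

section
/- Let G be a graph with e ≥ 1 edges and m ≥ 1 triangles. Then G contains a triangle on vertices u, v, w such that d(uv) + d(vw) + d(wu) ≥ 9m/e, where d(xy) denotes the number of common neighbors of x and y. -/
open Finset

namespace SimpleGraph

variable {V : Type*} [Fintype V] (G : SimpleGraph V) [DecidableRel G.Adj]

/-- The ordered pairs of adjacent vertices. -/
def adjPairs : Finset (V × V) := univ.filter fun p => G.Adj p.1 p.2

lemma card_adjPairs : G.adjPairs.card = 2 * G.edgeFinset.card := by
  rw [← G.sum_degrees_eq_twice_card_edges, adjPairs, ← univ_product_univ, card_filter,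
    sum_product]
  refine sum_congr rfl fun u _ => ?_
  rw [← card_filter, ← card_neighborFinset_eq_degree, neighborFinset_eq_filter]

variable [DecidableEq V]

/-- The number of common neighbours of the two entries of a pair. -/
def pairCodegree (p : V × V) : ℕ := (G.neighborFinset p.1 ∩ G.neighborFinset p.2).card

/-- The ordered triangles, as an ordered pair of adjacent vertices and a common neighbour. -/
def orderedTriangles : Finset (Σ _ : V × V, V) :=
  G.adjPairs.sigma fun p => G.neighborFinset p.1 ∩ G.neighborFinset p.2

lemma mem_orderedTriangles {t : Σ _ : V × V, V} :
    t ∈ G.orderedTriangles ↔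
      G.Adj t.1.1 t.1.2 ∧ G.Adj t.1.1 t.2 ∧ G.Adj t.1.2 t.2 := by
  simp [orderedTriangles, adjPairs]

lemma sum_orderedTriangles (f : V × V → ℝ) :
    ∑ t ∈ G.orderedTriangles, f t.1 = ∑ p ∈ G.adjPairs, G.pairCodegree p * f p := by
  simp [orderedTriangles, sum_sigma, pairCodegree]

lemma sum_orderedTriangles_rotate (f : V × V → ℝ) :
    ∑ t ∈ G.orderedTriangles, f (t.1.2, t.2) = ∑ t ∈ G.orderedTriangles, f t.1 := by
  refine sum_nbij' (fun t => ⟨(t.1.2, t.2), t.1.1⟩) (fun t => ⟨(t.2, t.1.1), t.1.2⟩) ?_ ?_ ?_ ?_ ?_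
  all_goals simp +contextual [mem_orderedTriangles, G.adj_comm]

lemma sum_orderedTriangles_rotate_symm (f : V × V → ℝ) :
    ∑ t ∈ G.orderedTriangles, f (t.2, t.1.1) = ∑ t ∈ G.orderedTriangles, f t.1 := by
  refine sum_nbij' (fun t => ⟨(t.2, t.1.1), t.1.2⟩) (fun t => ⟨(t.1.2, t.2), t.1.1⟩) ?_ ?_ ?_ ?_ ?_
  all_goals simp +contextual [mem_orderedTriangles, G.adj_comm]

lemma six_mul_card_cliqueFinset_le :
    6 * (G.cliqueFinset 3).card ≤ G.orderedTriangles.card := by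
  have hmaps : ∀ t ∈ G.orderedTriangles,
      ({t.1.1, t.1.2, t.2} : Finset V) ∈ G.cliqueFinset 3 := by
    intro t ht
    rw [mem_orderedTriangles] at ht
    rw [mem_cliqueFinset_iff, is3Clique_triple_iff]
    exact ht
  rw [card_eq_sum_card_fiberwise hmaps, mul_comm, ← smul_eq_mul]
  refine card_nsmul_le_sum _ _ _ fun s hs => ?_
  obtain ⟨a, b, c, hab, hac, hbc, rfl⟩ := is3Clique_iff.1 ((mem_cliqueFinset_iff).1 hs)
  have hsub : ({⟨(a, b), c⟩, ⟨(a, c), b⟩, ⟨(b, a), c⟩, ⟨(b, c), a⟩, ⟨(c, a), b⟩, ⟨(c, b), a⟩} :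
      Finset (Σ _ : V × V, V)) ⊆
      G.orderedTriangles.filter fun t => ({t.1.1, t.1.2, t.2} : Finset V) = {a, b, c} := by
    intro t ht
    simp only [mem_insert, mem_singleton] at ht
    rw [mem_filter, mem_orderedTriangles]
    rcases ht with rfl | rfl | rfl | rfl | rfl | rfl <;>
      refine ⟨by simp [hab, hac, hbc, hab.symm, hac.symm, hbc.symm], ?_⟩ <;>
      ext x <;> simp <;> tauto
  refine le_trans (le_of_eq ?_) (card_le_card hsub)
  simp [card_insert_of_notMem, hab.ne, hac.ne, hbc.ne, hab.ne.symm, hac.ne.symm, hbc.ne.symm]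

lemma sq_card_orderedTriangles_le :
    (G.orderedTriangles.card : ℝ) ^ 2 ≤
      2 * G.edgeFinset.card * ∑ t ∈ G.orderedTriangles, (G.pairCodegree t.1 : ℝ) := by
  have hcard : (G.orderedTriangles.card : ℝ) = ∑ p ∈ G.adjPairs, (G.pairCodegree p : ℝ) := by
    simpa using G.sum_orderedTriangles fun _ => 1
  have hcauchy := sq_sum_le_card_mul_sum_sq (s := G.adjPairs) (f := fun p => (G.pairCodegree p : ℝ))
  rw [G.sum_orderedTriangles fun p => (G.pairCodegree p : ℝ), hcard]
  simpa [card_adjPairs, sq] using hcauchy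

end SimpleGraph

/-- A graph with `e ≥ 1` edges and `m ≥ 1` triangles contains a triangle `uvw`
with `d(uv) + d(vw) + d(wu) ≥ 9m/e`. -/
theorem exists_triangle_large_codegree_sum {V : Type*} [Fintype V] [DecidableEq V]
    (G : SimpleGraph V) [DecidableRel G.Adj]
    (he : 1 ≤ G.edgeFinset.card) (hm : 1 ≤ (G.cliqueFinset 3).card) :
    ∃ u v w : V, G.Adj u v ∧ G.Adj v w ∧ G.Adj w u ∧
      9 * ((G.cliqueFinset 3).card : ℝ) / (G.edgeFinset.card : ℝ) ≤
        ((G.neighborFinset u ∩ G.neighborFinset v).card : ℝ)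
          + ((G.neighborFinset v ∩ G.neighborFinset w).card : ℝ)
          + ((G.neighborFinset w ∩ G.neighborFinset u).card : ℝ) := by
  have he' : (0 : ℝ) < G.edgeFinset.card := by exact_mod_cast he
  have hsix : 6 * ((G.cliqueFinset 3).card : ℝ) ≤ G.orderedTriangles.card := by
    exact_mod_cast G.six_mul_card_cliqueFinset_le
  have hm' : (1 : ℝ) ≤ (G.cliqueFinset 3).card := by exact_mod_cast hm
  have hpos : (0 : ℝ) < G.orderedTriangles.card := by linarith
  let d : V × V → ℝ := fun p => G.pairCodegree p
  have hsum : ∑ t ∈ G.orderedTriangles, (d t.1 + d (t.1.2, t.2) + d (t.2, t.1.1)) =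
      3 * ∑ t ∈ G.orderedTriangles, d t.1 := by
    rw [sum_add_distrib, sum_add_distrib, G.sum_orderedTriangles_rotate d,
      G.sum_orderedTriangles_rotate_symm d]
    ring
  have havg : ∑ _t ∈ G.orderedTriangles,
      9 * ((G.cliqueFinset 3).card : ℝ) / (G.edgeFinset.card : ℝ) ≤
      ∑ t ∈ G.orderedTriangles, (d t.1 + d (t.1.2, t.2) + d (t.2, t.1.1)) := by
    rw [hsum, sum_const, nsmul_eq_mul, mul_div_assoc', div_le_iff₀ he']
    have hsq : (G.orderedTriangles.card : ℝ) ^ 2 ≤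
      2 * G.edgeFinset.card * ∑ t ∈ G.orderedTriangles, d t.1 := G.sq_card_orderedTriangles_le
    nlinarith [mul_le_mul_of_nonneg_left hsix hpos.le]
  obtain ⟨⟨⟨u, v⟩, w⟩, ht, hle⟩ :=
    exists_le_of_sum_le (card_pos.1 (by exact_mod_cast hpos)) havg
  obtain ⟨huv, huw, hvw⟩ := G.mem_orderedTriangles.1 ht
  exact ⟨u, v, w, huv, hvw, huw.symm, hle⟩
end
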